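/- arXiv:1209.3867 — 5 statements merged into one kernel-verified Lean document; each statement's English description precedes it below -/
import Mathlib

section
/- The function t ↦ 1/Ai(it), defined on the real line (with values in ℂ), belongs to the Schwartz class of rapidly decreasing smooth functions; that is, every derivative of t ↦ 1/Ai(it) decreases faster than any negative power of |t| as t → ±∞. -/
/-- A real function with nonnegative derivative on `[0, ∞)` is monotone there. -/
lemma le_of_hasDerivAt_nonneg_Ici {h h' : ℝ → ℝ} (hd : ∀ t, HasDerivAt h (h' t) t)
    (h0 : ∀ t, 0 ≤ t → 0 ≤ h' t) {s t : ℝ} (hs : 0 ≤ s) (hst : s ≤ t) : h s ≤ h t := by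
  refine monotoneOn_of_deriv_nonneg (convex_Ici (0 : ℝ))
    (fun x _ => (hd x).continuousAt.continuousWithinAt)
    (fun x _ => (hd x).differentiableAt.differentiableWithinAt) ?_
    (Set.mem_Ici.2 hs) (Set.mem_Ici.2 (hs.trans hst)) hst
  intro x hx
  rw [interior_Ici] at hx
  rw [(hd x).deriv]
  exact h0 x (le_of_lt hx)

/-- Integrating a lower bound by a monomial. -/
lemma exists_pow_le_of_hasDerivAt {h h' : ℝ → ℝ} (hd : ∀ t, HasDerivAt h (h' t) t)
    (h0 : 0 ≤ h 0) {k : ℕ} (hk : ∃ c > 0, ∀ t, 0 ≤ t → c * t ^ k ≤ h' t) :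
    ∃ c > 0, ∀ t, 0 ≤ t → c * t ^ (k + 1) ≤ h t := by
  obtain ⟨c, hc, hb⟩ := hk
  refine ⟨c / (k + 1), by positivity, fun t ht => ?_⟩
  have hd' : ∀ t, HasDerivAt (fun t => h t - c / (k + 1) * t ^ (k + 1)) (h' t - c * t ^ k) t := by
    intro t
    refine ((hd t).sub ((hasDerivAt_pow (k + 1) t).const_mul (c / (k + 1)))).congr_deriv ?_
    have : (k : ℝ) + 1 ≠ 0 := by positivity
    simp only [Nat.cast_add, Nat.cast_one, Nat.add_sub_cancel]
    field_simp
  have := le_of_hasDerivAt_nonneg_Ici hd' (fun t ht => sub_nonneg.2 (hb t ht)) le_rfl ht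
  simp only [ne_eq, Nat.add_eq_zero_iff, one_ne_zero, and_false, not_false_eq_true, zero_pow,
    mul_zero, sub_zero] at this
  linarith

/-- Growth on `[0, ∞)` of solutions `u = x + iy` of `u'' = -itu`, in real coordinates. -/
lemma growth_real {x y X Y : ℝ → ℝ} (hx : ∀ t, HasDerivAt x (X t) t)
    (hy : ∀ t, HasDerivAt y (Y t) t) (hX : ∀ t, HasDerivAt X (t * y t) t)
    (hY : ∀ t, HasDerivAt Y (-(t * x t)) t) (hx0 : 0 < x 0) (hy0 : y 0 = 0) (hX0 : X 0 = 0)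
    (hY0 : Y 0 < 0) :
    (∀ n : ℕ, ∃ C, 0 ≤ C ∧ ∀ t, 0 ≤ t → (1 + t) ^ n ≤ C * (x t ^ 2 + y t ^ 2)) ∧
      ∃ C, 0 ≤ C ∧
        ∀ t, 0 ≤ t → X t ^ 2 + Y t ^ 2 ≤ C * (1 + t) ^ 4 * (x t ^ 2 + y t ^ 2) := by
  set w : ℝ → ℝ := fun t => x t ^ 2 + y t ^ 2 with hw
  set a : ℝ → ℝ := fun t => x t * X t + y t * Y t with ha
  set e : ℝ → ℝ := fun t => X t ^ 2 + Y t ^ 2 with he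
  set M : ℝ → ℝ := fun t => X t * y t - Y t * x t with hM
  have dw : ∀ t, HasDerivAt w (2 * a t) t := fun t =>
    (((hx t).pow 2).add ((hy t).pow 2)).congr_deriv (by simp only [ha]; push_cast; ring)
  have da : ∀ t, HasDerivAt a (e t) t := fun t =>
    (((hx t).mul (hX t)).add ((hy t).mul (hY t))).congr_deriv (by simp only [he]; ring)
  have de : ∀ t, HasDerivAt e (2 * t * M t) t := fun t =>
    (((hX t).pow 2).add ((hY t).pow 2)).congr_deriv (by simp only [hM]; push_cast; ring)
  have dM : ∀ t, HasDerivAt M (t * w t) t := fun t =>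
    (((hX t).mul (hy t)).sub ((hY t).mul (hx t))).congr_deriv (by simp only [hw]; ring)
  have w0 : 0 < w 0 := by simp only [hw]; positivity
  have a0 : a 0 = 0 := by simp [ha, hy0, hX0]
  have e0 : 0 ≤ e 0 := by simp only [he]; positivity
  have M0 : 0 < M 0 := by simp only [hM, hX0]; nlinarith
  have wnn : ∀ t, 0 ≤ w t := fun t => by simp only [hw]; positivity
  have ann : ∀ t, 0 ≤ t → 0 ≤ a t := fun t ht => a0 ▸
    le_of_hasDerivAt_nonneg_Ici da (fun t _ => by simp only [he]; positivity) le_rfl ht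
  have wmono : ∀ {t}, 0 ≤ t → w 0 ≤ w t := fun ht =>
    le_of_hasDerivAt_nonneg_Ici dw (fun t ht => mul_nonneg zero_le_two (ann t ht)) le_rfl ht
  have low : ∀ n : ℕ, ∃ c > 0, ∀ t, 0 ≤ t → c * t ^ (6 * n) ≤ w t := by
    intro n
    induction n with
    | zero => exact ⟨w 0, w0, fun t ht => by simpa using wmono ht⟩
    | succ n ih =>
      obtain ⟨c, hc, h1⟩ := ih
      obtain ⟨c, hc, h2⟩ := exists_pow_le_of_hasDerivAt (k := 6 * n + 1) dM M0.le
        ⟨c, hc, fun t ht => by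
          calc _ = t * (c * t ^ (6 * n)) := by ring
            _ ≤ _ := mul_le_mul_of_nonneg_left (h1 t ht) ht⟩
      have h3 := exists_pow_le_of_hasDerivAt (k := 6 * n + 3) de e0
        ⟨2 * c, by positivity, fun t ht => by
          calc _ = 2 * t * (c * t ^ (6 * n + 1 + 1)) := by ring
            _ ≤ _ := mul_le_mul_of_nonneg_left (h2 t ht) (mul_nonneg zero_le_two ht)⟩
      obtain ⟨c, hc, h4⟩ := exists_pow_le_of_hasDerivAt da a0.ge h3
      exact exists_pow_le_of_hasDerivAt (k := 6 * n + 5) dw w0.le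
        ⟨2 * c, by positivity, fun t ht => by linarith [h4 t ht]⟩
  constructor
  · intro n
    obtain ⟨c, hc, hl⟩ := low n
    refine ⟨2 ^ (6 * n - 1) * (1 / w 0 + 1 / c), by positivity, fun t ht => ?_⟩
    have h1 : (1 + t) ^ n ≤ (1 + t) ^ (6 * n) := pow_le_pow_right₀ (by linarith) (by omega)
    have h2 := add_pow_le zero_le_one ht (6 * n)
    have h3 : 1 ≤ 1 / w 0 * w t := by
      rw [one_div, inv_mul_eq_div, le_div_iff₀ w0, one_mul]; exact wmono ht
    have h4 : t ^ (6 * n) ≤ 1 / c * w t := by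
      rw [one_div, inv_mul_eq_div, le_div_iff₀ hc, mul_comm]; exact hl t ht
    calc (1 + t) ^ n ≤ 2 ^ (6 * n - 1) * (1 ^ (6 * n) + t ^ (6 * n)) := h1.trans h2
      _ ≤ 2 ^ (6 * n - 1) * (1 / w 0 * w t + 1 / c * w t) := by
        rw [one_pow]; gcongr
      _ = _ := by ring
  · refine ⟨e 0 / w 0 + (M 0 / w 0 + 1), by positivity, fun t ht => ?_⟩
    have Mnn : ∀ t, 0 ≤ t → 0 ≤ M t := fun t ht => M0.le.trans <|
      le_of_hasDerivAt_nonneg_Ici dM (fun t ht => mul_nonneg ht (wnn t)) le_rfl ht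
    have hM1 : M t ≤ M 0 + t ^ 2 * w t := by
      have := le_of_hasDerivAt_nonneg_Ici
        (fun s => ((hasDerivAt_pow 2 s).mul (dw s)).sub (dM s)) (fun s hs => by
          have h1 := ann s hs
          have h2 := wnn s
          have : 0 ≤ s * w s + s ^ 2 * (2 * a s) := by positivity
          norm_num
          linarith) le_rfl ht
      simp only [Pi.sub_apply, Pi.mul_apply] at this
      linarith
    have he1 : e t ≤ e 0 + t ^ 2 * M t := by
      have := le_of_hasDerivAt_nonneg_Ici
        (fun s => ((hasDerivAt_pow 2 s).mul (dM s)).sub (de s)) (fun s hs => by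
          have h2 := wnn s
          have : 0 ≤ s ^ 2 * (s * w s) := by positivity
          norm_num
          linarith) le_rfl ht
      simp only [Pi.sub_apply, Pi.mul_apply] at this
      linarith
    have h3 : 1 ≤ w t / w 0 := by
      rw [le_div_iff₀ w0, one_mul]; exact wmono ht
    have h4 : 1 ≤ (1 + t) ^ 4 := one_le_pow₀ (by linarith)
    have h5 : t ^ 2 ≤ (1 + t) ^ 4 := by
      nlinarith [mul_nonneg ht ht, pow_nonneg ht 3, pow_nonneg ht 4]
    have h6 : t ^ 4 ≤ (1 + t) ^ 4 := by gcongr; linarith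
    calc e t ≤ e 0 + t ^ 2 * (M 0 + t ^ 2 * w t) := he1.trans (by gcongr)
      _ = 1 * (e 0 * 1) + t ^ 2 * (M 0 * 1) + t ^ 4 * w t := by ring
      _ ≤ (1 + t) ^ 4 * (e 0 * (w t / w 0)) + (1 + t) ^ 4 * (M 0 * (w t / w 0))
          + (1 + t) ^ 4 * w t := by
        have := wnn t
        gcongr
      _ = (e 0 / w 0 + (M 0 / w 0 + 1)) * (1 + t) ^ 4 * w t := by ring

/-- Growth on `[0, ∞)` of solutions of `u'' = -itu` with data of Airy type at the origin. -/
lemma growth_nonneg {u v : ℝ → ℂ} (hu : ∀ t, HasDerivAt u (v t) t)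
    (hv : ∀ t : ℝ, HasDerivAt v (-(Complex.I * t * u t)) t) {p q : ℝ} (hp : 0 < p) (hq : q < 0)
    (hu0 : u 0 = p) (hv0 : v 0 = Complex.I * q) :
    (∀ n : ℕ, ∃ C, 0 ≤ C ∧ ∀ t, 0 ≤ t → (1 + t) ^ n ≤ C * ‖u t‖ ^ 2) ∧
      ∃ C, 0 ≤ C ∧ ∀ t, 0 ≤ t → ‖v t‖ ^ 2 ≤ C * (1 + t) ^ 4 * ‖u t‖ ^ 2 := by
  have re {f : ℝ → ℂ} {f' : ℂ} {t : ℝ} (h : HasDerivAt f f' t) :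
      HasDerivAt (fun t => (f t).re) f'.re t := Complex.reCLM.hasFDerivAt.comp_hasDerivAt t h
  have im {f : ℝ → ℂ} {f' : ℂ} {t : ℝ} (h : HasDerivAt f f' t) :
      HasDerivAt (fun t => (f t).im) f'.im t := Complex.imCLM.hasFDerivAt.comp_hasDerivAt t h
  have := growth_real (fun t => re (hu t)) (fun t => im (hu t))
    (fun t => (re (hv t)).congr_deriv (by simp))
    (fun t => (im (hv t)).congr_deriv (by simp)) (by simpa [hu0]) (by simp [hu0])
    (by simp [hv0]) (by simpa [hv0])
  simpa only [Complex.sq_norm, Complex.normSq_apply, ← sq] using this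

/-- Growth on the real line of solutions of `u'' = -itu` with data of Airy type at the origin. -/
lemma growth {u v : ℝ → ℂ} (hu : ∀ t, HasDerivAt u (v t) t)
    (hv : ∀ t : ℝ, HasDerivAt v (-(Complex.I * t * u t)) t) {p q : ℝ} (hp : 0 < p) (hq : q < 0)
    (hu0 : u 0 = p) (hv0 : v 0 = Complex.I * q) :
    (∀ n : ℕ, ∃ C, 0 ≤ C ∧ ∀ t, (1 + |t|) ^ n ≤ C * ‖u t‖) ∧
      ∃ C, 0 ≤ C ∧ ∀ t, ‖v t‖ ≤ C * (1 + |t|) ^ 2 * ‖u t‖ := by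
  obtain ⟨h1, C, hC, h2⟩ := growth_nonneg hu hv hp hq hu0 hv0
  have hu' : ∀ t, HasDerivAt (fun t => star (u (-t))) (-star (v (-t))) t := fun t => by
    have := ((hu (-t)).scomp t (hasDerivAt_neg t)).star
    exact this.congr_deriv (by simp)
  have hv' : ∀ t : ℝ, HasDerivAt (fun t => -star (v (-t)))
      (-(Complex.I * t * star (u (-t)))) t := fun t => by
    have := ((hv (-t)).scomp t (hasDerivAt_neg t)).star.neg
    exact this.congr_deriv (by simp)
  obtain ⟨h1', C', hC', h2'⟩ := growth_nonneg hu' hv' hp hq (by simp [hu0]) (by simp [hv0])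
  simp only [norm_star, norm_neg] at h1' h2'
  constructor
  · intro n
    obtain ⟨D, hD, h⟩ := h1 (n * 2)
    obtain ⟨D', hD', h'⟩ := h1' (n * 2)
    refine ⟨√(D + D'), Real.sqrt_nonneg _, fun t => ?_⟩
    rw [← sq_le_sq₀ (by positivity) (by positivity), ← pow_mul, mul_pow,
      Real.sq_sqrt (by positivity)]
    rcases le_total 0 t with ht | ht
    · rw [abs_of_nonneg ht]
      exact (h t ht).trans (by gcongr; linarith)
    · have := h' (-t) (neg_nonneg.2 ht)
      rw [neg_neg] at this
      rw [abs_of_nonpos ht]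
      exact this.trans (by gcongr; linarith)
  · refine ⟨√(C + C'), Real.sqrt_nonneg _, fun t => ?_⟩
    rw [← sq_le_sq₀ (by positivity) (by positivity), mul_pow, mul_pow,
      Real.sq_sqrt (by positivity), ← pow_mul]
    rcases le_total 0 t with ht | ht
    · rw [abs_of_nonneg ht]
      exact (h2 t ht).trans (by gcongr; linarith)
    · have := h2' (-t) (neg_nonneg.2 ht)
      rw [neg_neg] at this
      rw [abs_of_nonpos ht]
      refine this.trans ?_
      have : 0 ≤ 1 + -t := by linarith
      gcongr
      linarith

/-- The reciprocal of a solution of `u'' = -itu` with data of Airy type is a Schwartz function. -/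
lemma exists_schwartz_inv {u v : ℝ → ℂ} (hu : ∀ t, HasDerivAt u (v t) t)
    (hv : ∀ t : ℝ, HasDerivAt v (-(Complex.I * t * u t)) t) (hs : ContDiff ℝ ⊤ u)
    {p q : ℝ} (hp : 0 < p) (hq : q < 0) (hu0 : u 0 = p) (hv0 : v 0 = Complex.I * q) :
    ∃ φ : SchwartzMap ℝ ℂ, ∀ t : ℝ, φ t = (u t)⁻¹ := by
  obtain ⟨hgrow, C₀, hC₀, hlog⟩ := growth hu hv hp hq hu0 hv0
  have une : ∀ t, u t ≠ 0 := fun t ht => by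
    obtain ⟨C, -, h⟩ := hgrow 0
    have := h t
    norm_num [ht] at this
  let r : ℝ → ℂ := fun t => v t / u t
  let τ : ℝ → ℂ := fun t => t
  have hr : ∀ t, HasDerivAt r (-(Complex.I * τ t) - r t * r t) t := fun t =>
    ((hv t).div (hu t) (une t)).congr_deriv (by
      have := une t
      simp only [r, τ]
      field_simp)
  have hτ : ∀ t, HasDerivAt τ 1 t := fun t => Complex.ofRealCLM.hasDerivAt
  have hf : ∀ t, HasDerivAt (fun t => (u t)⁻¹) (-r t * (u t)⁻¹) t := fun t =>
    ((hu t).inv (une t)).congr_deriv (by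
      have := une t
      simp only [r]
      field_simp)
  let A : Subalgebra ℂ (ℝ → ℂ) := Algebra.adjoin ℂ {τ, r}
  have τA : τ ∈ A := Algebra.subset_adjoin (by simp)
  have rA : r ∈ A := Algebra.subset_adjoin (by simp)
  have hder : ∀ g ∈ A, ∃ g' ∈ A, ∀ t, HasDerivAt g (g' t) t := by
    intro g hg
    induction hg using Algebra.adjoin_induction with
    | mem g hg =>
      rcases hg with rfl | rfl
      · exact ⟨1, A.one_mem, hτ⟩
      · exact ⟨-(Complex.I • τ) - r * r,
          A.sub_mem (A.neg_mem (A.smul_mem τA _)) (A.mul_mem rA rA), hr⟩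
    | algebraMap c => exact ⟨0, A.zero_mem, fun t => hasDerivAt_const t c⟩
    | add g h _ _ ihg ihh =>
      obtain ⟨g', hg', dg⟩ := ihg
      obtain ⟨h', hh', dh⟩ := ihh
      exact ⟨g' + h', A.add_mem hg' hh', fun t => (dg t).add (dh t)⟩
    | mul g h hg hh ihg ihh =>
      obtain ⟨g', hg', dg⟩ := ihg
      obtain ⟨h', hh', dh⟩ := ihh
      exact ⟨g' * h + g * h', A.add_mem (A.mul_mem hg' hh) (A.mul_mem hg hh'),
        fun t => (dg t).mul (dh t)⟩
  have hbound : ∀ g ∈ A, ∃ C, 0 ≤ C ∧ ∃ k : ℕ, ∀ t, ‖g t‖ ≤ C * (1 + |t|) ^ k := by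
    intro g hg
    induction hg using Algebra.adjoin_induction with
    | mem g hg =>
      rcases hg with rfl | rfl
      · exact ⟨1, zero_le_one, 1, fun t => by simp [τ]⟩
      · refine ⟨C₀, hC₀, 2, fun t => ?_⟩
        rw [norm_div, div_le_iff₀ (norm_pos_iff.2 (une t))]
        exact hlog t
    | algebraMap c => exact ⟨‖c‖, norm_nonneg _, 0, fun t => by simp⟩
    | add g h _ _ ihg ihh =>
      obtain ⟨C, hC, k, hg⟩ := ihg
      obtain ⟨D, hD, l, hh⟩ := ihh
      refine ⟨C + D, add_nonneg hC hD, k + l, fun t => ?_⟩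
      have h1 : 1 ≤ 1 + |t| := by linarith [abs_nonneg t]
      calc ‖g t + h t‖ ≤ C * (1 + |t|) ^ k + D * (1 + |t|) ^ l :=
            norm_add_le_of_le (hg t) (hh t)
        _ ≤ C * (1 + |t|) ^ (k + l) + D * (1 + |t|) ^ (k + l) := by
            gcongr <;> first | exact h1 | omega
        _ = _ := by ring
    | mul g h _ _ ihg ihh =>
      obtain ⟨C, hC, k, hg⟩ := ihg
      obtain ⟨D, hD, l, hh⟩ := ihh
      refine ⟨C * D, mul_nonneg hC hD, k + l, fun t => ?_⟩
      calc ‖g t * h t‖ ≤ C * (1 + |t|) ^ k * (D * (1 + |t|) ^ l) :=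
            norm_mul_le_of_le (hg t) (hh t)
        _ = _ := by ring
  have hiter : ∀ n : ℕ, ∃ g ∈ A, iteratedDeriv n (fun t => (u t)⁻¹) =
      fun t => g t * (u t)⁻¹ := by
    intro n
    induction n with
    | zero => exact ⟨1, A.one_mem, by simp⟩
    | succ n ih =>
      obtain ⟨g, hg, h⟩ := ih
      obtain ⟨g', hg', dg⟩ := hder g hg
      refine ⟨g' - g * r, A.sub_mem hg' (A.mul_mem hg rA), ?_⟩
      rw [iteratedDeriv_succ, h]
      funext t
      refine ((dg t).mul (hf t)).deriv.trans ?_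
      simp only [Pi.sub_apply, Pi.mul_apply]
      ring
  refine ⟨⟨fun t => (u t)⁻¹, (hs.inv une).of_le (by simp), fun k n => ?_⟩, fun t => rfl⟩
  obtain ⟨g, hg, h⟩ := hiter n
  obtain ⟨C, hC, m, hb⟩ := hbound g hg
  obtain ⟨D, hD, hd⟩ := hgrow (k + m)
  refine ⟨C * D, fun t => ?_⟩
  rw [norm_iteratedFDeriv_eq_norm_iteratedDeriv, h, norm_mul, norm_inv, Real.norm_eq_abs,
    ← mul_assoc, ← div_eq_mul_inv, div_le_iff₀ (norm_pos_iff.2 (une t))]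
  calc |t| ^ k * ‖g t‖ ≤ (1 + |t|) ^ k * (C * (1 + |t|) ^ m) := by
        gcongr
        · linarith
        · exact hb t
    _ = C * (1 + |t|) ^ (k + m) := by ring
    _ ≤ C * (D * ‖u t‖) := by gcongr; exact hd t
    _ = _ := by ring

theorem airy_inv_on_imaginary_axis_schwartz (Ai : ℂ → ℂ)
    (hAi_d1 : Differentiable ℂ Ai)
    (hAi_d2 : Differentiable ℂ (deriv Ai))
    (hAi_ode : ∀ z : ℂ, deriv (deriv Ai) z = z * Ai z)
    (hAi_0 : Ai 0 = (3 : ℂ) ^ (-(2 : ℂ) / 3) / Complex.Gamma (2 / 3))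
    (hAi_0' : deriv Ai 0 = -(3 : ℂ) ^ (-(1 : ℂ) / 3) / Complex.Gamma (1 / 3))
    (hAi_zeros : ∀ z : ℂ, Ai z = 0 → ∃ x : ℝ, x < 0 ∧ z = (x : ℂ)) :
    ∃ φ : SchwartzMap ℝ ℂ, ∀ t : ℝ, φ t = 1 / Ai (Complex.I * t) := by
  have hline : ∀ t : ℝ, HasDerivAt (fun t : ℝ => Complex.I * (t : ℂ)) Complex.I t := fun t =>
    ((Complex.ofRealCLM.hasDerivAt (x := t)).const_mul Complex.I).congr_deriv (by simp)
  have hp : (0 : ℝ) < 3 ^ (-2 / 3 : ℝ) / Real.Gamma (2 / 3) :=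
    div_pos (by positivity) (Real.Gamma_pos_of_pos (by norm_num))
  have hq : -(3 : ℝ) ^ (-1 / 3 : ℝ) / Real.Gamma (1 / 3) < 0 :=
    div_neg_of_neg_of_pos (neg_neg_of_pos (by positivity)) (Real.Gamma_pos_of_pos (by norm_num))
  have hs : ContDiff ℝ ⊤ (fun t : ℝ => Ai (Complex.I * t)) :=
    (hAi_d1.contDiff.restrict_scalars ℝ).comp
      (contDiff_const.mul Complex.ofRealCLM.contDiff)
  obtain ⟨φ, h⟩ := exists_schwartz_inv
    (u := fun t : ℝ => Ai (Complex.I * t)) (v := fun t : ℝ => Complex.I * deriv Ai (Complex.I * t))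
    (fun t => (hAi_d1 _).hasDerivAt.scomp t (hline t))
    (fun t => (((hAi_d2 _).hasDerivAt.scomp t (hline t)).const_mul Complex.I).congr_deriv (by
      rw [hAi_ode, smul_eq_mul]
      linear_combination (Complex.I * t * Ai (Complex.I * t)) * Complex.I_sq))
    hs hp hq (by
      simp only [Complex.ofReal_zero, mul_zero, hAi_0]
      rw [Complex.ofReal_div, ← Complex.Gamma_ofReal, Complex.ofReal_cpow (by norm_num)]
      push_cast
      rfl) (by
      simp only [Complex.ofReal_zero, mul_zero, hAi_0']
      rw [Complex.ofReal_div, ← Complex.Gamma_ofReal, Complex.ofReal_neg,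
        Complex.ofReal_cpow (by norm_num)]
      push_cast
      rfl)
  exact ⟨φ, fun t => by rw [h, one_div]⟩
end

section
/- For every real t, the Fourier transform of the Chernoff density f satisfies ∫_ℝ e^(itx) f(x) dx = (1/(2π)) ∫_ℝ ds /(Ai(i(t+s))·Ai(is)). -/
open MeasureTheory FourierTransform

lemma mul_pow_le_of_hasDerivAt_ge {u u' : ℝ → ℝ} (hu : ∀ t, HasDerivAt u (u' t) t)
    (h0 : 0 ≤ u 0) {c : ℝ} {n : ℕ} (h : ∀ t, 0 ≤ t → c * t ^ n ≤ u' t) {t : ℝ} (ht : 0 ≤ t) :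
    c / (n + 1) * t ^ (n + 1) ≤ u t := by
  have hd (s : ℝ) :
      HasDerivAt (fun s ↦ u s - c / (n + 1) * s ^ (n + 1)) (u' s - c * s ^ n) s := by
    refine ((hu s).sub ((hasDerivAt_pow (n + 1) s).const_mul (c / (n + 1)))).congr_deriv ?_
    have : (n + 1 : ℝ) ≠ 0 := by positivity
    push_cast
    field_simp
  have hmono : MonotoneOn (fun s ↦ u s - c / (n + 1) * s ^ (n + 1)) (Set.Ici 0) := by
    refine monotoneOn_of_deriv_nonneg (convex_Ici 0)
      (fun s _ ↦ (hd s).continuousAt.continuousWithinAt)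
      (fun s _ ↦ (hd s).differentiableAt.differentiableWithinAt) fun s hs ↦ ?_
    rw [(hd s).deriv]
    rw [interior_Ici] at hs
    linarith [h s (le_of_lt hs)]
  have := hmono (Set.mem_Ici.2 le_rfl) (Set.mem_Ici.2 ht) ht
  simp at this
  linarith

lemma complex_norm_sq_eq (z : ℂ) : ‖z‖ ^ 2 = z.re ^ 2 + z.im ^ 2 := by
  rw [Complex.sq_norm, Complex.normSq_apply]
  ring

lemma integrable_of_norm_le_inv_one_add_sq {F : ℝ → ℂ} (hF : AEStronglyMeasurable F) {C : ℝ}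
    (h : ∀ t, ‖F t‖ ≤ C * (1 + t ^ 2)⁻¹) : Integrable F :=
  (integrable_inv_one_add_sq.const_mul C).mono' hF (.of_forall h)

/-- `a + i b` solves `w'' = -i t w`, with derivative `p + i q`. -/
structure RotatedAirySystem (a b p q : ℝ → ℝ) : Prop where
  hasDerivAt_a : ∀ t, HasDerivAt a (p t) t
  hasDerivAt_b : ∀ t, HasDerivAt b (q t) t
  hasDerivAt_p : ∀ t, HasDerivAt p (t * b t) t
  hasDerivAt_q : ∀ t, HasDerivAt q (-(t * a t)) t
  a_zero : a 0 ≠ 0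
  b_zero : b 0 = 0
  p_zero : p 0 = 0
  wronskian_zero : q 0 * a 0 ≤ 0

namespace RotatedAirySystem

variable {a b p q : ℝ → ℝ}

lemma reflect (h : RotatedAirySystem a b p q) :
    RotatedAirySystem (fun t ↦ a (-t)) (fun t ↦ -b (-t)) (fun t ↦ -p (-t)) (fun t ↦ q (-t)) where
  hasDerivAt_a t := by
    simpa using! (h.hasDerivAt_a (-t)).comp t (hasDerivAt_neg t)
  hasDerivAt_b t := by
    simpa using! ((h.hasDerivAt_b (-t)).comp t (hasDerivAt_neg t)).neg
  hasDerivAt_p t := by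
    simpa using! ((h.hasDerivAt_p (-t)).comp t (hasDerivAt_neg t)).neg
  hasDerivAt_q t := by
    simpa using! (h.hasDerivAt_q (-t)).comp t (hasDerivAt_neg t)
  a_zero := by simpa using h.a_zero
  b_zero := by simpa using h.b_zero
  p_zero := by simpa using h.p_zero
  wronskian_zero := by simpa using h.wronskian_zero

lemma hasDerivAt_normSq (h : RotatedAirySystem a b p q) (t : ℝ) :
    HasDerivAt (fun t ↦ a t ^ 2 + b t ^ 2) (2 * (a t * p t + b t * q t)) t := by
  refine (((h.hasDerivAt_a t).pow 2).add ((h.hasDerivAt_b t).pow 2)).congr_deriv ?_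
  simp
  ring

lemma hasDerivAt_radial (h : RotatedAirySystem a b p q) (t : ℝ) :
    HasDerivAt (fun t ↦ a t * p t + b t * q t) (p t ^ 2 + q t ^ 2) t := by
  refine (((h.hasDerivAt_a t).mul (h.hasDerivAt_p t)).add
    ((h.hasDerivAt_b t).mul (h.hasDerivAt_q t))).congr_deriv ?_
  ring

lemma hasDerivAt_angular (h : RotatedAirySystem a b p q) (t : ℝ) :
    HasDerivAt (fun t ↦ p t * b t - q t * a t) (t * (a t ^ 2 + b t ^ 2)) t := by
  refine (((h.hasDerivAt_p t).mul (h.hasDerivAt_b t)).sub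
    ((h.hasDerivAt_q t).mul (h.hasDerivAt_a t))).congr_deriv ?_
  ring

lemma hasDerivAt_normSq_deriv (h : RotatedAirySystem a b p q) (t : ℝ) :
    HasDerivAt (fun t ↦ p t ^ 2 + q t ^ 2) (2 * t * (p t * b t - q t * a t)) t := by
  refine (((h.hasDerivAt_p t).pow 2).add ((h.hasDerivAt_q t).pow 2)).congr_deriv ?_
  simp
  ring

lemma radial_nonneg (h : RotatedAirySystem a b p q) {t : ℝ} (ht : 0 ≤ t) :
    0 ≤ a t * p t + b t * q t := by
  have := mul_pow_le_of_hasDerivAt_ge (c := 0) (n := 0) h.hasDerivAt_radial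
    (by simp [h.b_zero, h.p_zero]) (fun s _ ↦ by simpa using by positivity) ht
  simpa using this

lemma monotoneOn_normSq (h : RotatedAirySystem a b p q) :
    MonotoneOn (fun t ↦ a t ^ 2 + b t ^ 2) (Set.Ici 0) := by
  refine monotoneOn_of_deriv_nonneg (convex_Ici 0)
    (fun s _ ↦ (h.hasDerivAt_normSq s).continuousAt.continuousWithinAt)
    (fun s _ ↦ (h.hasDerivAt_normSq s).differentiableAt.differentiableWithinAt) fun s hs ↦ ?_
  rw [(h.hasDerivAt_normSq s).deriv]
  rw [interior_Ici] at hs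
  linarith [h.radial_nonneg (le_of_lt hs)]

lemma sq_a_zero_le (h : RotatedAirySystem a b p q) {t : ℝ} (ht : 0 ≤ t) :
    a 0 ^ 2 ≤ a t ^ 2 + b t ^ 2 := by
  simpa [h.b_zero] using h.monotoneOn_normSq (Set.mem_Ici.2 le_rfl) (Set.mem_Ici.2 ht) ht

lemma exists_mul_pow_le (h : RotatedAirySystem a b p q) (k : ℕ) :
    ∃ c, 0 < c ∧ ∀ t, 0 ≤ t → c * t ^ (6 * k) ≤ a t ^ 2 + b t ^ 2 := by
  induction k with
  | zero =>
    exact ⟨a 0 ^ 2, by have := h.a_zero; positivity, fun t ht ↦ by simpa using h.sq_a_zero_le ht⟩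
  | succ k ih =>
    obtain ⟨c, hc, hρ⟩ := ih
    have hτ := fun t ht ↦ mul_pow_le_of_hasDerivAt_ge (t := t) (c := c) (n := 6 * k + 1)
      h.hasDerivAt_angular (by simpa [h.p_zero] using h.wronskian_zero)
      (fun s hs ↦ (by ring : c * s ^ (6 * k + 1) = s * (c * s ^ (6 * k))).trans_le
        (mul_le_mul_of_nonneg_left (hρ s hs) hs)) ht
    obtain ⟨c₁, hc₁, hτ⟩ : ∃ c₁, 0 < c₁ ∧ ∀ t, 0 ≤ t →
        c₁ * t ^ (6 * k + 2) ≤ p t * b t - q t * a t := ⟨_, by positivity, hτ⟩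
    have hσ := fun t ht ↦ mul_pow_le_of_hasDerivAt_ge (t := t) (c := 2 * c₁) (n := 6 * k + 3)
      h.hasDerivAt_normSq_deriv (by positivity)
      (fun s hs ↦ (by ring : 2 * c₁ * s ^ (6 * k + 3) = 2 * s * (c₁ * s ^ (6 * k + 2))).trans_le
        (mul_le_mul_of_nonneg_left (hτ s hs) (by positivity))) ht
    obtain ⟨c₂, hc₂, hσ⟩ : ∃ c₂, 0 < c₂ ∧ ∀ t, 0 ≤ t →
        c₂ * t ^ (6 * k + 4) ≤ p t ^ 2 + q t ^ 2 := ⟨_, by positivity, hσ⟩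
    have hr := fun t ht ↦ mul_pow_le_of_hasDerivAt_ge (t := t) (c := c₂) (n := 6 * k + 4)
      h.hasDerivAt_radial (by simp [h.b_zero, h.p_zero]) hσ ht
    obtain ⟨c₃, hc₃, hr⟩ : ∃ c₃, 0 < c₃ ∧ ∀ t, 0 ≤ t →
        c₃ * t ^ (6 * k + 5) ≤ a t * p t + b t * q t := ⟨_, by positivity, hr⟩
    have hρ' := fun t ht ↦ mul_pow_le_of_hasDerivAt_ge (t := t) (c := 2 * c₃) (n := 6 * k + 5)
      h.hasDerivAt_normSq (by positivity) (fun s hs ↦ by linarith [hr s hs]) ht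
    exact ⟨_, by positivity, hρ'⟩

lemma exists_mul_one_add_sq_pow_le (h : RotatedAirySystem a b p q) :
    ∃ c, 0 < c ∧ ∀ t, 0 ≤ t → c * (1 + t ^ 2) ^ 6 ≤ a t ^ 2 + b t ^ 2 := by
  obtain ⟨c, hc, hρ⟩ := h.exists_mul_pow_le 2
  have ha : 0 < a 0 ^ 2 := by have := h.a_zero; positivity
  have hm : 0 < min (a 0 ^ 2) c := lt_min ha hc
  refine ⟨min (a 0 ^ 2) c / 64, by positivity, fun t ht ↦ ?_⟩
  rcases le_total t 1 with h1 | h1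
  · have : (1 + t ^ 2) ^ 6 ≤ 2 ^ 6 := by
      gcongr
      nlinarith
    calc min (a 0 ^ 2) c / 64 * (1 + t ^ 2) ^ 6 ≤ min (a 0 ^ 2) c / 64 * 2 ^ 6 := by gcongr
      _ = min (a 0 ^ 2) c := by ring
      _ ≤ a 0 ^ 2 := min_le_left _ _
      _ ≤ _ := h.sq_a_zero_le ht
  · have : (1 + t ^ 2) ^ 6 ≤ (2 * t ^ 2) ^ 6 := by
      gcongr
      nlinarith
    calc min (a 0 ^ 2) c / 64 * (1 + t ^ 2) ^ 6 ≤ min (a 0 ^ 2) c / 64 * (2 * t ^ 2) ^ 6 := by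
          gcongr
      _ = min (a 0 ^ 2) c * t ^ (6 * 2) := by ring
      _ ≤ c * t ^ (6 * 2) := by gcongr; exact min_le_right _ _
      _ ≤ _ := hρ t ht

end RotatedAirySystem

/-- `w` solves `w'' = -i t w`, with `w 0` real and `w' 0` imaginary and of opposite sign. -/
structure RotatedAirySolution (w w' : ℝ → ℂ) : Prop where
  hasDerivAt : ∀ t, HasDerivAt w (w' t) t
  hasDerivAt_deriv : ∀ t : ℝ, HasDerivAt w' (-(Complex.I * t * w t)) t
  re_zero : (w 0).re ≠ 0
  im_zero : (w 0).im = 0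
  deriv_re_zero : (w' 0).re = 0
  deriv_im_zero : (w' 0).im * (w 0).re ≤ 0

namespace RotatedAirySolution

variable {w w' : ℝ → ℂ}

lemma system (h : RotatedAirySolution w w') :
    RotatedAirySystem (fun t ↦ (w t).re) (fun t ↦ (w t).im)
      (fun t ↦ (w' t).re) (fun t ↦ (w' t).im) where
  hasDerivAt_a t := Complex.reCLM.hasFDerivAt.comp_hasDerivAt t (h.hasDerivAt t)
  hasDerivAt_b t := Complex.imCLM.hasFDerivAt.comp_hasDerivAt t (h.hasDerivAt t)
  hasDerivAt_p t := by
    simpa using! Complex.reCLM.hasFDerivAt.comp_hasDerivAt t (h.hasDerivAt_deriv t)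
  hasDerivAt_q t := by
    simpa using! Complex.imCLM.hasFDerivAt.comp_hasDerivAt t (h.hasDerivAt_deriv t)
  a_zero := h.re_zero
  b_zero := h.im_zero
  p_zero := h.deriv_re_zero
  wronskian_zero := h.deriv_im_zero

lemma exists_mul_le_norm (h : RotatedAirySolution w w') :
    ∃ m, 0 < m ∧ ∀ t, m * (1 + t ^ 2) ^ 3 ≤ ‖w t‖ := by
  obtain ⟨c, hc, h₁⟩ := h.system.exists_mul_one_add_sq_pow_le
  obtain ⟨d, hd, h₂⟩ := h.system.reflect.exists_mul_one_add_sq_pow_le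
  have hm : 0 < min c d := lt_min hc hd
  refine ⟨√(min c d), by positivity, fun t ↦ ?_⟩
  refine le_of_sq_le_sq ?_ (norm_nonneg _)
  rw [mul_pow, Real.sq_sqrt hm.le, ← pow_mul, complex_norm_sq_eq]
  rcases le_total 0 t with ht | ht
  · refine le_trans ?_ (h₁ t ht)
    gcongr
    exact min_le_left _ _
  · have := h₂ (-t) (by linarith)
    simp only [neg_neg, neg_sq] at this
    refine le_trans ?_ this
    gcongr
    exact min_le_right _ _

lemma norm_le_norm (h : RotatedAirySolution w w') {s t : ℝ} (hs : s ∈ Set.uIcc 0 t) :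
    ‖w s‖ ≤ ‖w t‖ := by
  refine le_of_sq_le_sq ?_ (norm_nonneg _)
  rw [complex_norm_sq_eq, complex_norm_sq_eq]
  rcases le_total 0 t with ht | ht
  · rw [Set.uIcc_of_le ht] at hs
    exact h.system.monotoneOn_normSq (Set.mem_Ici.2 hs.1) (Set.mem_Ici.2 ht) hs.2
  · rw [Set.uIcc_of_ge ht] at hs
    have := h.system.reflect.monotoneOn_normSq
      (Set.mem_Ici.2 (neg_nonneg.2 hs.2)) (Set.mem_Ici.2 (neg_nonneg.2 ht)) (neg_le_neg hs.1)
    simpa using this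

lemma norm_deriv_le (h : RotatedAirySolution w w') (t : ℝ) :
    ‖w' t‖ ≤ ‖w' 0‖ + t ^ 2 * ‖w t‖ := by
  have := (convex_uIcc 0 t).norm_image_sub_le_of_norm_hasDerivWithin_le
    (fun s _ ↦ (h.hasDerivAt_deriv s).hasDerivWithinAt) (C := |t| * ‖w t‖)
    (fun s hs ↦ by
      have h₁ : |s| ≤ |t| := by
        simpa using Set.abs_sub_left_of_mem_uIcc hs
      have h₂ := h.norm_le_norm hs
      simp only [norm_neg, norm_mul, Complex.norm_I, one_mul, Complex.norm_real, Real.norm_eq_abs]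
      gcongr) Set.left_mem_uIcc Set.right_mem_uIcc
  rw [sub_zero, Real.norm_eq_abs] at this
  have h₂ := norm_le_norm_add_norm_sub' (w' t) (w' 0)
  have h₃ : |t| * ‖w t‖ * |t| = t ^ 2 * ‖w t‖ := by
    rw [← sq_abs]
    ring
  linarith

lemma ne_zero (h : RotatedAirySolution w w') (t : ℝ) : w t ≠ 0 := by
  obtain ⟨m, hm, hw⟩ := h.exists_mul_le_norm
  have : 0 < ‖w t‖ := lt_of_lt_of_le (by positivity) (hw t)
  simpa using this

lemma exists_norm_deriv_le (h : RotatedAirySolution w w') :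
    ∃ B, 0 < B ∧ ∀ t, ‖w' t‖ ≤ B * (1 + t ^ 2) * ‖w t‖ := by
  have h₀ : 0 < ‖w 0‖ := norm_pos_iff.2 (h.ne_zero 0)
  refine ⟨‖w' 0‖ / ‖w 0‖ + 1, by positivity, fun t ↦ (h.norm_deriv_le t).trans ?_⟩
  have h₁ : ‖w 0‖ ≤ ‖w t‖ := h.norm_le_norm Set.left_mem_uIcc
  have h₂ : ‖w' 0‖ ≤ ‖w' 0‖ / ‖w 0‖ * ‖w t‖ := by
    rw [div_mul_eq_mul_div, le_div_iff₀ h₀]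
    gcongr
  have h₃ : 0 ≤ ‖w' 0‖ / ‖w 0‖ * t ^ 2 * ‖w t‖ := by positivity
  nlinarith [norm_nonneg (w t)]

lemma hasDerivAt_inv (h : RotatedAirySolution w w') (t : ℝ) :
    HasDerivAt (fun s ↦ (w s)⁻¹) (-w' t / w t ^ 2) t :=
  (h.hasDerivAt t).fun_inv (h.ne_zero t)

lemma hasDerivAt_inv_deriv (h : RotatedAirySolution w w') (t : ℝ) :
    HasDerivAt (fun s ↦ -w' s / w s ^ 2)
      (Complex.I * t * (w t)⁻¹ + 2 * (w' t / w t) ^ 2 * (w t)⁻¹) t := by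
  have hw := h.ne_zero t
  refine ((h.hasDerivAt_deriv t).fun_neg.fun_div ((h.hasDerivAt t).fun_pow 2)
    (pow_ne_zero 2 hw)).congr_deriv ?_
  field_simp
  simp
  ring

lemma exists_norm_inv_le (h : RotatedAirySolution w w') :
    ∃ C, 0 < C ∧ ∀ t, ‖(w t)⁻¹‖ ≤ C * ((1 + t ^ 2)⁻¹) ^ 3 := by
  obtain ⟨m, hm, hw⟩ := h.exists_mul_le_norm
  refine ⟨m⁻¹, by positivity, fun t ↦ ?_⟩
  rw [norm_inv, inv_pow, ← mul_inv]
  exact inv_anti₀ (by positivity) (hw t)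

lemma exists_norm_logDeriv_le (h : RotatedAirySolution w w') :
    ∃ B, 0 < B ∧ ∀ t, ‖w' t / w t‖ ≤ B * (1 + t ^ 2) := by
  obtain ⟨B, hB, hw⟩ := h.exists_norm_deriv_le
  refine ⟨B, hB, fun t ↦ ?_⟩
  rw [norm_div, div_le_iff₀ (norm_pos_iff.2 (h.ne_zero t))]
  exact hw t

lemma continuous (h : RotatedAirySolution w w') : Continuous w :=
  continuous_iff_continuousAt.2 fun t ↦ (h.hasDerivAt t).continuousAt

lemma continuous_deriv (h : RotatedAirySolution w w') : Continuous w' :=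
  continuous_iff_continuousAt.2 fun t ↦ (h.hasDerivAt_deriv t).continuousAt

lemma integrable_inv (h : RotatedAirySolution w w') : Integrable (fun t ↦ (w t)⁻¹) := by
  obtain ⟨C, hC, hw⟩ := h.exists_norm_inv_le
  refine integrable_of_norm_le_inv_one_add_sq (C := C) (h.continuous.inv₀ h.ne_zero).aestronglyMeasurable
    fun t ↦ (hw t).trans ?_
  gcongr
  exact pow_le_of_le_one (by positivity) (inv_le_one_of_one_le₀ (by nlinarith)) (by norm_num)

lemma integrable_inv_deriv (h : RotatedAirySolution w w') :
    Integrable (fun t ↦ -w' t / w t ^ 2) := by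
  obtain ⟨C, hC, hw⟩ := h.exists_norm_inv_le
  obtain ⟨B, hB, hw'⟩ := h.exists_norm_logDeriv_le
  refine integrable_of_norm_le_inv_one_add_sq (C := B * C)
    (h.continuous_deriv.neg.div (h.continuous.pow 2)
      fun t ↦ pow_ne_zero 2 (h.ne_zero t)).aestronglyMeasurable fun t ↦ ?_
  have hx : 0 < 1 + t ^ 2 := by positivity
  calc ‖-w' t / w t ^ 2‖ = ‖w' t / w t‖ * ‖(w t)⁻¹‖ := by
        rw [← norm_mul, ← norm_neg]
        congr 1
        have := h.ne_zero t
        field_simp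
    _ ≤ B * (1 + t ^ 2) * (C * ((1 + t ^ 2)⁻¹) ^ 3) := by
        gcongr
        exacts [hw' t, hw t]
    _ = B * C * ((1 + t ^ 2)⁻¹) ^ 2 := by field_simp
    _ ≤ B * C * (1 + t ^ 2)⁻¹ := by
        gcongr
        exact pow_le_of_le_one (by positivity) (inv_le_one_of_one_le₀ (by nlinarith)) (by norm_num)

lemma integrable_inv_deriv_deriv (h : RotatedAirySolution w w') :
    Integrable (fun t : ℝ ↦ Complex.I * t * (w t)⁻¹ + 2 * (w' t / w t) ^ 2 * (w t)⁻¹) := by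
  obtain ⟨C, hC, hw⟩ := h.exists_norm_inv_le
  obtain ⟨B, hB, hw'⟩ := h.exists_norm_logDeriv_le
  have hcinv : Continuous fun t ↦ (w t)⁻¹ := h.continuous.inv₀ h.ne_zero
  refine integrable_of_norm_le_inv_one_add_sq (C := C + 2 * B ^ 2 * C)
    (((by fun_prop : Continuous fun t : ℝ ↦ Complex.I * t).mul hcinv).add
      (((h.continuous_deriv.div h.continuous h.ne_zero).pow 2
        |>.const_mul 2).mul hcinv)).aestronglyMeasurable fun t ↦ ?_
  have hx : 0 < 1 + t ^ 2 := by positivity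
  have ht : |t| ≤ (1 + t ^ 2) ^ 2 := by
    have : |t| ≤ 1 + t ^ 2 := by nlinarith [sq_abs t, sq_nonneg (|t| - 1), abs_nonneg t]
    nlinarith
  calc _ ≤ |t| * ‖(w t)⁻¹‖ + 2 * ‖w' t / w t‖ ^ 2 * ‖(w t)⁻¹‖ := by
        refine (norm_add_le _ _).trans_eq ?_
        simp
    _ ≤ (1 + t ^ 2) ^ 2 * (C * ((1 + t ^ 2)⁻¹) ^ 3)
        + 2 * (B * (1 + t ^ 2)) ^ 2 * (C * ((1 + t ^ 2)⁻¹) ^ 3) := by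
        gcongr
        exacts [hw t, hw' t, hw t]
    _ = _ := by field_simp

end RotatedAirySolution

lemma integrable_fourier_of_hasDerivAt {F F' F'' : ℝ → ℂ} (h : ∀ t, HasDerivAt F (F' t) t)
    (h' : ∀ t, HasDerivAt F' (F'' t) t) (hF : Integrable F) (hF' : Integrable F')
    (hF'' : Integrable F'') : Integrable (𝓕 F) := by
  have e : deriv F = F' := funext fun t ↦ (h t).deriv
  have e' : deriv F' = F'' := funext fun t ↦ (h' t).deriv
  have h₁ := Real.fourier_deriv hF (fun t ↦ (h t).differentiableAt) (by rwa [e])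
  have h₂ := Real.fourier_deriv hF' (fun t ↦ (h' t).differentiableAt) (by rwa [e'])
  rw [e] at h₁
  rw [e'] at h₂
  have bound (G : ℝ → ℂ) (x : ℝ) : ‖𝓕 G x‖ ≤ ∫ t, ‖G t‖ :=
    VectorFourier.norm_fourierIntegral_le_integral_norm _ _ _ _ _
  refine integrable_of_norm_le_inv_one_add_sq (C := (∫ t, ‖F t‖) + ∫ t, ‖F'' t‖)
    ?_ fun x ↦ ?_
  · exact (VectorFourier.fourierIntegral_continuous Real.continuous_fourierChar
      (by exact continuous_inner) hF).aestronglyMeasurable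
  have hx : ‖𝓕 F'' x‖ = (2 * Real.pi) ^ 2 * x ^ 2 * ‖𝓕 F x‖ := by
    rw [h₂, h₁]
    simp [abs_of_pos Real.pi_pos]
    ring_nf
    rw [sq_abs]
    ring
  have hb := bound F'' x
  have hb₀ := bound F x
  rw [hx] at hb
  rw [← div_eq_mul_inv, le_div_iff₀ (by positivity)]
  have hpi : 1 ≤ (2 * Real.pi) ^ 2 := by nlinarith [Real.pi_gt_three]
  have : x ^ 2 * ‖𝓕 F x‖ ≤ (2 * Real.pi) ^ 2 * (x ^ 2 * ‖𝓕 F x‖) :=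
    le_mul_of_one_le_left (by positivity) hpi
  linarith

lemma integral_exp_mul_fourier_mul_fourier_neg {F : ℝ → ℂ} (hc : Continuous F)
    (hF : Integrable F) (hF' : Integrable (𝓕 F)) (t : ℝ) :
    ∫ y : ℝ, Complex.exp (2 * Real.pi * y * t * Complex.I) * (𝓕 F y * 𝓕 F (-y)) =
      ∫ s : ℝ, F (t + s) * F s := by
  have hG : Integrable (fun y : ℝ ↦
      Complex.exp (-(2 * Real.pi * y * t * Complex.I)) * 𝓕 F (-y)) := by
    refine hF'.comp_neg.bdd_mul (c := 1) (by fun_prop) (.of_forall fun y ↦ ?_)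
    have : -(2 * Real.pi * y * t * Complex.I) = ((-(2 * Real.pi * y * t) : ℝ) : ℂ) * Complex.I := by
      push_cast
      ring
    rw [this, Complex.norm_exp_ofReal_mul_I]
  have key := VectorFourier.integral_fourierIntegral_smul_eq_flip (L := innerₗ ℝ) (F := ℂ)
    Real.continuous_fourierChar (by exact continuous_inner) hF hG
  rw [flip_innerₗ] at key
  have h₁ : ∫ y : ℝ, Complex.exp (2 * Real.pi * y * t * Complex.I) * (𝓕 F y * 𝓕 F (-y)) =
      ∫ y : ℝ, 𝓕 F y * (Complex.exp (-(2 * Real.pi * y * t * Complex.I)) * 𝓕 F (-y)) := by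
    rw [← integral_neg_eq_self]
    congr with y
    simp
    ring
  rw [h₁]
  refine key.trans ?_
  congr with s
  rw [smul_eq_mul, mul_comm]
  congr 1
  have hinv := congrFun (hc.fourierInv_fourier_eq hF hF') (t + s)
  rw [← hinv, Real.fourierInv_eq', ← integral_neg_eq_self]
  refine (Real.fourier_eq' (fun y : ℝ ↦
    Complex.exp (-(2 * Real.pi * y * t * Complex.I)) * 𝓕 F (-y)) s).trans ?_
  congr with y
  simp only [smul_eq_mul]
  rw [← mul_assoc, ← Complex.exp_add]
  congr 2
  simp
  ring

lemma rotatedAirySolution_of_airy {Ai : ℂ → ℂ} (h₁ : Differentiable ℂ Ai)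
    (h₂ : Differentiable ℂ (deriv Ai)) (hode : ∀ z : ℂ, deriv (deriv Ai) z = z * Ai z)
    (h₀ : Ai 0 = (3 : ℂ) ^ (-(2 : ℂ) / 3) / Complex.Gamma (2 / 3))
    (h₀' : deriv Ai 0 = -(3 : ℂ) ^ (-(1 : ℂ) / 3) / Complex.Gamma (1 / 3)) :
    RotatedAirySolution (fun t : ℝ ↦ Ai (Complex.I * t))
      (fun t : ℝ ↦ Complex.I * deriv Ai (Complex.I * t)) := by
  have hlin (t : ℝ) : HasDerivAt (fun t : ℝ ↦ Complex.I * (t : ℂ)) Complex.I t := by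
    simpa using (Complex.ofRealCLM.hasDerivAt (x := t)).const_mul Complex.I
  have e₀ : Ai 0 = ((3 ^ (-2 / 3 : ℝ) / Real.Gamma (2 / 3) : ℝ) : ℂ) := by
    rw [h₀]
    push_cast [Complex.ofReal_cpow, ← Complex.Gamma_ofReal]
    rw [Complex.ofReal_cpow (by norm_num)]
    push_cast
    rfl
  have e₁ : deriv Ai 0 = ((-3 ^ (-1 / 3 : ℝ) / Real.Gamma (1 / 3) : ℝ) : ℂ) := by
    rw [h₀']
    push_cast [← Complex.Gamma_ofReal]
    rw [Complex.ofReal_cpow (by norm_num)]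
    push_cast
    rfl
  have hΓ₁ : 0 < Real.Gamma (1 / 3) := Real.Gamma_pos_of_pos (by norm_num)
  have hΓ₂ : 0 < Real.Gamma (2 / 3) := Real.Gamma_pos_of_pos (by norm_num)
  have hpos₀ : 0 < (3 : ℝ) ^ (-2 / 3 : ℝ) / Real.Gamma (2 / 3) := by positivity
  have hpos₁ : 0 < (3 : ℝ) ^ (-1 / 3 : ℝ) / Real.Gamma (1 / 3) := by positivity
  rw [neg_div] at e₁
  refine ⟨fun t ↦ ?_, fun t ↦ ?_, ?_, ?_, ?_, ?_⟩
  · exact ((h₁ _).hasDerivAt.comp t (hlin t)).congr_deriv (mul_comm _ _)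
  · refine (((h₂ _).hasDerivAt.comp t (hlin t)).const_mul Complex.I).congr_deriv ?_
    rw [hode]
    linear_combination (Complex.I * t * Ai (Complex.I * t)) * Complex.I_mul_I
  · simp only [Complex.ofReal_zero, mul_zero, e₀, Complex.ofReal_re]
    exact hpos₀.ne'
  · simp only [Complex.ofReal_zero, mul_zero, e₀, Complex.ofReal_im]
  · simp only [Complex.ofReal_zero, mul_zero, e₁, Complex.I_mul_re, Complex.ofReal_im, neg_zero]
  · simp only [Complex.ofReal_zero, mul_zero, e₀, e₁, Complex.I_mul_im, Complex.ofReal_re]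
    nlinarith
theorem chernoff_characteristic_function (Ai : ℂ → ℂ)
    (hAi_d1 : Differentiable ℂ Ai)
    (hAi_d2 : Differentiable ℂ (deriv Ai))
    (hAi_ode : ∀ z : ℂ, deriv (deriv Ai) z = z * Ai z)
    (hAi_0 : Ai 0 = (3 : ℂ) ^ (-(2 : ℂ) / 3) / Complex.Gamma (2 / 3))
    (hAi_0' : deriv Ai 0 = -(3 : ℂ) ^ (-(1 : ℂ) / 3) / Complex.Gamma (1 / 3))
    (hAi_zeros : ∀ z : ℂ, Ai z = 0 → ∃ x : ℝ, x < 0 ∧ z = (x : ℂ))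
    (g : ℝ → ℝ)
    (hg : ∀ x : ℝ, (g x : ℂ) =
      (1 / (2 * (Real.pi : ℂ))) *
        ∫ t : ℝ, Complex.exp (-(Complex.I * t * x)) * ((Real.sqrt 2 : ℂ) / Ai (Complex.I * t)))
    (f : ℝ → ℝ)
    (hf : ∀ x : ℝ, f x = (1 / 2) * g x * g (-x)) :
    ∀ t : ℝ,
      ∫ x : ℝ, Complex.exp (Complex.I * t * x) * (f x : ℂ) =
        (1 / (2 * (Real.pi : ℂ))) *
          ∫ s : ℝ, 1 / (Ai (Complex.I * (t + s)) * Ai (Complex.I * s)) := by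
  intro t
  have hsol := rotatedAirySolution_of_airy hAi_d1 hAi_d2 hAi_ode hAi_0 hAi_0'
  have hF' := integrable_fourier_of_hasDerivAt hsol.hasDerivAt_inv hsol.hasDerivAt_inv_deriv
    hsol.integrable_inv hsol.integrable_inv_deriv hsol.integrable_inv_deriv_deriv
  have hmain := integral_exp_mul_fourier_mul_fourier_neg
    (F := fun s : ℝ ↦ (Ai (Complex.I * s))⁻¹) (hsol.continuous.inv₀ hsol.ne_zero)
    hsol.integrable_inv hF' t
  set F : ℝ → ℂ := fun s ↦ (Ai (Complex.I * s))⁻¹ with hFdef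
  have hgF (y : ℝ) : (g (2 * Real.pi * y) : ℂ) =
      (Real.sqrt 2 : ℂ) / (2 * (Real.pi : ℂ)) * 𝓕 F y := by
    rw [hg, Real.fourier_eq', div_mul_eq_mul_div, one_mul, div_mul_eq_mul_div, ← integral_const_mul]
    congr 2 with s
    simp only [smul_eq_mul, hFdef]
    rw [mul_left_comm, div_eq_mul_inv]
    congr 2
    simp
    ring
  have hsqrt : (Real.sqrt 2 : ℂ) ^ 2 = 2 := by
    exact_mod_cast Real.sq_sqrt (by norm_num : (0 : ℝ) ≤ 2)
  have hint (y : ℝ) : Complex.exp (Complex.I * t * (2 * Real.pi * y : ℝ)) *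
      (f (2 * Real.pi * y) : ℂ) = (1 / (2 * (Real.pi : ℂ))) ^ 2 *
        (Complex.exp (2 * Real.pi * y * t * Complex.I) * (𝓕 F y * 𝓕 F (-y))) := by
    have hneg : -(2 * Real.pi * y) = 2 * Real.pi * -y := by ring
    rw [hf, hneg]
    push_cast
    rw [hgF, hgF, show Complex.I * t * (2 * Real.pi * y) = 2 * Real.pi * y * t * Complex.I by ring]
    field_simp
    rw [hsqrt]
  have hscale := Measure.integral_comp_mul_left
    (fun x : ℝ ↦ Complex.exp (Complex.I * t * x) * (f x : ℂ)) (2 * Real.pi)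
  simp only [hint] at hscale
  rw [integral_const_mul, hmain, abs_of_pos (by positivity), Complex.real_smul] at hscale
  have hrhs : ∫ s : ℝ, F (t + s) * F s =
      ∫ s : ℝ, 1 / (Ai (Complex.I * (t + s)) * Ai (Complex.I * s)) := by
    congr with s
    simp [hFdef, mul_comm]
  rw [← hrhs]
  change _ * (∫ s : ℝ, F (t + s) * F s) = _ at hscale
  generalize ∫ s : ℝ, F (t + s) * F s = J at hscale ⊢
  push_cast at hscale
  field_simp at hscale ⊢
  rw [hscale]
end

section
/- For every real t and every real σ with σ > a₁ (where a₁ is the largest zero of Ai), the contour integral (1/(2πi)) ∫_{σ−i∞}^{σ+i∞} dz/(Ai(z+it)·Ai(z)), i.e. (1/(2π)) ∫_ℝ dy/(Ai(σ+iy+it)·Ai(σ+iy)), is independent of σ; in particular it equals its value for σ = 0, namely (1/(2π)) ∫_ℝ dy/(Ai(iy+it)·Ai(iy)). -/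
open Complex Metric Set Filter Topology MeasureTheory

/-- A nonvanishing holomorphic function on a disc has a holomorphic logarithm. -/
lemma exists_log_of_ne_zero_on_ball {f : ℂ → ℂ} {c : ℂ} {r : ℝ} (hr : 0 < r)
    (hf : DifferentiableOn ℂ f (ball c r)) (h0 : ∀ z ∈ ball c r, f z ≠ 0) :
    ∃ L : ℂ → ℂ, L c = 0 ∧ (∀ z ∈ ball c r, HasDerivAt L (deriv f z / f z) z) ∧
      ∀ z ∈ ball c r, f z = f c * exp (L z) := by
  have hd : DifferentiableOn ℂ (fun z => deriv f z / f z) (ball c r) :=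
    (hf.deriv isOpen_ball).div hf h0
  obtain ⟨L, hLc, hL⟩ := hd.isExactOn_ball.with_val_at c 0
  refine ⟨L, hLc, hL, fun z hz => ?_⟩
  have hg : ∀ w ∈ ball c r, HasDerivAt (fun w => f w * exp (-L w)) 0 w := by
    intro w hw
    have hfw := (hf.differentiableAt (isOpen_ball.mem_nhds hw)).hasDerivAt
    refine (hfw.mul (hL w hw).neg.cexp).congr_deriv ?_
    have := h0 w hw
    field_simp
    ring
  have hconst : f z * exp (-L z) = f c * exp (-L c) :=
    (convex_ball c r).is_const_of_fderivWithin_eq_zero (𝕜 := ℂ)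
      (fun w hw => (hg w hw).differentiableAt.differentiableWithinAt)
      (fun w hw => by
        rw [fderivWithin_of_isOpen isOpen_ball hw]
        simpa using (hg w hw).hasFDerivAt.fderiv)
      hz (mem_ball_self hr)
  rw [hLc, neg_zero, exp_zero, mul_one] at hconst
  rw [← hconst, mul_assoc, ← exp_add, neg_add_cancel, exp_zero, mul_one]

/-- If a nonvanishing holomorphic function on a disc is at most `exp M` times its value at the
centre, then near the centre its logarithm is Lipschitz with constant `4 * M / r`. -/
lemma exp_neg_le_norm_and_norm_deriv_le {f : ℂ → ℂ} {c : ℂ} {r M : ℝ} (hr : 0 < r) (hM : 0 < M)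
    (hf : DifferentiableOn ℂ f (ball c r)) (h0 : ∀ z ∈ ball c r, f z ≠ 0)
    (hb : ∀ z ∈ ball c r, ‖f z‖ ≤ ‖f c‖ * Real.exp M) :
    (∀ z, ‖z - c‖ ≤ r / 2 → ‖f c‖ * Real.exp (-(4 * M / r * ‖z - c‖)) ≤ ‖f z‖) ∧
      ‖deriv f c‖ ≤ 4 * M / r * ‖f c‖ := by
  obtain ⟨L, hLc, hL, hfL⟩ := exists_log_of_ne_zero_on_ball hr hf h0
  have hc : c ∈ ball c r := mem_ball_self hr
  have hfc : 0 < ‖f c‖ := norm_pos_iff.2 (h0 c hc)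
  have hshift : ∀ w ∈ ball (0 : ℂ) r, c + w ∈ ball c r := by
    intro w hw
    simpa using hw
  have hLip : ∀ z, ‖z - c‖ ≤ r / 2 → ‖L z‖ ≤ 4 * M / r * ‖z - c‖ := by
    intro z hz
    have hzr : z - c ∈ ball (0 : ℂ) r := by
      rw [mem_ball_zero_iff]; linarith
    have h := borelCaratheodory_zero (f := fun w => L (c + w)) hM
      (fun w hw => by
        have h1 : DifferentiableAt ℂ L (c + w) := (hL _ (hshift w hw)).differentiableAt
        exact (h1.comp w (by fun_prop)).differentiableWithinAt)
      (fun w hw => by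
        have h1 := hb _ (hshift w hw)
        rw [hfL _ (hshift w hw), norm_mul, norm_exp] at h1
        exact Real.exp_le_exp.1 (le_of_mul_le_mul_left h1 hfc))
      hr hzr (by simpa using hLc)
    simp only [add_sub_cancel] at h
    refine h.trans ?_
    rw [div_le_iff₀ (by linarith)]
    have : 4 * M / r * ‖z - c‖ * (r - ‖z - c‖) =
      2 * M * ‖z - c‖ * (2 * (r - ‖z - c‖) / r) := by field_simp; ring
    rw [this]
    refine le_mul_of_one_le_right (by positivity) ?_
    rw [one_le_div hr]
    linarith
  refine ⟨fun z hz => ?_, ?_⟩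
  · have hzr : z ∈ ball c r := by
      rw [mem_ball_iff_norm]; linarith
    rw [hfL z hzr, norm_mul, norm_exp]
    gcongr
    have h1 := hLip z hz
    have h2 := (abs_le.1 (abs_re_le_norm (L z))).1
    linarith
  · have h1 : ‖deriv f c / f c‖ ≤ 4 * M / r := by
      refine (hL c hc).le_of_lip' (by positivity) ?_
      filter_upwards [ball_mem_nhds c (half_pos hr)] with z hz
      rw [hLc, sub_zero]
      exact hLip z (by rw [mem_ball_iff_norm] at hz; exact hz.le)
    rwa [norm_div, div_le_iff₀ hfc] at h1

/-- Solutions of the Airy equation have order of growth at most `3 / 2`. -/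
lemma norm_le_of_airy_ode {A : ℂ → ℂ} (hA : Differentiable ℂ A)
    (hA' : Differentiable ℂ (deriv A)) (hode : ∀ z, deriv (deriv A) z = z * A z)
    {ρ : ℝ} (hρ : 1 ≤ ρ) {z : ℂ} (hz : ‖z‖ ≤ ρ) :
    ‖A z‖ ≤ (‖A 0‖ + ‖deriv A 0‖) * Real.exp (√ρ * ρ) := by
  have hs : 1 ≤ √ρ := Real.one_le_sqrt.2 hρ
  have hs0 : 0 < √ρ := by linarith
  set f : ℝ → ℂ × ℂ := fun r => ((√ρ : ℂ) * A (r * z), deriv A (r * z))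
  set f' : ℝ → ℂ × ℂ := fun r => ((√ρ : ℂ) * (deriv A (r * z) * z), r * z * A (r * z) * z)
  have hline : ∀ r : ℝ, HasDerivAt (fun r : ℝ => (r : ℂ) * z) z r := fun r => by
    simpa using (ofRealCLM.hasDerivAt (x := r)).mul_const z
  have hf : ∀ r : ℝ, HasDerivAt f (f' r) r := by
    intro r
    refine HasDerivAt.prodMk ?_ ?_
    · exact ((hA _).hasDerivAt.comp r (hline r)).const_mul _
    · have := (hA' (r * z)).hasDerivAt.comp r (hline r)
      rwa [hode] at this
  have hbound : ∀ r ∈ Ico (0 : ℝ) 1, ‖f' r‖ ≤ (√ρ * ρ) * ‖f r‖ + 0 := by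
    intro r hr
    rw [add_zero]
    have h1 : ‖(√ρ : ℂ)‖ = √ρ := by simp
    have e1 : √ρ * ‖A (r * z)‖ ≤ ‖f r‖ := by
      refine le_trans ?_ (norm_fst_le (f r))
      simp [f, abs_of_pos hs0]
    have e2 : ‖deriv A (r * z)‖ ≤ ‖f r‖ := norm_snd_le (f r)
    refine norm_prod_le_iff.2 ⟨?_, ?_⟩
    · simp only [f', norm_mul, h1]
      calc √ρ * (‖deriv A (r * z)‖ * ‖z‖) ≤ √ρ * (‖f r‖ * ρ) := by gcongr
        _ = _ := by ring
    · simp only [f', norm_mul, norm_real, Real.norm_eq_abs, abs_of_nonneg hr.1]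
      calc r * ‖z‖ * ‖A (r * z)‖ * ‖z‖ ≤ 1 * ρ * ‖A (r * z)‖ * ρ := by
            gcongr
            exact hr.2.le
        _ = √ρ * ρ * (√ρ * ‖A (r * z)‖) := by
            nth_rw 1 [← Real.mul_self_sqrt (by linarith : (0 : ℝ) ≤ ρ)]; ring
        _ ≤ _ := by gcongr
  have h := norm_le_gronwallBound_of_norm_deriv_right_le (f := f) (f' := f')
    (fun r _ => (hf r).continuousAt.continuousWithinAt)
    (fun r _ => (hf r).hasDerivWithinAt) le_rfl hbound 1 (by simp)
  rw [gronwallBound_ε0, sub_zero, mul_one] at h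
  have h0 : ‖f 0‖ ≤ √ρ * (‖A 0‖ + ‖deriv A 0‖) := by
    refine norm_prod_le_iff.2 ⟨?_, ?_⟩
    · simp [f]
      have := norm_nonneg (deriv A 0)
      have : 0 ≤ ρ := by linarith
      rw [abs_of_pos hs0]
      gcongr
      linarith
    · simp [f]
      nlinarith [norm_nonneg (deriv A 0), norm_nonneg (A 0)]
  have h2 : √ρ * ‖A z‖ ≤ ‖f 1‖ := by
    refine le_trans ?_ (norm_fst_le (f 1))
    simp [f, abs_of_pos hs0]
  refine le_of_mul_le_mul_left ?_ hs0
  calc √ρ * ‖A z‖ ≤ ‖f 0‖ * Real.exp (√ρ * ρ) := h2.trans h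
    _ ≤ √ρ * (‖A 0‖ + ‖deriv A 0‖) * Real.exp (√ρ * ρ) := by gcongr
    _ = _ := by ring

/-- Derivative of `conj A · A'` along the imaginary axis for a solution `A` of Airy's equation. -/
lemma hasDerivAt_conj_mul_deriv_of_airy_ode {A : ℂ → ℂ} (hA : Differentiable ℂ A)
    (hA' : Differentiable ℂ (deriv A)) (hode : ∀ z, deriv (deriv A) z = z * A z) (y : ℝ) :
    HasDerivAt (fun y : ℝ => (starRingEnd ℂ) (A (I * y)) * deriv A (I * y))
      (-((y * ‖A (I * y)‖ ^ 2 : ℝ) : ℂ) - I * ((‖deriv A (I * y)‖ ^ 2 : ℝ) : ℂ)) y := by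
  have hline : HasDerivAt (fun y : ℝ => I * (y : ℂ)) I y := by
    simpa using (ofRealCLM.hasDerivAt (x := y)).const_mul I
  have h1 := ((hA _).hasDerivAt.comp y hline).star
  have h2 := (hA' (I * y)).hasDerivAt.comp y hline
  rw [hode] at h2
  refine (h1.mul h2).congr_deriv ?_
  have e1 : ((‖A (I * y)‖ ^ 2 : ℝ) : ℂ) = (starRingEnd ℂ) (A (I * y)) * A (I * y) := by
    rw [mul_comm ((starRingEnd ℂ) _), mul_conj, normSq_eq_norm_sq]
  have e2 : ((‖deriv A (I * y)‖ ^ 2 : ℝ) : ℂ) =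
      (starRingEnd ℂ) (deriv A (I * y)) * deriv A (I * y) := by
    rw [mul_comm ((starRingEnd ℂ) _), mul_conj, normSq_eq_norm_sq]
  rw [ofReal_mul, e1, e2]
  simp only [Function.comp, star_def, map_mul, conj_I]
  linear_combination y * (starRingEnd ℂ) (A (I * y)) * A (I * y) * I_mul_I

/-- A solution of Airy's equation with `Im (conj A(0) · A'(0)) ≤ 0` has non-decreasing modulus on
the positive imaginary axis. -/
lemma norm_zero_le_of_airy_ode {A : ℂ → ℂ} (hA : Differentiable ℂ A)
    (hA' : Differentiable ℂ (deriv A)) (hode : ∀ z, deriv (deriv A) z = z * A z)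
    (him : ((starRingEnd ℂ) (A 0) * deriv A 0).im ≤ 0) {y : ℝ} (hy : 0 ≤ y) :
    ‖A 0‖ ≤ ‖A (I * y)‖ := by
  set P : ℝ → ℂ := fun y => (starRingEnd ℂ) (A (I * y)) * deriv A (I * y)
  have hP := hasDerivAt_conj_mul_deriv_of_airy_ode hA hA' hode
  have hPim : ∀ y : ℝ, HasDerivAt (fun y => (P y).im) (-‖deriv A (I * y)‖ ^ 2) y := fun y => by
    have := imCLM.hasFDerivAt.comp_hasDerivAt y (hP y)
    refine this.congr_deriv ?_
    simp [-ofReal_pow]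
  have hanti : Antitone fun y => (P y).im :=
    antitone_of_hasDerivAt_nonpos hPim fun y => by
      simp only [Pi.zero_apply, Left.neg_nonpos_iff]
      positivity
  have hPneg : ∀ y, 0 ≤ y → (P y).im ≤ 0 := fun y hy =>
    (hanti hy).trans (by simpa [P] using him)
  have hu : ∀ y : ℝ, HasDerivAt (fun y : ℝ => ‖A (I * y)‖ ^ 2) (-2 * (P y).im) y := by
    intro y
    have hline : HasDerivAt (fun y : ℝ => I * (y : ℂ)) I y := by
      simpa using (ofRealCLM.hasDerivAt (x := y)).const_mul I
    refine ((hA _).hasDerivAt.comp y hline).norm_sq.congr_deriv ?_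
    simp [P, Complex.inner]
    ring
  have hmono : MonotoneOn (fun y : ℝ => ‖A (I * y)‖ ^ 2) (Ici 0) := by
    refine monotoneOn_of_hasDerivWithinAt_nonneg (convex_Ici 0)
      (fun y _ => (hu y).continuousAt.continuousWithinAt)
      (fun y _ => (hu y).hasDerivWithinAt) fun y hy => ?_
    rw [interior_Ici, mem_Ioi] at hy
    linarith [hPneg y hy.le]
  have := hmono (mem_Ici.2 le_rfl) (mem_Ici.2 hy) hy
  simp only [ofReal_zero, mul_zero] at this
  exact (sq_le_sq₀ (norm_nonneg _) (norm_nonneg _)).1 this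

/-- Lipschitz bounds for the logarithm of a solution of Airy's equation without zeros in the upper
half plane, around points of the positive imaginary axis. -/
lemma exists_exp_neg_le_norm_of_airy_ode {A : ℂ → ℂ} (hA : Differentiable ℂ A)
    (hA' : Differentiable ℂ (deriv A)) (hode : ∀ z, deriv (deriv A) z = z * A z)
    (h0 : ∀ z : ℂ, 0 < z.im → A z ≠ 0) (hA0 : A 0 ≠ 0)
    (him : ((starRingEnd ℂ) (A 0) * deriv A 0).im ≤ 0) :
    ∃ κ : ℝ, 0 < κ ∧ ∀ y : ℝ, 1 ≤ y →
      (∀ z, ‖z - I * y‖ ≤ y / 2 →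
        ‖A (I * y)‖ * Real.exp (-(κ * √y * ‖z - I * y‖)) ≤ ‖A z‖) ∧
      ‖deriv A (I * y)‖ ≤ κ * √y * ‖A (I * y)‖ := by
  have ha : 0 < ‖A 0‖ := norm_pos_iff.2 hA0
  set K := (‖A 0‖ + ‖deriv A 0‖) / ‖A 0‖ with hK
  have hK1 : 1 ≤ K := by
    rw [hK, one_le_div ha]
    linarith [norm_nonneg (deriv A 0)]
  have hlog : 0 ≤ Real.log K := Real.log_nonneg hK1
  refine ⟨4 * (Real.log K + 4), by positivity, fun y hy => ?_⟩
  have hy0 : 0 < y := by linarith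
  have hs : 1 ≤ √y := Real.one_le_sqrt.2 hy
  have hM : 0 < (Real.log K + 4) * (√y * y) := by positivity
  have h := exp_neg_le_norm_and_norm_deriv_le (c := I * y) hy0 hM hA.differentiableOn
    (fun z hz => h0 z (by
      rw [mem_ball_iff_norm] at hz
      have := (abs_lt.1 ((abs_im_le_norm _).trans_lt hz)).1
      simp at this
      linarith))
    (fun z hz => by
      rw [mem_ball_iff_norm] at hz
      have hz2 : ‖z‖ ≤ 2 * y := by
        have h1 := norm_le_norm_sub_add z (I * y)
        have h2 : ‖I * (y : ℂ)‖ = y := by simp [abs_of_pos hy0]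
        linarith
      have hsq : √(2 * y) ≤ 2 * √y := by
        rw [Real.sqrt_mul zero_le_two]
        gcongr
        exact Real.sqrt_le_iff.2 ⟨by norm_num, by norm_num⟩
      calc ‖A z‖ ≤ (‖A 0‖ + ‖deriv A 0‖) * Real.exp (√(2 * y) * (2 * y)) :=
            norm_le_of_airy_ode hA hA' hode (by linarith) hz2
        _ = ‖A 0‖ * (Real.exp (Real.log K) * Real.exp (√(2 * y) * (2 * y))) := by
            rw [Real.exp_log (by linarith), hK]; field_simp
        _ ≤ ‖A (I * y)‖ * Real.exp ((Real.log K + 4) * (√y * y)) := by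
            rw [← Real.exp_add]
            gcongr
            · exact norm_zero_le_of_airy_ode hA hA' hode him hy0.le
            · have h1 : 1 ≤ √y * y := one_le_mul_of_one_le_of_one_le hs hy
              have h2 : √(2 * y) * (2 * y) ≤ 2 * √y * (2 * y) := by gcongr
              nlinarith)
  have e : 4 * ((Real.log K + 4) * (√y * y)) / y = 4 * (Real.log K + 4) * √y := by
    field_simp
  rwa [e] at h

/-- A solution of Airy's equation with `conj A(0) · A'(0) ≤ 0` and without zeros in the upper half
plane grows like `exp (k * y ^ (3 / 2))` on the positive imaginary axis. -/
lemma exists_exp_le_norm_sq_of_airy_ode {A : ℂ → ℂ} (hA : Differentiable ℂ A)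
    (hA' : Differentiable ℂ (deriv A)) (hode : ∀ z, deriv (deriv A) z = z * A z)
    (hA0 : A 0 ≠ 0) (him : ((starRingEnd ℂ) (A 0) * deriv A 0).im ≤ 0)
    (hre : ((starRingEnd ℂ) (A 0) * deriv A 0).re ≤ 0) {κ : ℝ} (hκ : 0 < κ)
    (hlog : ∀ y : ℝ, 1 ≤ y → ‖deriv A (I * y)‖ ≤ κ * √y * ‖A (I * y)‖) :
    ∃ c : ℝ, 0 < c ∧ ∀ y : ℝ, 1 ≤ y →
      c * Real.exp (2 / (3 * κ) * (y * √y)) ≤ √y * ‖A (I * y)‖ ^ 2 := by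
  have ha : 0 < ‖A 0‖ := norm_pos_iff.2 hA0
  set F : ℝ → ℝ := fun y => -((starRingEnd ℂ) (A (I * y)) * deriv A (I * y)).re with hFdef
  have hF : ∀ y : ℝ, HasDerivAt F (y * ‖A (I * y)‖ ^ 2) y := fun y => by
    refine (reCLM.hasFDerivAt.comp_hasDerivAt y
      (hasDerivAt_conj_mul_deriv_of_airy_ode hA hA' hode y)).neg.congr_deriv ?_
    simp [-ofReal_pow]
  have hF1 : 0 < F 1 := by
    have hmono : StrictMonoOn F (Ici 0) := by
      refine strictMonoOn_of_hasDerivWithinAt_pos (convex_Ici 0)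
        (fun y _ => (hF y).continuousAt.continuousWithinAt)
        (fun y _ => (hF y).hasDerivWithinAt) fun y hy => ?_
      rw [interior_Ici, mem_Ioi] at hy
      have := ha.trans_le (norm_zero_le_of_airy_ode hA hA' hode him hy.le)
      positivity
    have h1 := hmono (mem_Ici.2 le_rfl) (mem_Ici.2 zero_le_one) zero_lt_one
    have h2 : 0 ≤ F 0 := by
      simp only [hFdef, ofReal_zero, mul_zero]
      linarith
    linarith
  have hFle : ∀ y : ℝ, 1 ≤ y → F y ≤ κ * √y * ‖A (I * y)‖ ^ 2 := fun y hy => by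
    have h1 := (abs_le.1 (abs_re_le_norm ((starRingEnd ℂ) (A (I * y)) * deriv A (I * y)))).1
    rw [norm_mul, RCLike.norm_conj] at h1
    have h2 := mul_le_mul_of_nonneg_left (hlog y hy) (norm_nonneg (A (I * y)))
    calc F y ≤ ‖A (I * y)‖ * ‖deriv A (I * y)‖ := by simp only [hFdef]; linarith
      _ ≤ _ := by linarith
  set k := 2 / (3 * κ) with hk
  have hE : ∀ y : ℝ, 1 ≤ y → HasDerivAt (fun y => F y * Real.exp (-(k * (y * √y))))
      ((y * ‖A (I * y)‖ ^ 2 - √y / κ * F y) * Real.exp (-(k * (y * √y)))) y := fun y hy => by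
    have hy0 : 0 < y := by linarith
    have h1 : HasDerivAt (fun y => y * √y) (3 / 2 * √y) y := by
      refine ((hasDerivAt_id y).mul (Real.hasDerivAt_sqrt hy0.ne')).congr_deriv ?_
      have h3 : 0 < √y := Real.sqrt_pos.2 hy0
      simp only [id]
      field_simp
      rw [Real.sq_sqrt hy0.le]
      ring
    refine ((hF y).mul (h1.const_mul k).neg.exp).congr_deriv ?_
    rw [hk, Pi.neg_apply]
    field_simp
    ring
  have hmono : MonotoneOn (fun y => F y * Real.exp (-(k * (y * √y)))) (Ici 1) := by
    refine monotoneOn_of_hasDerivWithinAt_nonneg (convex_Ici 1)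
      (fun y hy => (hE y hy).continuousAt.continuousWithinAt)
      (fun y hy => (hE y (interior_subset hy)).hasDerivWithinAt) fun y hy => ?_
    have hy1 : 1 ≤ y := interior_subset hy
    refine mul_nonneg (sub_nonneg.2 ?_) (Real.exp_pos _).le
    calc √y / κ * F y ≤ √y / κ * (κ * √y * ‖A (I * y)‖ ^ 2) := by
          gcongr; exact hFle y hy1
      _ = √y * √y * ‖A (I * y)‖ ^ 2 := by field_simp
      _ = _ := by rw [Real.mul_self_sqrt (by linarith)]
  refine ⟨F 1 * Real.exp (-k) / κ, by positivity, fun y hy => ?_⟩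
  have h1 := hmono (mem_Ici.2 le_rfl) (mem_Ici.2 hy) hy
  simp only [Real.sqrt_one, mul_one] at h1
  rw [div_mul_eq_mul_div, div_le_iff₀ hκ]
  calc F 1 * Real.exp (-k) * Real.exp (k * (y * √y))
      ≤ F y * Real.exp (-(k * (y * √y))) * Real.exp (k * (y * √y)) := by gcongr
    _ = F y := by rw [mul_assoc, ← Real.exp_add, neg_add_cancel, Real.exp_zero, mul_one]
    _ ≤ κ * √y * ‖A (I * y)‖ ^ 2 := hFle y hy
    _ = _ := by ring

/-- Elementary comparison: `exp (k s ^ 3 - b s)` beats any multiple of `s ^ 5`. -/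
lemma eventually_mul_pow_le_exp (C b : ℝ) {k : ℝ} (hk : 0 < k) :
    ∀ᶠ s : ℝ in atTop, C * s ^ 5 ≤ Real.exp (k * s ^ 3 - b * s) := by
  have h1 : ∀ᶠ s : ℝ in atTop, C ≤ Real.exp s / s ^ 5 :=
    (Real.tendsto_exp_div_pow_atTop 5).eventually_ge_atTop C
  have h2 : ∀ᶠ s : ℝ in atTop, b + 1 ≤ k * s ^ 2 :=
    ((tendsto_pow_atTop two_ne_zero).const_mul_atTop hk).eventually_ge_atTop _
  filter_upwards [h1, h2, eventually_gt_atTop 0] with s h1 h2 hs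
  rw [le_div_iff₀ (by positivity)] at h1
  refine h1.trans (Real.exp_le_exp.2 ?_)
  nlinarith

/-- In a vertical strip, high in the upper half plane, such a solution of Airy's equation satisfies
`Im z ≤ ‖A z‖`. -/
lemma exists_im_le_norm_of_airy_ode {A : ℂ → ℂ} (hA : Differentiable ℂ A)
    (hA' : Differentiable ℂ (deriv A)) (hode : ∀ z, deriv (deriv A) z = z * A z)
    (h0 : ∀ z : ℂ, 0 < z.im → A z ≠ 0) (hA0 : A 0 ≠ 0)
    (him : ((starRingEnd ℂ) (A 0) * deriv A 0).im ≤ 0)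
    (hre : ((starRingEnd ℂ) (A 0) * deriv A 0).re ≤ 0) (R : ℝ) :
    ∃ Y : ℝ, ∀ z : ℂ, |z.re| ≤ R → Y ≤ z.im → z.im ≤ ‖A z‖ := by
  obtain ⟨κ, hκ, hlog⟩ := exists_exp_neg_le_norm_of_airy_ode hA hA' hode h0 hA0 him
  obtain ⟨c, hc, hgrow⟩ :=
    exists_exp_le_norm_sq_of_airy_ode hA hA' hode hA0 him hre hκ fun y hy => (hlog y hy).2
  have hev : ∀ᶠ y : ℝ in atTop,
      c⁻¹ * √y ^ 5 ≤ Real.exp (2 / (3 * κ) * √y ^ 3 - 2 * κ * R * √y) :=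
    Real.tendsto_sqrt_atTop.eventually
      (eventually_mul_pow_le_exp c⁻¹ (2 * κ * R) (by positivity : 0 < 2 / (3 * κ)))
  obtain ⟨Y, hY⟩ := eventually_atTop.1 hev
  refine ⟨max Y (max 1 (2 * R)), fun z hzR hz => ?_⟩
  obtain ⟨hz1, hz2, hz3⟩ : Y ≤ z.im ∧ 1 ≤ z.im ∧ 2 * R ≤ z.im := by
    simpa using hz
  set y := z.im with hy
  have hy0 : 0 < y := by linarith
  have hs : 0 < √y := Real.sqrt_pos.2 hy0
  have hsub : ‖z - I * y‖ ≤ R := by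
    have : z - I * y = (z.re : ℂ) := by apply Complex.ext <;> simp [hy]
    rw [this, norm_real]
    exact hzR
  have h1 : ‖A (I * y)‖ * Real.exp (-(κ * √y * R)) ≤ ‖A z‖ := by
    refine le_trans ?_ ((hlog y hz2).1 z (by linarith))
    gcongr
  have h2 := hgrow y hz2
  have h3 := hY y hz1
  have hsq : √y ^ 2 = y := Real.sq_sqrt hy0.le
  refine (sq_le_sq₀ hy0.le (norm_nonneg _)).1 ?_
  refine le_trans ?_ (pow_le_pow_left₀ (by positivity) h1 2)
  refine le_of_mul_le_mul_left ?_ hs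
  calc √y * y ^ 2 = c * (c⁻¹ * √y ^ 5) := by
        rw [mul_inv_cancel_left₀ hc.ne']; nth_rw 2 [← hsq]; ring
    _ ≤ c * Real.exp (2 / (3 * κ) * √y ^ 3 - 2 * κ * R * √y) := by gcongr
    _ = c * Real.exp (2 / (3 * κ) * (y * √y)) * Real.exp (-(κ * √y * R)) ^ 2 := by
        rw [← Real.exp_nat_mul, mul_assoc c, ← Real.exp_add]
        congr 2
        push_cast
        linear_combination 2 / (3 * κ) * √y * hsq
    _ ≤ √y * ‖A (I * y)‖ ^ 2 * Real.exp (-(κ * √y * R)) ^ 2 := by gcongr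
    _ = _ := by ring

/-- In a vertical strip, a solution of Airy's equation without non-real zeros and with
`conj A(0) · A'(0) ≤ 0` satisfies `|Im z| ≤ ‖A z‖` far from the real axis. -/
lemma exists_abs_im_le_norm_of_airy_ode {A : ℂ → ℂ} (hA : Differentiable ℂ A)
    (hA' : Differentiable ℂ (deriv A)) (hode : ∀ z, deriv (deriv A) z = z * A z)
    (h0 : ∀ z : ℂ, z.im ≠ 0 → A z ≠ 0) (hA0 : A 0 ≠ 0)
    (him : ((starRingEnd ℂ) (A 0) * deriv A 0).im = 0)
    (hre : ((starRingEnd ℂ) (A 0) * deriv A 0).re ≤ 0) (R : ℝ) :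
    ∃ Y : ℝ, ∀ z : ℂ, |z.re| ≤ R → Y ≤ |z.im| → |z.im| ≤ ‖A z‖ := by
  obtain ⟨Y₁, h₁⟩ := exists_im_le_norm_of_airy_ode hA hA' hode (fun z hz => h0 z hz.ne') hA0
    him.le hre R
  set B : ℂ → ℂ := starRingEnd ℂ ∘ A ∘ starRingEnd ℂ with hB
  have hB' : deriv B = starRingEnd ℂ ∘ deriv A ∘ starRingEnd ℂ := deriv_conj_conj
  have e : (starRingEnd ℂ) (B 0) * deriv B 0 =
      (starRingEnd ℂ) ((starRingEnd ℂ) (A 0) * deriv A 0) := by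
    simp [hB]
  obtain ⟨Y₂, h₂⟩ := exists_im_le_norm_of_airy_ode (A := B)
    (fun z => differentiableAt_conj_conj_iff.2 (hA _))
    (by rw [hB']; exact fun z => differentiableAt_conj_conj_iff.2 (hA' _))
    (fun z => by simp [hode, hB])
    (fun z hz => by
      have := h0 ((starRingEnd ℂ) z) (by simpa using hz.ne')
      simpa [hB] using this)
    (by simpa [hB] using hA0) (by rw [e, conj_im, him, neg_zero]) (by rwa [e, conj_re]) R
  refine ⟨max Y₁ Y₂, fun z hzR hz => ?_⟩
  rcases abs_cases z.im with ⟨hz', _⟩ | ⟨hz', _⟩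
  · rw [hz'] at hz ⊢
    exact h₁ z hzR ((le_max_left _ _).trans hz)
  · rw [hz'] at hz ⊢
    have := h₂ ((starRingEnd ℂ) z) (by simpa using hzR) (by simpa using (le_max_right _ _).trans hz)
    simpa [hB] using this

/-- A continuous function on `ℝ` bounded by `C / (1 + y ^ 2)` for large `|y|` is integrable. -/
lemma integrable_of_norm_le_div_one_add_sq {f : ℝ → ℂ} (hf : Continuous f) {C Y : ℝ}
    (hb : ∀ y, Y ≤ |y| → ‖f y‖ ≤ C / (1 + y ^ 2)) : Integrable f := by
  refine hf.locallyIntegrable.integrable_of_isBigO_cocompact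
    (g := fun y => (1 + y ^ 2)⁻¹) ?_ (integrable_inv_one_add_sq.integrableAtFilter _)
  refine Asymptotics.IsBigO.of_bound C ?_
  filter_upwards [tendsto_norm_cocompact_atTop.eventually_ge_atTop Y] with y hy
  refine (hb y hy).trans_eq ?_
  rw [div_eq_mul_inv, Real.norm_of_nonneg (by positivity)]

/-- Shifting a vertical contour of integration. -/
lemma integral_vertical_eq_of_differentiableOn {f : ℂ → ℂ} {a b C Y : ℝ}
    (hf : DifferentiableOn ℂ f (re ⁻¹' uIcc a b))
    (hb : ∀ z : ℂ, z.re ∈ uIcc a b → Y ≤ |z.im| → ‖f z‖ ≤ C / (1 + z.im ^ 2)) :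
    ∫ y : ℝ, f (a + y * I) = ∫ y : ℝ, f (b + y * I) := by
  have hint : ∀ x ∈ uIcc a b, Integrable fun y : ℝ => f (x + y * I) := by
    intro x hx
    refine integrable_of_norm_le_div_one_add_sq (C := C) (Y := Y) ?_ fun y hy => ?_
    · exact hf.continuousOn.comp_continuous (by fun_prop) fun y => by simpa using hx
    · simpa using hb (x + y * I) (by simpa using hx) (by simpa using hy)
  have hlim : ∀ x ∈ uIcc a b, Tendsto (fun T : ℝ => ∫ y in (-T)..T, f (x + y * I)) atTop
      (𝓝 (∫ y : ℝ, f (x + y * I))) := fun x hx =>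
    intervalIntegral_tendsto_integral (hint x hx) tendsto_neg_atTop_atBot tendsto_id
  have hdecay : Tendsto (fun T : ℝ => C / (1 + T ^ 2) * |b - a|) atTop (𝓝 0) := by
    have : Tendsto (fun T : ℝ => 1 + T ^ 2) atTop atTop :=
      tendsto_atTop_add_const_left _ _ (tendsto_pow_atTop two_ne_zero)
    simpa using (this.const_div_atTop C).mul_const |b - a|
  have hhor : ∀ s : ℝ, |s| = 1 →
      Tendsto (fun T : ℝ => ∫ x in a..b, f (x + (s * T : ℝ) * I)) atTop (𝓝 0) := by
    intro s hs
    refine squeeze_zero_norm' ?_ hdecay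
    filter_upwards [eventually_ge_atTop Y, eventually_ge_atTop 0] with T hT hT0
    refine intervalIntegral.norm_integral_le_of_norm_le_const fun x hx => ?_
    have := hb (x + (s * T : ℝ) * I) (by simpa using uIoc_subset_uIcc hx)
      (by simpa [abs_mul, hs] using hT.trans (le_abs_self T))
    have hs2 : s ^ 2 = 1 := by rw [← sq_abs, hs, one_pow]
    simpa [mul_pow, hs2] using this
  have hrect : ∀ T : ℝ,
      (∫ x in a..b, f (x + ((-1) * T : ℝ) * I)) - (∫ x in a..b, f (x + (1 * T : ℝ) * I)) +
        I * (∫ y in (-T)..T, f (b + y * I)) - I * (∫ y in (-T)..T, f (a + y * I)) = 0 := by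
    intro T
    have := integral_boundary_rect_eq_zero_of_differentiableOn f ⟨a, -T⟩ ⟨b, T⟩
      (hf.mono fun z hz => hz.1)
    simpa using this
  have h := (((hhor (-1) (by simp)).sub (hhor 1 (by simp))).add
    ((hlim b right_mem_uIcc).const_mul I)).sub ((hlim a left_mem_uIcc).const_mul I)
  have h0 := tendsto_nhds_unique (h.congr hrect) tendsto_const_nhds
  rw [sub_zero, zero_add, ← mul_sub] at h0
  exact (sub_eq_zero.1 ((mul_eq_zero.1 h0).resolve_left I_ne_zero)).symm

/-- The initial values of the Airy function are real, of opposite sign, and nonzero. -/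
lemma airy_initial_values {a b : ℂ} (ha : a = (3 : ℂ) ^ (-(2 : ℂ) / 3) / Complex.Gamma (2 / 3))
    (hb : b = -(3 : ℂ) ^ (-(1 : ℂ) / 3) / Complex.Gamma (1 / 3)) :
    a ≠ 0 ∧ ((starRingEnd ℂ) a * b).im = 0 ∧ ((starRingEnd ℂ) a * b).re ≤ 0 := by
  have ha' : a = (((3 : ℝ) ^ (-(2 : ℝ) / 3) / Real.Gamma (2 / 3) : ℝ) : ℂ) := by
    rw [ha, ofReal_div, ← Complex.Gamma_ofReal, ofReal_cpow (by norm_num)]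
    push_cast
    rfl
  have hb' : b = ((-((3 : ℝ) ^ (-(1 : ℝ) / 3) / Real.Gamma (1 / 3)) : ℝ) : ℂ) := by
    rw [hb, ofReal_neg, ofReal_div, ← Complex.Gamma_ofReal, ofReal_cpow (by norm_num), neg_div]
    push_cast
    rfl
  have h1 : 0 < (3 : ℝ) ^ (-(2 : ℝ) / 3) / Real.Gamma (2 / 3) :=
    div_pos (by positivity) (Real.Gamma_pos_of_pos (by norm_num))
  have h2 : 0 < (3 : ℝ) ^ (-(1 : ℝ) / 3) / Real.Gamma (1 / 3) :=
    div_pos (by positivity) (Real.Gamma_pos_of_pos (by norm_num))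
  rw [ha', hb', conj_ofReal, ← ofReal_mul]
  refine ⟨ofReal_ne_zero.2 h1.ne', ofReal_im _, ?_⟩
  rw [ofReal_re]
  nlinarith

theorem airy_contour_integral_independent_of_abscissa (Ai : ℂ → ℂ)
    (hAi_d1 : Differentiable ℂ Ai)
    (hAi_d2 : Differentiable ℂ (deriv Ai))
    (hAi_ode : ∀ z : ℂ, deriv (deriv Ai) z = z * Ai z)
    (hAi_0 : Ai 0 = (3 : ℂ) ^ (-(2 : ℂ) / 3) / Complex.Gamma (2 / 3))
    (hAi_0' : deriv Ai 0 = -(3 : ℂ) ^ (-(1 : ℂ) / 3) / Complex.Gamma (1 / 3))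
    (hAi_zeros : ∀ z : ℂ, Ai z = 0 → ∃ x : ℝ, x < 0 ∧ z = (x : ℂ))
    (a₁ : ℝ)
    (ha₁_zero : Ai (a₁ : ℂ) = 0)
    (ha₁_max : ∀ z : ℂ, Ai z = 0 → z.re ≤ a₁) :
    ∀ (t : ℝ) (σ : ℝ), a₁ < σ →
      (1 / (2 * (Real.pi : ℂ))) *
          ∫ y : ℝ, 1 / (Ai ((σ : ℂ) + Complex.I * y + Complex.I * t) * Ai ((σ : ℂ) + Complex.I * y)) =
        (1 / (2 * (Real.pi : ℂ))) *
          ∫ y : ℝ, 1 / (Ai (Complex.I * y + Complex.I * t) * Ai (Complex.I * y)) := by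
  intro t σ hσ
  have ha₁ : a₁ < 0 := by
    obtain ⟨x, hx, hxa⟩ := hAi_zeros _ ha₁_zero
    rwa [ofReal_inj.1 hxa]
  obtain ⟨hne, him, hre⟩ := airy_initial_values hAi_0 hAi_0'
  obtain ⟨Y, hY⟩ := exists_abs_im_le_norm_of_airy_ode hAi_d1 hAi_d2 hAi_ode
    (fun z hz h => by
      obtain ⟨x, -, rfl⟩ := hAi_zeros z h
      exact hz (ofReal_im x)) hne him hre |σ|
  have hstrip : ∀ z : ℂ, z.re ∈ uIcc σ 0 → a₁ < z.re ∧ |z.re| ≤ |σ| := by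
    intro z hz
    refine ⟨(lt_min hσ ha₁).trans_le hz.1, ?_⟩
    simpa using abs_sub_right_of_mem_uIcc hz
  have hnz : ∀ z : ℂ, a₁ < z.re → Ai z ≠ 0 := fun z hz h => (ha₁_max z h).not_gt hz
  have hshift : ∀ z : ℂ, (z + I * t).re = z.re := by simp
  have h := integral_vertical_eq_of_differentiableOn (a := σ) (b := 0) (C := 4)
    (Y := 2 * (|Y| + |t| + 1)) (f := fun z => 1 / (Ai (z + I * t) * Ai z))
    (fun z hz => by
      have hz1 := (hstrip z hz).1
      have h1 : DifferentiableAt ℂ (fun z => Ai (z + I * t) * Ai z) z := by fun_prop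
      exact ((differentiableAt_const 1).div h1 (mul_ne_zero
        (hnz _ (by rwa [hshift])) (hnz _ hz1))).differentiableWithinAt)
    (fun z hz hzY => by
      have hz2 := (hstrip z hz).2
      have ht := abs_nonneg t
      have hYa := le_abs_self Y
      have hY0 := abs_nonneg Y
      have h1 := hY z hz2 (by linarith)
      have him : (z + I * t).im = z.im + t := by simp
      have h3 : |z.im| - |t| ≤ |z.im + t| := by
        simpa using abs_sub_abs_le_abs_sub z.im (-t)
      have h2 := hY (z + I * t) (by rwa [hshift]) (by rw [him]; linarith)
      rw [him] at h2
      have h4 : |z.im| / 2 ≤ ‖Ai (z + I * t)‖ := by linarith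
      have h5 : 1 ≤ |z.im| := by linarith
      have h6 : |z.im| / 2 * |z.im| ≤ ‖Ai (z + I * t)‖ * ‖Ai z‖ := by gcongr
      have h7 : |z.im| * |z.im| = z.im ^ 2 := by rw [← sq, sq_abs]
      rw [norm_div, norm_one, norm_mul, div_le_div_iff₀ (by nlinarith) (by positivity)]
      nlinarith)
  congr 1
  simpa [mul_comm] using h
end

section
/- The moment generating function t ↦ ∫_ℝ e^(tx) f(x) dx of the Chernoff density f is finite for every complex t and defines an entire function; moreover, for every complex t and every real σ with σ > a₁ and σ + Re t > a₁ (where a₁ is the largest zero of Ai), one has ∫_ℝ e^(tx) f(x) dx = (1/(2πi)) ∫_{σ−i∞}^{σ+i∞} dz/(Ai(z+t)·Ai(z)) = (1/(2π)) ∫_ℝ dy/(Ai(σ+iy+t)·Ai(σ+iy)). -/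
open MeasureTheory Set Filter Topology

/-- Differentiation under the integral sign for a locally dominated holomorphic integrand; the
derivative is dominated by Cauchy's estimate. -/
theorem hasDerivAt_integral_of_differentiableOn_of_norm_le {α : Type*} [MeasurableSpace α]
    {μ : Measure α} {F : ℂ → α → ℂ} {F' : α → ℂ} {z₀ : ℂ} {ε : ℝ} (hε : 0 < ε) {bound : α → ℝ}
    (hmeas : ∀ z ∈ Metric.ball z₀ ε, AEStronglyMeasurable (F z) μ)
    (hdiff : ∀ᵐ a ∂μ, DifferentiableOn ℂ (fun z => F z a) (Metric.ball z₀ ε))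
    (hF' : ∀ᵐ a ∂μ, HasDerivAt (fun z => F z a) (F' a) z₀)
    (hbound : ∀ᵐ a ∂μ, ∀ z ∈ Metric.ball z₀ ε, ‖F z a‖ ≤ bound a)
    (hint : Integrable bound μ) :
    Integrable F' μ ∧ HasDerivAt (fun z => ∫ a, F z a ∂μ) (∫ a, F' a ∂μ) z₀ := by
  classical
  have hz₀ : z₀ ∈ Metric.ball z₀ ε := Metric.mem_ball_self hε
  have hF'meas : AEStronglyMeasurable F' μ := by
    let h : ℕ → ℂ := fun n => ((ε / 2 * (1 / ((n : ℝ) + 1)) : ℝ) : ℂ)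
    have hpos (n : ℕ) : 0 < ε / 2 * (1 / ((n : ℝ) + 1)) := by positivity
    have hlim : Tendsto h atTop (𝓝 0) := by
      have := (tendsto_one_div_add_atTop_nhds_zero_nat (𝕜 := ℝ)).const_mul (ε / 2)
      rw [mul_zero] at this
      exact (Complex.continuous_ofReal.tendsto' 0 0 Complex.ofReal_zero).comp this
    have hlim' : Tendsto h atTop (𝓝[≠] 0) :=
      tendsto_nhdsWithin_iff.2
        ⟨hlim, .of_forall fun n => Complex.ofReal_ne_zero.2 (hpos n).ne'⟩
    have hmem (n : ℕ) : z₀ + h n ∈ Metric.ball z₀ ε := by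
      rw [mem_ball_iff_norm, add_sub_cancel_left, Complex.norm_real, Real.norm_of_nonneg (hpos n).le]
      have : 1 / ((n : ℝ) + 1) ≤ 1 := by
        rw [div_le_one (by positivity)]; linarith [n.cast_nonneg (α := ℝ)]
      nlinarith
    refine aestronglyMeasurable_of_tendsto_ae atTop
      (f := fun n a => (h n)⁻¹ • (F (z₀ + h n) a - F z₀ a))
      (fun n => ((hmeas _ (hmem n)).sub (hmeas _ hz₀)).const_smul (h n)⁻¹) ?_
    filter_upwards [hF'] with a ha
    exact ha.tendsto_slope_zero.comp hlim'
  refine ⟨?_, ?_⟩ <;>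
  have key := hasDerivAt_integral_of_dominated_loc_of_deriv_le (μ := μ) (𝕜 := ℂ) (F := F)
    (F' := fun z a => if z = z₀ then F' a else deriv (fun z => F z a) z) (x₀ := z₀)
    (bound := fun a => bound a / (ε / 2)) (Metric.ball_mem_nhds z₀ (half_pos hε))
    (by filter_upwards [Metric.ball_mem_nhds z₀ hε] with z hz using hmeas z hz)
    (hint.mono' (hmeas _ hz₀) (by filter_upwards [hbound] with a ha using ha _ hz₀))
    (by simpa using hF'meas)
    (by
      filter_upwards [hbound, hdiff, hF'] with a ha hd hd' z hz
      have hsub : Metric.closedBall z (ε / 2) ⊆ Metric.ball z₀ ε := fun x hx => by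
        rw [Metric.mem_ball, Metric.mem_closedBall] at *
        linarith [dist_triangle x z z₀]
      have : ‖deriv (fun z => F z a) z‖ ≤ bound a / (ε / 2) := by
        refine Complex.norm_deriv_le_of_forall_mem_sphere_norm_le (half_pos hε) ?_
          fun x hx => ha x (hsub (Metric.sphere_subset_closedBall hx))
        exact (hd.mono hsub).diffContOnCl_ball subset_rfl
      split_ifs with h
      · rwa [h, hd'.deriv] at this
      · exact this)
    (hint.div_const _)
    (by
      filter_upwards [hdiff, hF'] with a hd hd' z hz
      split_ifs with h
      · rwa [h]
      · exact (hd.differentiableAt (Metric.isOpen_ball.mem_nhds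
          (Metric.ball_subset_ball (by linarith) hz))).hasDerivAt)
  · simpa using key.1
  · simpa using key.2

theorem exists_neg_mul_cube_add_le (ε : ℝ) (hε : 0 < ε) (M : ℝ) (hM : 0 ≤ M) :
    ∃ K : ℝ, ∀ r : ℝ, 0 ≤ r → -ε * r ^ 3 + M * (1 + r) ^ 2 ≤ K - r := by
  set A := 2 * M + 1 with hA
  refine ⟨2 * M + 1 + A * (A / ε) ^ 2, fun r hr => ?_⟩
  have h1 : M * (1 + r) ^ 2 + r ≤ 2 * M + 1 + A * r ^ 2 := by
    nlinarith [sq_nonneg (r - 1), mul_nonneg hM (sq_nonneg (r - 1))]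
  have h2 : A * r ^ 2 ≤ ε * r ^ 3 + A * (A / ε) ^ 2 := by
    rcases le_total (A / ε) r with h | h
    · rw [div_le_iff₀ hε] at h
      have : 0 ≤ A * (A / ε) ^ 2 := by positivity
      nlinarith [mul_le_mul_of_nonneg_right h (sq_nonneg r)]
    · have : r ^ 2 ≤ (A / ε) ^ 2 := by gcongr
      have : A * r ^ 2 ≤ A * (A / ε) ^ 2 := by gcongr
      have : 0 ≤ ε * r ^ 3 := by positivity
      linarith
  linarith

/-- On a ray in a direction `v` with `Re v ^ 3 < 0`, the Airy integrand decays exponentially,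
locally uniformly in the base point `w` of the ray and in the parameter `z`. -/
theorem exists_norm_exp_airy_phase_le {v : ℂ} (hv : ‖v‖ = 1) (hv3 : (v ^ 3).re < 0) (R : ℝ) :
    ∃ K : ℝ, ∀ w z : ℂ, ∀ r : ℝ, ‖w‖ ≤ R → ‖z‖ ≤ R → 0 ≤ r →
      ‖Complex.exp ((w + r * v) ^ 3 / 3 - z * (w + r * v))‖ ≤ Real.exp (K - r) := by
  wlog hR : 0 ≤ R generalizing R
  · exact ⟨0, fun w z r hw => absurd ((norm_nonneg w).trans hw) hR⟩
  obtain ⟨K, hK⟩ := exists_neg_mul_cube_add_le (-(v ^ 3).re / 3) (by linarith)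
    (R ^ 3 + R ^ 2 + R + R * (R + 1)) (by positivity)
  refine ⟨K, fun w z r hw hz hr => ?_⟩
  rw [Complex.norm_exp, Real.exp_le_exp]
  refine le_trans ?_ (hK r hr)
  have e : (w + r * v) ^ 3 / 3 - z * (w + r * v) =
      ((r ^ 3 / 3 : ℝ) : ℂ) * v ^ 3 +
        (w ^ 3 / 3 + r * (w ^ 2 * v) + r ^ 2 * (w * v ^ 2) - z * (w + r * v)) := by
    push_cast; ring
  rw [e, Complex.add_re, Complex.re_ofReal_mul]
  have h := Complex.re_le_norm
    (w ^ 3 / 3 + r * (w ^ 2 * v) + r ^ 2 * (w * v ^ 2) - z * (w + r * v))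
  have h' : ‖w ^ 3 / 3 + r * (w ^ 2 * v) + r ^ 2 * (w * v ^ 2) - z * (w + r * v)‖ ≤
      R ^ 3 / 3 + r * R ^ 2 + r ^ 2 * R + R * (R + r) := by
    refine (norm_sub_le _ _).trans (add_le_add ((norm_add₃_le).trans ?_) ?_)
    · simp only [norm_mul, norm_div, norm_pow, hv, Complex.norm_real, Real.norm_of_nonneg hr,
        one_pow, mul_one, Complex.norm_ofNat]
      gcongr
    · rw [norm_mul]
      gcongr
      refine (norm_add_le _ _).trans ?_
      rw [norm_mul, hv, Complex.norm_real, Real.norm_of_nonneg hr, mul_one]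
      gcongr
  have : R ^ 3 / 3 + r * R ^ 2 + r ^ 2 * R + R * (R + r) ≤
      (R ^ 3 + R ^ 2 + R + R * (R + 1)) * (1 + r) ^ 2 := by
    have a1 : 0 ≤ R ^ 3 := by positivity
    have a2 : 0 ≤ R ^ 2 := by positivity
    have e1 : (1:ℝ) ≤ (1 + r) ^ 2 := by nlinarith
    have e2 : r ≤ (1 + r) ^ 2 := by nlinarith
    have e3 : r ^ 2 ≤ (1 + r) ^ 2 := by nlinarith
    have e4 : R + r ≤ (R + 1) * (1 + r) ^ 2 := by nlinarith [mul_nonneg hR hr]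
    nlinarith [mul_le_mul_of_nonneg_left e1 a1, mul_le_mul_of_nonneg_left e2 a2,
      mul_le_mul_of_nonneg_left e3 hR, mul_le_mul_of_nonneg_left e4 hR]
  linarith

/-- The `k`-th moment of the Airy integrand along the ray from `w` in the direction `v`. -/
noncomputable def airyRay (k : ℕ) (v w z : ℂ) : ℂ :=
  ∫ r in Ioi (0 : ℝ), (w + r * v) ^ k * Complex.exp ((w + r * v) ^ 3 / 3 - z * (w + r * v)) * v

theorem exists_norm_airyRay_integrand_le {v : ℂ} (hv : ‖v‖ = 1) (hv3 : (v ^ 3).re < 0) (k : ℕ)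
    (R : ℝ) : ∃ C : ℝ, ∀ w z : ℂ, ∀ r : ℝ, ‖w‖ ≤ R → ‖z‖ ≤ R → 0 ≤ r →
      ‖(w + r * v) ^ k * Complex.exp ((w + r * v) ^ 3 / 3 - z * (w + r * v))‖ ≤
        C * Real.exp (-(1 / 2) * r) := by
  obtain ⟨K, hK⟩ := exists_norm_exp_airy_phase_le hv hv3 R
  refine ⟨k.factorial * 2 ^ k * Real.exp (R / 2) * Real.exp K, fun w z r hw hz hr => ?_⟩
  have hnorm : ‖w + r * v‖ ≤ R + r := by
    refine (norm_add_le _ _).trans ?_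
    rw [norm_mul, hv, Complex.norm_real, Real.norm_of_nonneg hr, mul_one]
    gcongr
  have h0 : 0 ≤ R + r := (norm_nonneg _).trans hnorm
  have hpow : (R + r) ^ k ≤ k.factorial * 2 ^ k * Real.exp ((R + r) / 2) := by
    have h := Real.pow_div_factorial_le_exp ((R + r) / 2) (by positivity) k
    rw [div_le_iff₀ (by positivity), div_pow, div_le_iff₀ (by positivity)] at h
    linarith
  rw [norm_mul, norm_pow]
  calc _ ≤ (R + r) ^ k * Real.exp (K - r) := by
        gcongr
        exact hK w z r hw hz hr
    _ ≤ k.factorial * 2 ^ k * Real.exp ((R + r) / 2) * Real.exp (K - r) := by gcongr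
    _ = k.factorial * 2 ^ k * (Real.exp (R / 2) * Real.exp K * Real.exp (-(1 / 2) * r)) := by
        rw [mul_assoc, ← Real.exp_add, ← Real.exp_add, ← Real.exp_add]
        ring_nf
    _ = _ := by ring

theorem integrableOn_const_mul_exp_neg_half (C : ℝ) :
    IntegrableOn (fun r : ℝ => C * Real.exp (-(1 / 2) * r)) (Ioi 0) :=
  (integrableOn_exp_mul_Ioi (by norm_num) 0).const_mul C

theorem continuous_airyRay_integrand (k : ℕ) (v w z : ℂ) : Continuous fun r : ℝ =>
    (w + r * v) ^ k * Complex.exp ((w + r * v) ^ 3 / 3 - z * (w + r * v)) * v := by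
  fun_prop

theorem integrableOn_airyRay_integrand {v : ℂ} (hv : ‖v‖ = 1) (hv3 : (v ^ 3).re < 0) (k : ℕ)
    (w z : ℂ) : IntegrableOn (fun r : ℝ =>
      (w + r * v) ^ k * Complex.exp ((w + r * v) ^ 3 / 3 - z * (w + r * v)) * v) (Ioi 0) := by
  obtain ⟨C, hC⟩ := exists_norm_airyRay_integrand_le hv hv3 k (max ‖w‖ ‖z‖)
  refine (integrableOn_const_mul_exp_neg_half C).mono'
    (continuous_airyRay_integrand k v w z).aestronglyMeasurable ?_
  refine (ae_restrict_iff' measurableSet_Ioi).2 (.of_forall fun r hr => ?_)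
  rw [norm_mul, hv, mul_one]
  exact hC w z r (le_max_left _ _) (le_max_right _ _) (le_of_lt hr)

theorem integral_deriv_airy_phase {v : ℂ} (hv : ‖v‖ = 1) (hv3 : (v ^ 3).re < 0) (w z : ℂ) :
    airyRay 2 v w z - z * airyRay 0 v w z = -Complex.exp (w ^ 3 / 3 - z * w) := by
  obtain ⟨K, hK⟩ := exists_norm_exp_airy_phase_le hv hv3 (max ‖w‖ ‖z‖)
  have hlim : Tendsto (fun r : ℝ => Complex.exp ((w + r * v) ^ 3 / 3 - z * (w + r * v)))
      atTop (𝓝 0) := by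
    refine squeeze_zero_norm' ?_ (a := fun r => Real.exp (K - r)) ?_
    · filter_upwards [eventually_ge_atTop 0] with r hr
      exact hK w z r (le_max_left _ _) (le_max_right _ _) hr
    · exact Real.tendsto_exp_atBot.comp (tendsto_atBot_add_const_left _ K tendsto_neg_atTop_atBot)
  have h2 := integrableOn_airyRay_integrand hv hv3 2 w z
  have h0 := (integrableOn_airyRay_integrand hv hv3 0 w z).const_mul z
  have key := integral_Ioi_of_hasDerivAt_of_tendsto' (a := (0 : ℝ)) (fun r _ => ?_)
    (h2.sub h0) hlim
  · rw [airyRay, airyRay, ← integral_const_mul, ← integral_sub h2 h0]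
    simpa using key
  · have h1 : HasDerivAt (fun r : ℝ => w + (r : ℂ) * v) v r := by
      simpa using ((Complex.ofRealCLM.hasDerivAt (x := r)).mul_const v).const_add w
    have := ((((h1.pow 3).div_const 3).sub (h1.const_mul z))).cexp
    refine this.congr_deriv ?_
    simp only [Pi.sub_apply, Pi.pow_apply, Nat.cast_ofNat]
    ring

theorem hasDerivAt_airyRay_base {v : ℂ} (hv : ‖v‖ = 1) (hv3 : (v ^ 3).re < 0) (w z : ℂ) :
    HasDerivAt (fun w => airyRay 0 v w z) (-Complex.exp (w ^ 3 / 3 - z * w)) w := by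
  obtain ⟨C, hC⟩ := exists_norm_airyRay_integrand_le hv hv3 0 (max (‖w‖ + 1) ‖z‖)
  have hd (r : ℝ) (w : ℂ) : HasDerivAt (fun w : ℂ =>
      (w + r * v) ^ 0 * Complex.exp ((w + r * v) ^ 3 / 3 - z * (w + r * v)) * v)
      ((w + r * v) ^ 2 * Complex.exp ((w + r * v) ^ 3 / 3 - z * (w + r * v)) * v -
        z * ((w + r * v) ^ 0 * Complex.exp ((w + r * v) ^ 3 / 3 - z * (w + r * v)) * v)) w := by
    have h1 : HasDerivAt (fun w : ℂ => w + (r : ℂ) * v) 1 w := (hasDerivAt_id w).add_const _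
    have := ((((h1.pow 3).div_const 3).sub (h1.const_mul z))).cexp.mul_const v
    simp only [pow_zero, one_mul]
    refine this.congr_deriv ?_
    simp only [Pi.sub_apply, Pi.pow_apply, Nat.cast_ofNat]
    ring
  have key := (hasDerivAt_integral_of_differentiableOn_of_norm_le (μ := volume.restrict (Ioi 0))
    (z₀ := w) one_pos
    (fun w _ => (continuous_airyRay_integrand 0 v w z).aestronglyMeasurable)
    (.of_forall fun r w _ => (hd r w).differentiableAt.differentiableWithinAt)
    (.of_forall fun r => hd r w)
    ((ae_restrict_iff' measurableSet_Ioi).2 (.of_forall fun r hr w' hw' => ?_))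
    (integrableOn_const_mul_exp_neg_half C)).2
  · refine key.congr_deriv ?_
    rw [← integral_deriv_airy_phase hv hv3, airyRay, airyRay, ← integral_const_mul,
      ← integral_sub (integrableOn_airyRay_integrand hv hv3 2 w z)
        ((integrableOn_airyRay_integrand hv hv3 0 w z).const_mul z)]
  · rw [norm_mul, hv, mul_one]
    refine hC w' z r (le_max_of_le_left ?_) (le_max_right _ _) (le_of_lt hr)
    rw [mem_ball_iff_norm] at hw'
    linarith [norm_sub_norm_le w' w]

theorem hasDerivAt_airyRay {v : ℂ} (hv : ‖v‖ = 1) (hv3 : (v ^ 3).re < 0) (k : ℕ) (w z : ℂ) :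
    HasDerivAt (fun z => airyRay k v w z) (-airyRay (k + 1) v w z) z := by
  obtain ⟨C, hC⟩ := exists_norm_airyRay_integrand_le hv hv3 k (max ‖w‖ (‖z‖ + 1))
  have hd (r : ℝ) (z : ℂ) : HasDerivAt (fun z : ℂ =>
      (w + r * v) ^ k * Complex.exp ((w + r * v) ^ 3 / 3 - z * (w + r * v)) * v)
      (-((w + r * v) ^ (k + 1) * Complex.exp ((w + r * v) ^ 3 / 3 - z * (w + r * v)) * v)) z := by
    have := ((((hasDerivAt_id z).mul_const (w + r * v)).const_sub
      ((w + r * v) ^ 3 / 3)).cexp.const_mul ((w + r * v) ^ k)).mul_const v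
    refine this.congr_deriv ?_
    simp only [id]
    ring
  have key := (hasDerivAt_integral_of_differentiableOn_of_norm_le (μ := volume.restrict (Ioi 0))
    (z₀ := z) one_pos
    (fun z _ => (continuous_airyRay_integrand k v w z).aestronglyMeasurable)
    (.of_forall fun r w _ => (hd r w).differentiableAt.differentiableWithinAt)
    (.of_forall fun r => hd r z)
    ((ae_restrict_iff' measurableSet_Ioi).2 (.of_forall fun r hr z' hz' => ?_))
    (integrableOn_const_mul_exp_neg_half C)).2
  · refine key.congr_deriv ?_
    rw [airyRay, ← integral_neg]
  · rw [norm_mul, hv, mul_one]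
    refine hC w z' r (le_max_left _ _) (le_max_of_le_right ?_) (le_of_lt hr)
    rw [mem_ball_iff_norm] at hz'
    linarith [norm_sub_norm_le z' z]

/-- The difference of two rays does not depend on their common base point. -/
theorem airyRay_sub_airyRay_eq {v v' : ℂ} (hv : ‖v‖ = 1) (hv3 : (v ^ 3).re < 0) (hv' : ‖v'‖ = 1)
    (hv3' : (v' ^ 3).re < 0) (w w' z : ℂ) :
    airyRay 0 v w z - airyRay 0 v' w z = airyRay 0 v w' z - airyRay 0 v' w' z := by
  have hd (w : ℂ) : HasDerivAt (fun w => airyRay 0 v w z - airyRay 0 v' w z) 0 w :=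
    ((hasDerivAt_airyRay_base hv hv3 w z).sub (hasDerivAt_airyRay_base hv' hv3' w z)).congr_deriv
      (sub_self _)
  exact is_const_of_deriv_eq_zero (fun w => (hd w).differentiableAt) (fun w => (hd w).deriv) w w'

noncomputable def cubicMoment (k : ℕ) (u : ℂ) : ℂ :=
  ∫ r in Ioi (0 : ℝ), (r * u) ^ k * Complex.exp (-(r * u) ^ 3 / 3) * u

def cubicSector : Set ℂ := {u | u.im < u.re / 2 ∧ -u.im < u.re / 2}

theorem isOpen_cubicSector : IsOpen cubicSector := by
  refine IsOpen.inter ?_ ?_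
  · exact isOpen_lt Complex.continuous_im (Complex.continuous_re.div_const 2)
  · exact isOpen_lt Complex.continuous_im.neg (Complex.continuous_re.div_const 2)

theorem convex_cubicSector : Convex ℝ cubicSector := by
  intro x hx y hy a b ha hb hab
  simp only [cubicSector, mem_ofPred_eq, Complex.add_re, Complex.add_im, Complex.real_smul,
    Complex.re_ofReal_mul, Complex.im_ofReal_mul] at *
  rcases ha.eq_or_lt with rfl | ha
  · rw [zero_add] at hab
    subst hab
    simpa using hy
  · constructor <;>
    nlinarith [mul_lt_mul_of_pos_left hx.1 ha, mul_lt_mul_of_pos_left hx.2 ha,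
      mul_le_mul_of_nonneg_left hy.1.le hb, mul_le_mul_of_nonneg_left hy.2.le hb]

theorem pow_three_re_pos_of_mem_cubicSector {u : ℂ} (hu : u ∈ cubicSector) : 0 < (u ^ 3).re := by
  obtain ⟨h1, h2⟩ := hu
  have hre : 0 < u.re := by linarith
  have him : 0 < u.re ^ 2 - 4 * u.im ^ 2 := by nlinarith
  have : (u ^ 3).re = u.re * (u.re ^ 2 - 3 * u.im ^ 2) := by
    simp [pow_succ, Complex.mul_re, Complex.mul_im]; ring
  rw [this]
  have : 0 < u.re ^ 2 - 3 * u.im ^ 2 := by nlinarith [sq_nonneg u.im]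
  positivity

theorem differentiableAt_cubicMoment (k : ℕ) {u : ℂ} (hu : 0 < (u ^ 3).re) :
    DifferentiableAt ℂ (cubicMoment k) u := by
  set δ := (u ^ 3).re / 2
  have hδ : 0 < δ := half_pos hu
  have hnhds : {x : ℂ | δ < (x ^ 3).re} ∈ 𝓝 u :=
    (isOpen_lt continuous_const (Complex.continuous_re.comp (continuous_pow 3))).mem_nhds
      (half_lt_self hu)
  obtain ⟨ε, hε, hball⟩ := Metric.mem_nhds_iff.1 hnhds
  have hd (r : ℝ) : Differentiable ℂ fun u : ℂ =>
      (r * u) ^ k * Complex.exp (-(r * u) ^ 3 / 3) * u := by fun_prop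
  refine (hasDerivAt_integral_of_differentiableOn_of_norm_le (μ := volume.restrict (Ioi 0)) hε
    (bound := fun r => (‖u‖ + ε) ^ (k + 1) * (r ^ (k : ℝ) * Real.exp (-(δ / 3) * r ^ (3 : ℝ))))
    (fun z _ => by fun_prop)
    (.of_forall fun r => (hd r).differentiableOn)
    (.of_forall fun r => ((hd r) u).hasDerivAt)
    ((ae_restrict_iff' measurableSet_Ioi).2 (.of_forall fun r hr x hx => ?_))
    ?_).2.differentiableAt
  · have hr : 0 < r := hr
    have hx3 : δ < (x ^ 3).re := hball hx
    have hxn : ‖x‖ ≤ ‖u‖ + ε := by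
      rw [mem_ball_iff_norm] at hx
      linarith [norm_sub_norm_le x u]
    have e : (-(r * x) ^ 3 / 3 : ℂ) = ((-(r ^ 3) / 3 : ℝ) : ℂ) * x ^ 3 := by push_cast; ring
    rw [e, norm_mul, norm_mul, norm_pow, norm_mul, Complex.norm_exp, Complex.re_ofReal_mul,
      Complex.norm_real, Real.norm_of_nonneg hr.le, Real.rpow_natCast,
      show r ^ (3 : ℝ) = r ^ 3 by exact_mod_cast Real.rpow_natCast r 3]
    calc _ = ‖x‖ ^ (k + 1) * (r ^ k * Real.exp (-r ^ 3 / 3 * (x ^ 3).re)) := by ring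
      _ ≤ _ := by
        gcongr ?_ * (_ * Real.exp ?_)
        · gcongr
        · have : 0 < r ^ 3 := by positivity
          nlinarith
  · exact (integrableOn_rpow_mul_exp_neg_mul_rpow (by linarith [k.cast_nonneg (α := ℝ)])
      (by norm_num) (by positivity)).const_mul _

theorem cubicMoment_ofReal_mul (k : ℕ) {c : ℝ} (hc : 0 < c) (u : ℂ) :
    cubicMoment k (c * u) = cubicMoment k u := by
  have h := integral_comp_mul_left_Ioi
    (fun r : ℝ => (r * u) ^ k * Complex.exp (-(r * u) ^ 3 / 3) * u) 0 hc
  rw [mul_zero] at h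
  rw [eq_inv_smul_iff₀ hc.ne'] at h
  rw [cubicMoment, cubicMoment, ← h, ← integral_smul]
  congr 1 with r
  rw [Complex.real_smul, Complex.ofReal_mul]
  ring_nf

theorem cubicMoment_eq_of_mem_cubicSector (k : ℕ) {u : ℂ} (hu : u ∈ cubicSector) :
    cubicMoment k u = cubicMoment k 1 := by
  refine isOpen_cubicSector.is_const_of_deriv_eq_zero convex_cubicSector.isPreconnected
    (fun x hx => (differentiableAt_cubicMoment k
      (pow_three_re_pos_of_mem_cubicSector hx)).differentiableWithinAt) (fun x hx => ?_) hu
    (by simp [cubicSector])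
  have hx0 : x ≠ 0 := by
    rintro rfl
    simp [cubicSector] at hx
  have h1 := (differentiableAt_cubicMoment k (pow_three_re_pos_of_mem_cubicSector hx)).hasDerivAt
  have h2 : HasDerivAt (fun c : ℝ => (c : ℂ) * x) x 1 := by
    simpa using (Complex.ofRealCLM.hasDerivAt (x := (1 : ℝ))).mul_const x
  have h3 : HasDerivAt (fun c : ℝ => cubicMoment k (c * x)) (deriv (cubicMoment k) x * x) 1 :=
    HasDerivAt.comp_of_eq (1 : ℝ) h1 h2 (by simp)
  have h4 : HasDerivAt (fun c : ℝ => cubicMoment k (c * x)) 0 1 :=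
    (hasDerivAt_const (1 : ℝ) (cubicMoment k x)).congr_of_eventuallyEq (by
      filter_upwards [lt_mem_nhds (zero_lt_one' ℝ)] with c hc using cubicMoment_ofReal_mul k hc x)
  exact (mul_eq_zero.1 (h3.unique h4)).resolve_right hx0

theorem cubicMoment_one (k : ℕ) : cubicMoment k 1 =
    (((3 : ℝ) ^ ((k + 1) / 3 : ℝ) * (1 / 3) * Real.Gamma ((k + 1) / 3) : ℝ) : ℂ) := by
  have h := integral_rpow_mul_exp_neg_mul_rpow (p := 3) (q := k) (b := 1 / 3) (by norm_num)
    (by linarith [k.cast_nonneg (α := ℝ)]) (by norm_num)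
  rw [one_div, Real.inv_rpow (by norm_num), ← Real.rpow_neg (by norm_num), ← neg_div, neg_neg,
    ← one_div] at h
  rw [← h, cubicMoment, ← integral_complex_ofReal]
  congr 1 with r
  rw [Real.rpow_natCast, show r ^ (3 : ℝ) = r ^ 3 by exact_mod_cast Real.rpow_natCast r 3]
  push_cast
  ring_nf

theorem airyRay_mul_eq (k : ℕ) {a u : ℂ} (ha : a ^ 3 = -1) (hu : u ∈ cubicSector) :
    airyRay k (a * u) 0 0 = a ^ (k + 1) * cubicMoment k 1 := by
  rw [← cubicMoment_eq_of_mem_cubicSector k hu, cubicMoment, airyRay, ← integral_const_mul]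
  congr 1 with r
  rw [show (0 + r * (a * u)) ^ 3 / 3 - 0 * (0 + r * (a * u)) = a ^ 3 * (r * u) ^ 3 / 3 by ring, ha]
  ring_nf

/-- The direction `exp (5πi/12)`; rays in this direction and its conjugate are simultaneously
admissible for the integral from the origin and for the one from the saddle point. -/
noncomputable def airyDir : ℂ := Complex.exp (5 * Real.pi / 12 * Complex.I)

theorem norm_airyDir : ‖airyDir‖ = 1 := by
  rw [airyDir, show (5 * Real.pi / 12 : ℂ) = ((5 * Real.pi / 12 : ℝ) : ℂ) by push_cast; ring,
    Complex.norm_exp_ofReal_mul_I]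

theorem airyDir_pow_two : airyDir ^ 2 = ⟨-(√3 / 2), 1 / 2⟩ := by
  rw [airyDir, ← Complex.exp_nat_mul, show ((2 : ℕ) * (5 * Real.pi / 12 * Complex.I) : ℂ) =
    ((Real.pi - Real.pi / 6 : ℝ) : ℂ) * Complex.I by push_cast; ring]
  apply Complex.ext
  · rw [Complex.exp_ofReal_mul_I_re, Real.cos_pi_sub, Real.cos_pi_div_six]
  · rw [Complex.exp_ofReal_mul_I_im, Real.sin_pi_sub, Real.sin_pi_div_six]

theorem airyDir_pow_three_re : (airyDir ^ 3).re < 0 := by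
  rw [airyDir, ← Complex.exp_nat_mul, show ((3 : ℕ) * (5 * Real.pi / 12 * Complex.I) : ℂ) =
    ((Real.pi / 4 + Real.pi : ℝ) : ℂ) * Complex.I by push_cast; ring,
    Complex.exp_ofReal_mul_I_re, Real.cos_add_pi, Real.cos_pi_div_four]
  have : 0 < √2 := by positivity
  linarith

theorem norm_conj_airyDir : ‖star airyDir‖ = 1 := by
  rw [norm_star, norm_airyDir]

theorem conj_airyDir_pow_three_re : (star airyDir ^ 3).re < 0 := by
  rw [← star_pow, Complex.star_def, Complex.conj_re]
  exact airyDir_pow_three_re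

/-- `2πi` times the Airy function (and, up to sign, its derivatives), as a difference of two ray
integrals. -/
noncomputable def airyContour (k : ℕ) (z : ℂ) : ℂ :=
  airyRay k airyDir 0 z - airyRay k (star airyDir) 0 z

theorem airyContour_zero_apply (k : ℕ) : airyContour k 0 =
    (Complex.exp (Real.pi / 3 * Complex.I) ^ (k + 1) -
      star (Complex.exp (Real.pi / 3 * Complex.I)) ^ (k + 1)) * cubicMoment k 1 := by
  set a := Complex.exp (Real.pi / 3 * Complex.I) with ha
  set u := Complex.exp ((Real.pi / 12 : ℝ) * Complex.I) with hu
  have ha3 : a ^ 3 = -1 := by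
    rw [ha, ← Complex.exp_nat_mul, ← Complex.exp_pi_mul_I]
    push_cast; ring_nf
  have hau : airyDir = a * u := by
    rw [ha, hu, ← Complex.exp_add, airyDir]
    push_cast; ring_nf
  have him : 0 < u.im ∧ u.im < u.re / 2 := by
    rw [hu, Complex.exp_ofReal_mul_I_re, Complex.exp_ofReal_mul_I_im]
    have h1 := Real.pi_pos
    have h2 := Real.pi_lt_d2
    have h3 := Real.sin_lt (x := Real.pi / 12) (by positivity)
    have h4 := Real.one_sub_sq_div_two_le_cos (x := Real.pi / 12)
    exact ⟨Real.sin_pos_of_pos_of_lt_pi (by positivity) (by linarith), by nlinarith⟩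
  rw [airyContour, hau, star_mul', airyRay_mul_eq k ha3 ⟨him.2, by linarith⟩,
    airyRay_mul_eq k (by rw [← star_pow, ha3]; simp)]
  · ring
  · simpa [cubicSector] using ⟨by linarith, him.2⟩

theorem exp_pi_div_three_mul_I : Complex.exp (Real.pi / 3 * Complex.I) = ⟨1 / 2, √3 / 2⟩ := by
  rw [show (Real.pi / 3 : ℂ) = ((Real.pi / 3 : ℝ) : ℂ) by push_cast; ring]
  apply Complex.ext
  · rw [Complex.exp_ofReal_mul_I_re, Real.cos_pi_div_three]
  · rw [Complex.exp_ofReal_mul_I_im, Real.sin_pi_div_three]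

theorem Gamma_one_third_mul_Gamma_two_thirds :
    Real.Gamma (1 / 3) * Real.Gamma (2 / 3) = 2 * Real.pi / √3 := by
  have h := Real.Gamma_mul_Gamma_one_sub (1 / 3)
  rw [show (1 - 1 / 3 : ℝ) = 2 / 3 by norm_num, show Real.pi * (1 / 3) = Real.pi / 3 by ring,
    Real.sin_pi_div_three] at h
  rw [h]; field_simp

theorem airyContour_zero_zero : airyContour 0 0 = 2 * Real.pi * Complex.I *
    ((3 : ℂ) ^ (-(2 : ℂ) / 3) / Complex.Gamma (2 / 3)) := by
  have hG := Gamma_one_third_mul_Gamma_two_thirds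
  have hp : 0 < Real.Gamma (2 / 3) := Real.Gamma_pos_of_pos (by norm_num)
  have h3 : (0:ℝ) < √3 := by positivity
  have e1 : (3 : ℂ) ^ (-(2 : ℂ) / 3) = ((3 ^ (1 / 3 : ℝ) / 3 : ℝ) : ℂ) := by
    rw [show (3 ^ (1 / 3 : ℝ) / 3 : ℝ) = (3 : ℝ) ^ (-2 / 3 : ℝ) by
      rw [← Real.rpow_sub_one (by norm_num)]; norm_num, Complex.ofReal_cpow (by norm_num)]
    push_cast; rfl
  have e2 : Complex.Gamma (2 / 3) = (Real.Gamma (2 / 3) : ℂ) := by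
    rw [← Complex.Gamma_ofReal]; push_cast; rfl
  rw [airyContour_zero_apply, cubicMoment_one, exp_pi_div_three_mul_I, e1, e2]
  have key : √3 * (3 ^ (1 / 3 : ℝ) * (1 / 3) * Real.Gamma (1 / 3)) =
      2 * Real.pi * (3 ^ (1 / 3 : ℝ) / 3 / Real.Gamma (2 / 3)) := by
    rw [eq_div_iff h3.ne'] at hG
    rw [← hG]
    field_simp
  have e3 : (⟨1 / 2, √3 / 2⟩ : ℂ) ^ (0 + 1) - star (⟨1 / 2, √3 / 2⟩ : ℂ) ^ (0 + 1) =
      (√3 : ℝ) * Complex.I := by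
    apply Complex.ext <;> simp
  rw [e3]
  have := congrArg (fun x : ℝ => (x : ℂ) * Complex.I) key
  simp only [Complex.ofReal_mul, Complex.ofReal_div] at this
  push_cast at this ⊢
  norm_num at this ⊢
  linear_combination Complex.I * this

theorem airyContour_one_zero : airyContour 1 0 = 2 * Real.pi * Complex.I *
    ((3 : ℂ) ^ (-(1 : ℂ) / 3) / Complex.Gamma (1 / 3)) := by
  have hG := Gamma_one_third_mul_Gamma_two_thirds
  have hp : 0 < Real.Gamma (1 / 3) := Real.Gamma_pos_of_pos (by norm_num)
  have h3 : (0:ℝ) < √3 := by positivity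
  have e1 : (3 : ℂ) ^ (-(1 : ℂ) / 3) = ((3 ^ (2 / 3 : ℝ) / 3 : ℝ) : ℂ) := by
    rw [show (3 ^ (2 / 3 : ℝ) / 3 : ℝ) = (3 : ℝ) ^ (-1 / 3 : ℝ) by
      rw [← Real.rpow_sub_one (by norm_num)]; norm_num, Complex.ofReal_cpow (by norm_num)]
    push_cast; rfl
  have e2 : Complex.Gamma (1 / 3) = (Real.Gamma (1 / 3) : ℂ) := by
    rw [← Complex.Gamma_ofReal]; push_cast; rfl
  rw [airyContour_zero_apply, cubicMoment_one, exp_pi_div_three_mul_I, e1, e2]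
  have key : √3 * (3 ^ (2 / 3 : ℝ) * (1 / 3) * Real.Gamma (2 / 3)) =
      2 * Real.pi * (3 ^ (2 / 3 : ℝ) / 3 / Real.Gamma (1 / 3)) := by
    rw [eq_div_iff h3.ne'] at hG
    rw [← hG]
    field_simp
  have e3 : (⟨1 / 2, √3 / 2⟩ : ℂ) ^ (1 + 1) - star (⟨1 / 2, √3 / 2⟩ : ℂ) ^ (1 + 1) =
      (√3 : ℝ) * Complex.I := by
    apply Complex.ext <;> simp [pow_two]
    ring
  rw [e3]
  have := congrArg (fun x : ℝ => (x : ℂ) * Complex.I) key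
  simp only [Complex.ofReal_mul, Complex.ofReal_div] at this
  push_cast at this ⊢
  norm_num at this ⊢
  linear_combination Complex.I * this

theorem eq_of_airy_ode {h h' k k' : ℂ → ℂ} (hh : ∀ z, HasDerivAt h (h' z) z)
    (hh' : ∀ z, HasDerivAt h' (z * h z) z) (hk : ∀ z, HasDerivAt k (k' z) z)
    (hk' : ∀ z, HasDerivAt k' (z * k z) z) (h0 : h 0 = k 0) (h0' : h' 0 = k' 0) : h = k := by
  funext z
  have hpath (t : ℝ) : HasDerivAt (fun t : ℝ => (t : ℂ) * z) z t := by
    simpa using (Complex.ofRealCLM.hasDerivAt (x := t)).mul_const z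
  have hd {φ φ' : ℂ → ℂ} (hφ : ∀ z, HasDerivAt φ (φ' z) z)
      (hφ' : ∀ z, HasDerivAt φ' (z * φ z) z) (t : ℝ) :
      HasDerivAt (fun t : ℝ => (φ (t * z), φ' (t * z)))
        (φ' (t * z) * z, t * z * φ (t * z) * z) t :=
    (HasDerivAt.comp t (hφ _) (hpath t)).prodMk (HasDerivAt.comp t (hφ' _) (hpath t))
  have hlip : ∀ t ∈ Ico (0 : ℝ) 1, LipschitzOnWith (‖z‖₊ + ‖z‖₊ * ‖z‖₊)
      (fun x : ℂ × ℂ => (x.2 * z, (t : ℂ) * z * x.1 * z)) univ := fun t ht => by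
    refine LipschitzWith.lipschitzOnWith (LipschitzWith.of_dist_le_mul fun x y => ?_)
    rw [dist_eq_norm, dist_eq_norm]
    have h1 := norm_fst_le (x - y)
    have h2 := norm_snd_le (x - y)
    have hz := norm_nonneg z
    have hxy := norm_nonneg (x - y)
    rw [Prod.norm_def]
    push_cast
    refine max_le ?_ ?_
    · rw [Prod.fst_sub, ← sub_mul, norm_mul, ← Prod.snd_sub]
      nlinarith [mul_le_mul_of_nonneg_right h2 hz, mul_nonneg (mul_nonneg hz hz) hxy]
    · have e : ((t : ℂ) * z * x.1 * z, (t : ℂ) * z * x.1 * z).2 -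
          ((t : ℂ) * z * y.1 * z, (t : ℂ) * z * y.1 * z).2 = t * z * z * (x - y).1 := by
        simp only [Prod.fst_sub]; ring
      rw [Prod.snd_sub]
      refine (congrArg norm e).trans_le ?_
      rw [norm_mul, norm_mul, norm_mul, Complex.norm_real, Real.norm_of_nonneg ht.1]
      have : t * ‖z‖ * ‖z‖ * ‖(x - y).1‖ ≤ 1 * ‖z‖ * ‖z‖ * ‖x - y‖ := by
        gcongr
        exact ht.2.le
      nlinarith [mul_nonneg hz hxy]
  have key := ODE_solution_unique_of_mem_Icc_right hlip
    (fun t _ => (hd hh hh' t).continuousAt.continuousWithinAt)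
    (fun t _ => (hd hh hh' t).hasDerivWithinAt) (fun _ _ => mem_univ _)
    (fun t _ => (hd hk hk' t).continuousAt.continuousWithinAt)
    (fun t _ => (hd hk hk' t).hasDerivWithinAt) (fun _ _ => mem_univ _)
    (by simp [h0, h0'])
  simpa using congrArg Prod.fst (key (right_mem_Icc.2 zero_le_one))

theorem hasDerivAt_airyContour (k : ℕ) (z : ℂ) :
    HasDerivAt (airyContour k) (-airyContour (k + 1) z) z :=
  ((hasDerivAt_airyRay norm_airyDir airyDir_pow_three_re k 0 z).sub
    (hasDerivAt_airyRay norm_conj_airyDir conj_airyDir_pow_three_re k 0 z)).congr_deriv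
    (by rw [airyContour]; ring)

theorem airyContour_two (z : ℂ) : airyContour 2 z = z * airyContour 0 z := by
  have h1 := integral_deriv_airy_phase norm_airyDir airyDir_pow_three_re 0 z
  have h2 := integral_deriv_airy_phase norm_conj_airyDir conj_airyDir_pow_three_re 0 z
  rw [airyContour, airyContour]
  linear_combination h1 - h2

theorem airy_eq_contour {Ai : ℂ → ℂ} (hAi_d1 : Differentiable ℂ Ai)
    (hAi_d2 : Differentiable ℂ (deriv Ai)) (hAi_ode : ∀ z : ℂ, deriv (deriv Ai) z = z * Ai z)
    (hAi_0 : Ai 0 = (3 : ℂ) ^ (-(2 : ℂ) / 3) / Complex.Gamma (2 / 3))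
    (hAi_0' : deriv Ai 0 = -(3 : ℂ) ^ (-(1 : ℂ) / 3) / Complex.Gamma (1 / 3)) (z : ℂ) :
    2 * Real.pi * Complex.I * Ai z = airyContour 0 z := by
  refine congrFun (eq_of_airy_ode (h := fun z => 2 * Real.pi * Complex.I * Ai z)
    (h' := fun z => 2 * Real.pi * Complex.I * deriv Ai z) (k' := fun z => -airyContour 1 z)
    (fun z => (hAi_d1 z).hasDerivAt.const_mul _) (fun z => ?_) (hasDerivAt_airyContour 0)
    (fun z => ?_) ?_ ?_) z
  · exact ((hAi_d2 z).hasDerivAt.const_mul _).congr_deriv (by rw [hAi_ode]; ring)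
  · exact (hasDerivAt_airyContour 1 z).neg.congr_deriv (by rw [neg_neg, airyContour_two])
  · rw [hAi_0, airyContour_zero_zero]
  · rw [hAi_0', airyContour_one_zero]; ring

theorem norm_exp_sub_one_le_of_re_nonpos {q : ℂ} (hq : q.re ≤ 0) : ‖Complex.exp q - 1‖ ≤ ‖q‖ := by
  have := (convex_halfSpace_re_le 0).norm_image_sub_le_of_norm_deriv_le (𝕜 := ℂ) (C := 1)
    (f := Complex.exp) (x := 0) (y := q) (fun x _ => Complex.differentiableAt_exp)
    (fun x hx => by
      rw [Complex.deriv_exp, Complex.norm_exp]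
      exact Real.exp_le_one_iff.2 hx) (by simp) hq
  simpa using this

/-- The saddle point approximation of the ray integral based at the saddle point `w = √z`. -/
theorem norm_airyRay_saddle_sub_le {v w : ℂ} (hv : ‖v‖ = 1) (hv3 : (v ^ 3).re < 0)
    (hw : 0 < w.re) (hwv : (w * v ^ 2).re ≤ -(w.re / 4)) :
    ‖airyRay 0 v w (w ^ 2) - Complex.exp (-2 / 3 * w ^ 3) *
      (v * ((Real.pi / -(w * v ^ 2)) ^ (1 / 2 : ℂ) / 2))‖ ≤
      ‖Complex.exp (-2 / 3 * w ^ 3)‖ * (8 / 3 / w.re ^ 2) := by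
  have hre : 0 < (-(w * v ^ 2)).re := by rw [Complex.neg_re]; linarith
  have hG := integral_gaussian_complex_Ioi hre
  have hrw : (fun r : ℝ => (w + r * v) ^ 0 *
      Complex.exp ((w + r * v) ^ 3 / 3 - w ^ 2 * (w + r * v)) * v) = fun r : ℝ =>
      Complex.exp (-2 / 3 * w ^ 3) * v *
        (Complex.exp (-(-(w * v ^ 2)) * r ^ 2) * Complex.exp ((r ^ 3 / 3 : ℝ) * v ^ 3)) := by
    funext r
    rw [← Complex.exp_add, pow_zero, one_mul, mul_right_comm _ v, ← Complex.exp_add]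
    congr 2
    push_cast; ring
  have hint1 : IntegrableOn (fun r : ℝ => Complex.exp (-2 / 3 * w ^ 3) * v *
        (Complex.exp (-(-(w * v ^ 2)) * r ^ 2) * Complex.exp ((r ^ 3 / 3 : ℝ) * v ^ 3)))
        (Ioi 0) := hrw ▸ integrableOn_airyRay_integrand hv hv3 0 w (w ^ 2)
  have hint2 : IntegrableOn (fun r : ℝ => Complex.exp (-2 / 3 * w ^ 3) * v *
        Complex.exp (-(-(w * v ^ 2)) * r ^ 2)) (Ioi 0) :=
    ((integrable_cexp_neg_mul_sq hre).const_mul _).integrableOn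
  have hGam := integral_rpow_mul_exp_neg_mul_rpow (p := 2) (q := 3) (b := w.re / 4) (by norm_num)
    (by norm_num) (by positivity)
  have hval : (w.re / 4) ^ (-(3 + 1) / 2 : ℝ) * (1 / 2) * Real.Gamma ((3 + 1) / 2) =
      8 / w.re ^ 2 := by
    rw [show ((3 + 1) / 2 : ℝ) = 2 by norm_num, Real.Gamma_two,
      show (-(3 + 1) / 2 : ℝ) = -(2 : ℕ) by norm_num, Real.rpow_neg (by positivity),
      Real.rpow_natCast]
    field_simp
    norm_num
  rw [airyRay, hrw, ← hG, ← mul_assoc, ← integral_const_mul, ← integral_sub hint1 hint2]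
  calc _ ≤ ∫ r in Ioi (0 : ℝ), ‖Complex.exp (-2 / 3 * w ^ 3)‖ / 3 *
          (r ^ (3 : ℝ) * Real.exp (-(w.re / 4) * r ^ (2 : ℝ))) := by
        refine norm_integral_le_of_norm_le ?_ ?_
        · exact (integrableOn_rpow_mul_exp_neg_mul_rpow (by norm_num) (by norm_num)
            (by positivity)).const_mul _
        refine (ae_restrict_iff' measurableSet_Ioi).2 (.of_forall fun r hr => ?_)
        have hr : 0 < r := hr
        have e1 := norm_exp_sub_one_le_of_re_nonpos (q := (r ^ 3 / 3 : ℝ) * v ^ 3) (by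
          rw [Complex.re_ofReal_mul]
          exact mul_nonpos_of_nonneg_of_nonpos (by positivity) hv3.le)
        rw [norm_mul, Complex.norm_real, norm_pow, hv, one_pow, mul_one,
          Real.norm_of_nonneg (by positivity)] at e1
        have e2 : ‖Complex.exp (-(-(w * v ^ 2)) * r ^ 2)‖ ≤ Real.exp (-(w.re / 4) * r ^ 2) := by
          rw [Complex.norm_exp, neg_neg, ← Complex.ofReal_pow, Complex.re_mul_ofReal]
          gcongr
        rw [← mul_sub, ← mul_sub_one, norm_mul, norm_mul, norm_mul, hv, mul_one,
          show r ^ (3 : ℝ) = r ^ 3 by exact_mod_cast Real.rpow_natCast r 3,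
          show r ^ (2 : ℝ) = r ^ 2 by exact_mod_cast Real.rpow_natCast r 2]
        calc _ ≤ ‖Complex.exp (-2 / 3 * w ^ 3)‖ *
              (Real.exp (-(w.re / 4) * r ^ 2) * (r ^ 3 / 3)) := by gcongr
          _ = _ := by ring
    _ = _ := by
        rw [integral_const_mul, hGam, hval]
        ring

/-- The two leading terms of the saddle point approximation reinforce each other. -/
theorem norm_saddle_term_sub_ge {v w : ℂ} (hv : ‖v‖ = 1) (hv2 : (v ^ 2).re < 0)
    (hw : 1 ≤ w.re) (hw' : ‖w‖ ≤ 2 * w.re) : 1 / w.re ≤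
      ‖v * ((Real.pi / -(w * v ^ 2)) ^ (1 / 2 : ℂ) / 2) -
        star v * ((Real.pi / -(w * star v ^ 2)) ^ (1 / 2 : ℂ) / 2)‖ := by
  have hw0 : w ≠ 0 := by rintro rfl; simp at hw; linarith
  have hv0 : v ≠ 0 := by rintro rfl; simp at hv
  have hsq {v : ℂ} (hv0 : v ≠ 0) :
      (v * ((Real.pi / -(w * v ^ 2)) ^ (1 / 2 : ℂ) / 2)) ^ 2 = -(Real.pi / (4 * w)) := by
    rw [mul_pow, div_pow, one_div, Complex.cpow_ofNat_inv_pow]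
    field_simp
    ring
  have hre (x : ℂ) : 0 ≤ (x ^ (1 / 2 : ℂ)).re := by
    rw [one_div, Complex.cpow_inv_two_re]; positivity
  set X := v * ((Real.pi / -(w * v ^ 2)) ^ (1 / 2 : ℂ) / 2) with hX
  set Y := star v * ((Real.pi / -(w * star v ^ 2)) ^ (1 / 2 : ℂ) / 2) with hY
  have hX2 : X ^ 2 = -(Real.pi / (4 * w)) := hsq hv0
  have hY2 : Y ^ 2 = -(Real.pi / (4 * w)) := hsq (star_ne_zero.2 hv0)
  have hvv : v * star v = 1 := by
    rw [Complex.star_def, Complex.mul_conj, Complex.normSq_eq_norm_sq, hv]; simp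
  have hXv : 0 ≤ (X * star v).re := by
    rw [hX, mul_right_comm, hvv, one_mul, Complex.div_ofNat_re]
    exact div_nonneg (hre _) (by norm_num)
  have hYv : 0 ≤ (Y * v).re := by
    rw [hY, mul_right_comm, mul_comm (star v), hvv, one_mul, Complex.div_ofNat_re]
    exact div_nonneg (hre _) (by norm_num)
  have hre2 : (X ^ 2).re < 0 := by
    rw [hX2, Complex.neg_re, neg_lt_zero, show (Real.pi / (4 * w) : ℂ) =
      ((Real.pi / 4 : ℝ) : ℂ) * w⁻¹ by push_cast; field_simp, Complex.re_ofReal_mul, Complex.inv_re]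
    have := Complex.normSq_pos.2 hw0
    have := Real.pi_pos
    positivity
  have hne : X ≠ Y := by
    intro h
    rw [← h] at hYv
    simp only [pow_two, Complex.mul_re, Complex.star_def, Complex.conj_re, Complex.conj_im]
      at hXv hYv hre2 hv2
    have h1 : (X.im * v.im) ^ 2 ≤ (X.re * v.re) ^ 2 := sq_le_sq.2
      ((abs_le.2 ⟨by linarith, by linarith⟩).trans (le_abs_self _))
    have h2 : 0 < v.im * v.im := by nlinarith [mul_self_nonneg v.re]
    nlinarith [mul_pos (sub_pos.2 hre2) h2, mul_nonneg (mul_self_nonneg X.re) (sub_nonneg.2 hv2.le)]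
  have hXY : X = -Y := by
    have : (X - Y) * (X + Y) = 0 := by linear_combination hX2 - hY2
    exact eq_neg_of_add_eq_zero_left ((mul_eq_zero.1 this).resolve_left (sub_ne_zero.2 hne))
  have hnorm : ‖X‖ ^ 2 = Real.pi / (4 * ‖w‖) := by
    rw [← norm_pow, hX2, norm_neg, norm_div, norm_mul, Complex.norm_real,
      Real.norm_of_nonneg Real.pi_pos.le, Complex.norm_ofNat]
  rw [show X - Y = 2 * X by rw [hXY]; ring, norm_mul, Complex.norm_ofNat]
  refine le_of_sq_le_sq ?_ (by positivity)
  rw [mul_pow, hnorm, div_pow, one_pow]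
  have hwn : 0 < ‖w‖ := norm_pos_iff.2 hw0
  have := Real.pi_gt_three
  rw [show 2 ^ 2 * (Real.pi / (4 * ‖w‖)) = Real.pi / ‖w‖ by ring, div_le_div_iff₀ (by positivity) hwn]
  nlinarith

theorem le_norm_airyContour_sq {w : ℂ} (hw : 11 ≤ w.re) (hw' : |w.im| ≤ 6 / 5 * w.re) :
    Real.exp (-2 / 3 * (w ^ 3).re) / (2 * w.re) ≤ ‖airyContour 0 (w ^ 2)‖ := by
  obtain ⟨him1, him2⟩ := abs_le.1 hw'
  have h3 : (1.73 : ℝ) < √3 := Real.lt_sqrt_of_sq_lt (by norm_num)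
  have hstar : star airyDir ^ 2 = ⟨-(√3 / 2), -(1 / 2)⟩ := by
    rw [← star_pow, airyDir_pow_two]; rfl
  have hA := norm_airyRay_saddle_sub_le norm_airyDir airyDir_pow_three_re (w := w) (by linarith)
    (by rw [airyDir_pow_two, Complex.mul_re]; nlinarith)
  have hB := norm_airyRay_saddle_sub_le norm_conj_airyDir conj_airyDir_pow_three_re (w := w)
    (by linarith) (by rw [hstar, Complex.mul_re]; nlinarith)
  have hM := norm_saddle_term_sub_ge norm_airyDir (w := w)
    (by rw [airyDir_pow_two]; exact neg_lt_zero.2 (by positivity)) (by linarith) (by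
      refine abs_le_of_sq_le_sq' ?_ (by linarith) |>.2
      rw [Complex.sq_norm, Complex.normSq_apply]
      nlinarith)
  rw [airyContour, airyRay_sub_airyRay_eq norm_airyDir airyDir_pow_three_re norm_conj_airyDir
    conj_airyDir_pow_three_re 0 w]
  have hE : ‖Complex.exp (-2 / 3 * w ^ 3)‖ = Real.exp (-2 / 3 * (w ^ 3).re) := by
    rw [Complex.norm_exp, show (-2 / 3 * w ^ 3 : ℂ) = ((-2 / 3 : ℝ) : ℂ) * w ^ 3 by push_cast; ring,
      Complex.re_ofReal_mul]
  rw [hE] at hA hB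
  set E := Complex.exp (-2 / 3 * w ^ 3)
  set e := Real.exp (-2 / 3 * (w ^ 3).re)
  set X := airyDir * ((Real.pi / -(w * airyDir ^ 2)) ^ (1 / 2 : ℂ) / 2)
  set Y := star airyDir * ((Real.pi / -(w * star airyDir ^ 2)) ^ (1 / 2 : ℂ) / 2)
  set P := airyRay 0 airyDir w (w ^ 2)
  set Q := airyRay 0 (star airyDir) w (w ^ 2)
  have hEM : e * (1 / w.re) ≤ ‖E * X - E * Y‖ := by
    rw [← mul_sub, norm_mul, hE]
    gcongr
  have htri : ‖E * X - E * Y‖ ≤ ‖P - Q‖ + ‖P - E * X‖ + ‖Q - E * Y‖ := by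
    rw [show E * X - E * Y = (P - Q) - (P - E * X) + (Q - E * Y) by ring]
    exact (norm_add_le _ _).trans (add_le_add_left (norm_sub_le _ _) _)
  have herr : 2 * (8 / 3 / w.re ^ 2) ≤ 1 / (2 * w.re) := by
    rw [← mul_div_assoc, div_le_div_iff₀ (by positivity) (by positivity)]
    nlinarith
  have herr' : e * (2 * (8 / 3 / w.re ^ 2)) ≤ e * (1 / (2 * w.re)) := by gcongr
  have hhalf : e * (1 / w.re) = 2 * (e / (2 * w.re)) := by field_simp
  have hhalf' : e * (1 / (2 * w.re)) = e / (2 * w.re) := by ring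
  linarith

theorem norm_airyContour_ge {X : ℝ} {z : ℂ} (hX : |z.re| ≤ X) (hz : 244 + 7 * X ≤ |z.im|) :
    1 + z.im ^ 2 ≤ 1680 * ‖airyContour 0 z‖ := by
  obtain ⟨hx1, hx2⟩ := abs_le.1 hX
  have hX0 : 0 ≤ X := (abs_nonneg _).trans hX
  obtain ⟨w, hwz, hw0⟩ : ∃ w : ℂ, w ^ 2 = z ∧ 0 ≤ w.re := by
    obtain ⟨w, hw⟩ := IsAlgClosed.exists_pow_nat_eq z (n := 2) (by norm_num)
    rcases le_total 0 w.re with h | h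
    · exact ⟨w, hw, h⟩
    · exact ⟨-w, by rw [neg_sq, hw], by simpa using h⟩
  have hre : w.re ^ 2 - w.im ^ 2 = z.re := by rw [← hwz, sq w, Complex.mul_re]; ring
  have him : 2 * w.re * w.im = z.im := by rw [← hwz, pow_two, Complex.mul_im]; ring
  have hnorm : w.re ^ 2 + w.im ^ 2 = ‖z‖ := by
    rw [← hwz, norm_pow, Complex.sq_norm, Complex.normSq_apply]; ring
  have hzim := Complex.abs_im_le_norm z
  have ha2 : 122 + 3 * X ≤ w.re ^ 2 := by linarith
  have hb2 : w.im ^ 2 ≤ 36 / 25 * w.re ^ 2 := by linarith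
  have ha : 11 ≤ w.re := by nlinarith
  have hb : |w.im| ≤ 6 / 5 * w.re := abs_le_of_sq_le_sq (by linarith) (by linarith)
  have key := le_norm_airyContour_sq ha hb
  rw [hwz] at key
  have hcube : w.re ≤ -2 / 3 * (w ^ 3).re := by
    have : (w ^ 3).re = w.re * (w.re ^ 2 - 3 * w.im ^ 2) := by
      simp [pow_succ, Complex.mul_re, Complex.mul_im]; ring
    rw [this]
    nlinarith
  have h5 : w.re ^ 5 / 120 ≤ Real.exp (-2 / 3 * (w ^ 3).re) := by
    have := Real.pow_div_factorial_le_exp w.re hw0 5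
    norm_num [Nat.factorial] at this
    exact this.trans (Real.exp_le_exp.2 (by linarith))
  have h4 : w.re ^ 4 / 240 ≤ ‖airyContour 0 z‖ := by
    refine le_trans ?_ key
    rw [le_div_iff₀ (by positivity)]
    nlinarith
  have hy : z.im ^ 2 ≤ 144 / 25 * w.re ^ 4 := by
    rw [← him]
    nlinarith [mul_le_mul_of_nonneg_left hb2 (sq_nonneg w.re)]
  have : 1 ≤ w.re ^ 4 := one_le_pow₀ (by linarith)
  linarith

/-- On closed vertical strips free of zeros, the reciprocal of a multiple of the Airy function
decays quadratically. -/
theorem exists_norm_inv_airy_le {Ai : ℂ → ℂ} (hcont : Continuous Ai)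
    (hAi : ∀ z, 2 * Real.pi * Complex.I * Ai z = airyContour 0 z) {a₁ : ℝ}
    (ha₁ : ∀ z : ℂ, Ai z = 0 → z.re ≤ a₁) {s₁ s₂ : ℝ} (hs : a₁ < s₁) :
    ∃ C : ℝ, ∀ z : ℂ, s₁ ≤ z.re → z.re ≤ s₂ → ‖(Ai z)⁻¹‖ ≤ C * (1 + z.im ^ 2)⁻¹ := by
  set Y := 244 + 7 * max |s₁| |s₂|
  have hne : ∀ z : ℂ, s₁ ≤ z.re → Ai z ≠ 0 := fun z hz h => by linarith [ha₁ z h]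
  obtain ⟨C, hC⟩ := (isCompact_Icc.reProdIm isCompact_Icc : IsCompact
    (Icc s₁ s₂ ×ℂ Icc (-Y) Y)).exists_bound_of_continuousOn
    (f := fun z => (1 + (z.im : ℂ) ^ 2) * (Ai z)⁻¹) (by
      refine ContinuousOn.mul (by fun_prop) (hcont.continuousOn.inv₀ fun z hz => hne z hz.1.1))
  refine ⟨max C 13440, fun z h1 h2 => ?_⟩
  have hpos : 0 < 1 + z.im ^ 2 := by positivity
  rw [← div_eq_mul_inv, le_div_iff₀ hpos]
  have hn : ‖(1 + (z.im : ℂ) ^ 2)‖ = 1 + z.im ^ 2 := by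
    rw [← Complex.ofReal_pow, ← Complex.ofReal_one, ← Complex.ofReal_add, Complex.norm_real,
      Real.norm_of_nonneg hpos.le]
  rcases le_total |z.im| Y with h | h
  · have := hC z ⟨⟨h1, h2⟩, abs_le.1 h⟩
    rw [norm_mul, hn] at this
    exact le_max_of_le_left (by linarith)
  · refine le_max_of_le_right ?_
    have hb := norm_airyContour_ge (abs_le_max_abs_abs h1 h2) h
    have hpi : ‖(2 * Real.pi * Complex.I : ℂ)‖ ≤ 8 := by
      simp only [norm_mul, Complex.norm_ofNat, Complex.norm_real, Complex.norm_I,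
        Real.norm_of_nonneg Real.pi_pos.le]
      linarith [Real.pi_lt_four]
    have hAz : 0 < ‖Ai z‖ := norm_pos_iff.2 (hne z h1)
    rw [← hAi, norm_mul] at hb
    rw [norm_inv, inv_mul_le_iff₀ hAz]
    nlinarith

/-- `φ` is holomorphic on the half-plane `re z > a` and decays quadratically along vertical lines,
locally uniformly in the real part. -/
structure HasVerticalDecay (φ : ℂ → ℂ) (a : ℝ) : Prop where
  differentiableAt : ∀ z : ℂ, a < z.re → DifferentiableAt ℂ φ z
  norm_le : ∀ s₁ s₂ : ℝ, a < s₁ →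
    ∃ C : ℝ, ∀ z : ℂ, s₁ ≤ z.re → z.re ≤ s₂ → ‖φ z‖ ≤ C * (1 + z.im ^ 2)⁻¹

/-- `∫ exp (-zx) φ(z) dz / i` along the vertical line through `p`. -/
noncomputable def verticalIntegral (φ : ℂ → ℂ) (x : ℝ) (p : ℂ) : ℂ :=
  ∫ y : ℝ, Complex.exp (-(p + Complex.I * y) * x) * φ (p + Complex.I * y)

theorem inv_one_add_add_sq_le {h H : ℝ} (hh : |h| ≤ H) (y : ℝ) :
    (1 + (h + y) ^ 2)⁻¹ ≤ 2 * (1 + H ^ 2) * (1 + y ^ 2)⁻¹ := by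
  have h1 : h ^ 2 ≤ H ^ 2 := sq_le_sq' (by linarith [neg_abs_le h]) (by linarith [le_abs_self h])
  rw [inv_eq_one_div, ← div_eq_mul_inv, div_le_div_iff₀ (by positivity) (by positivity)]
  nlinarith [sq_nonneg (2 * h + y), mul_nonneg (sq_nonneg H) (sq_nonneg (h + y))]

theorem integrable_exp_neg_mul_abs {δ : ℝ} (hδ : 0 < δ) :
    Integrable fun x : ℝ => Real.exp (-δ * |x|) := by
  rw [← integrableOn_univ, ← Iic_union_Ioi (a := (0 : ℝ))]
  refine IntegrableOn.union ?_ ?_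
  · refine (integrableOn_exp_mul_Iic hδ 0).congr_fun (fun x hx => ?_) measurableSet_Iic
    simp [abs_of_nonpos (mem_Iic.1 hx)]
  · refine (integrableOn_exp_mul_Ioi (neg_neg_of_pos hδ) 0).congr_fun (fun x hx => ?_)
      measurableSet_Ioi
    simp [abs_of_pos (mem_Ioi.1 hx)]

namespace HasVerticalDecay

variable {φ : ℂ → ℂ} {a : ℝ}

theorem continuous_vertical (h : HasVerticalDecay φ a) {p : ℂ} (hp : a < p.re) :
    Continuous fun y : ℝ => φ (p + Complex.I * y) := by
  refine continuous_iff_continuousAt.2 fun y => ?_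
  refine ContinuousAt.comp (f := fun y : ℝ => p + Complex.I * y)
    (h.differentiableAt _ (by simpa using hp)).continuousAt ?_
  fun_prop

theorem exists_norm_le_near (h : HasVerticalDecay φ a) {p : ℂ} {ε : ℝ} (hp : a + ε < p.re) :
    ∃ C : ℝ, ∀ z ∈ Metric.ball p ε, ∀ y : ℝ, ‖φ (z + Complex.I * y)‖ ≤ C * (1 + y ^ 2)⁻¹ := by
  obtain ⟨C, hC⟩ := h.norm_le (p.re - ε) (p.re + ε) (by linarith)
  refine ⟨|C| * (2 * (1 + (|p.im| + ε) ^ 2)), fun z hz y => ?_⟩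
  rw [mem_ball_iff_norm] at hz
  have h1 := abs_le.1 ((Complex.abs_re_le_norm (z - p)).trans hz.le)
  have h2 := (Complex.abs_im_le_norm (z - p)).trans hz.le
  rw [Complex.sub_re] at h1
  rw [Complex.sub_im] at h2
  have h3 : |z.im| ≤ |p.im| + ε := by
    have := abs_add_le p.im (z.im - p.im)
    rw [add_sub_cancel] at this
    linarith
  have h4 := hC (z + Complex.I * y) (by simp; linarith) (by simp; linarith)
  have h5 : (z + Complex.I * y).im = z.im + y := by simp
  rw [h5] at h4
  calc _ ≤ _ := h4
    _ ≤ |C| * (1 + (z.im + y) ^ 2)⁻¹ := by gcongr; exact le_abs_self C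
    _ ≤ |C| * (2 * (1 + (|p.im| + ε) ^ 2) * (1 + y ^ 2)⁻¹) := by
      gcongr; exact inv_one_add_add_sq_le h3 y
    _ = _ := by ring

theorem integrable_vertical (h : HasVerticalDecay φ a) {p : ℂ} (hp : a < p.re) :
    Integrable fun y : ℝ => φ (p + Complex.I * y) := by
  obtain ⟨C, hC⟩ := h.exists_norm_le_near (p := p) (ε := (p.re - a) / 2) (by linarith)
  exact (integrable_inv_one_add_sq.const_mul C).mono'
    (h.continuous_vertical hp).aestronglyMeasurable
    (.of_forall fun y => hC p (Metric.mem_ball_self (by linarith)) y)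

theorem norm_exp_vertical (x y : ℝ) (p : ℂ) :
    ‖Complex.exp (-(p + Complex.I * y) * x)‖ = Real.exp (-p.re * x) := by
  rw [Complex.norm_exp]
  simp

theorem differentiableAt_verticalIntegral (h : HasVerticalDecay φ a) (x : ℝ) {p : ℂ}
    (hp : a < p.re) : DifferentiableAt ℂ (verticalIntegral φ x) p := by
  set ε := (p.re - a) / 2 with hε
  have hε0 : 0 < ε := by linarith
  obtain ⟨C, hC⟩ := h.exists_norm_le_near (p := p) (ε := ε) (by linarith)
  have hre {z : ℂ} (hz : z ∈ Metric.ball p ε) : |z.re - p.re| ≤ ε := by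
    rw [mem_ball_iff_norm] at hz
    exact (Complex.abs_re_le_norm (z - p)).trans hz.le
  have hd (y : ℝ) {z : ℂ} (hz : z ∈ Metric.ball p ε) : DifferentiableAt ℂ
      (fun z => Complex.exp (-(z + Complex.I * y) * x) * φ (z + Complex.I * y)) z := by
    have h1 : DifferentiableAt ℂ φ (z + Complex.I * y) :=
      h.differentiableAt _ (by simp; linarith [(abs_le.1 (hre hz)).1])
    have h2 : DifferentiableAt ℂ (fun z => φ (z + Complex.I * y)) z :=
      DifferentiableAt.comp (f := fun z => z + Complex.I * y) z h1 (by fun_prop)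
    exact DifferentiableAt.mul (by fun_prop) h2
  refine (hasDerivAt_integral_of_differentiableOn_of_norm_le hε0
    (F := fun (z : ℂ) (y : ℝ) => Complex.exp (-(z + Complex.I * y) * x) * φ (z + Complex.I * y))
    (bound := fun y => Real.exp ((|p.re| + ε) * |x|) * (C * (1 + y ^ 2)⁻¹))
    (fun z hz => ?_) (.of_forall fun y z hz => (hd y hz).differentiableWithinAt)
    (.of_forall fun y => (hd y (Metric.mem_ball_self hε0)).hasDerivAt)
    (.of_forall fun y z hz => ?_)
    ((integrable_inv_one_add_sq.const_mul C).const_mul _)).2.differentiableAt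
  · refine (Continuous.mul (by fun_prop) (h.continuous_vertical ?_)).aestronglyMeasurable
    linarith [(abs_le.1 (hre hz)).1]
  · rw [norm_mul, norm_exp_vertical]
    refine mul_le_mul (Real.exp_le_exp.2 ?_) (hC z hz y) (norm_nonneg _) (Real.exp_pos _).le
    calc -z.re * x ≤ |-z.re * x| := le_abs_self _
      _ = |z.re| * |x| := by rw [abs_mul, abs_neg]
      _ ≤ _ := by
        gcongr
        have := abs_add_le p.re (z.re - p.re)
        rw [add_sub_cancel] at this
        linarith [hre hz]

theorem verticalIntegral_add_I_mul (φ : ℂ → ℂ) (x : ℝ) (p : ℂ) (c : ℝ) :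
    verticalIntegral φ x (p + c * Complex.I) = verticalIntegral φ x p := by
  symm
  rw [verticalIntegral, verticalIntegral, ← integral_add_left_eq_self _ c]
  congr 1 with y
  push_cast
  ring_nf

/-- The contour can be shifted: by translation invariance the holomorphic function
`verticalIntegral φ x` has zero derivative. -/
theorem verticalIntegral_eq (h : HasVerticalDecay φ a) (x : ℝ) {p q : ℂ} (hp : a < p.re)
    (hq : a < q.re) : verticalIntegral φ x p = verticalIntegral φ x q := by
  have hopen : IsOpen {z : ℂ | a < z.re} := isOpen_lt continuous_const Complex.continuous_re
  refine hopen.is_const_of_deriv_eq_zero (convex_halfSpace_re_gt a).isPreconnected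
    (fun z hz => (h.differentiableAt_verticalIntegral x hz).differentiableWithinAt)
    (fun z hz => ?_) hp hq
  have h1 := (h.differentiableAt_verticalIntegral x hz).hasDerivAt
  have h2 : HasDerivAt (fun c : ℝ => z + c * Complex.I) Complex.I 0 := by
    simpa using ((Complex.ofRealCLM.hasDerivAt (x := (0 : ℝ))).mul_const Complex.I).const_add z
  have h3 : HasDerivAt (fun c : ℝ => verticalIntegral φ x (z + c * Complex.I))
      (deriv (verticalIntegral φ x) z * Complex.I) 0 :=
    HasDerivAt.comp_of_eq (0 : ℝ) h1 h2 (by simp)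
  simp_rw [verticalIntegral_add_I_mul] at h3
  exact (mul_eq_zero.1 (h3.unique (hasDerivAt_const _ _))).resolve_right Complex.I_ne_zero

theorem norm_verticalIntegral_le (h : HasVerticalDecay φ a) (x : ℝ) {p : ℂ} (hp : a < p.re)
    {σ : ℝ} (hσ : a < σ) : ‖verticalIntegral φ x p‖ ≤
      (∫ y : ℝ, ‖φ (σ + Complex.I * y)‖) * Real.exp (-σ * x) := by
  rw [h.verticalIntegral_eq x hp (q := (σ : ℂ)) (by simpa using hσ), mul_comm,
    ← integral_const_mul]
  refine (norm_integral_le_integral_norm _).trans_eq ?_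
  congr 1 with y
  rw [norm_mul, norm_exp_vertical, Complex.ofReal_re]

theorem continuous_verticalIntegral (h : HasVerticalDecay φ a) {p : ℂ} (hp : a < p.re) :
    Continuous fun x => verticalIntegral φ x p := by
  refine continuous_iff_continuousAt.2 fun x₀ => ?_
  refine continuousAt_of_dominated
    (bound := fun y => Real.exp (|p.re| * (|x₀| + 1)) * ‖φ (p + Complex.I * y)‖)
    (.of_forall fun x =>
      (Continuous.mul (by fun_prop) (h.continuous_vertical hp)).aestronglyMeasurable) ?_
    ((h.integrable_vertical hp).norm.const_mul _)
    (.of_forall fun y => by fun_prop)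
  filter_upwards [Metric.ball_mem_nhds x₀ one_pos] with x hx
  refine .of_forall fun y => ?_
  rw [norm_mul, norm_exp_vertical]
  refine mul_le_mul_of_nonneg_right (Real.exp_le_exp.2 ?_) (norm_nonneg _)
  rw [mem_ball_iff_norm, Real.norm_eq_abs] at hx
  calc -p.re * x ≤ |-p.re * x| := le_abs_self _
    _ = |p.re| * |x| := by rw [abs_mul, abs_neg]
    _ ≤ _ := by
      gcongr
      have := abs_add_le x₀ (x - x₀)
      rw [add_sub_cancel] at this
      linarith

theorem norm_exp_mul_verticalIntegral_le (h : HasVerticalDecay φ a) {p : ℂ} (hp : a < p.re) {σ : ℝ}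
    (hσ : a < σ) : ∃ C δ : ℝ, 0 < δ ∧
      ∀ x : ℝ, Real.exp (σ * x) * ‖verticalIntegral φ x p‖ ≤ C * Real.exp (-δ * |x|) := by
  set δ := (σ - a) / 2 with hδ
  refine ⟨max (∫ y : ℝ, ‖φ ((σ + δ : ℝ) + Complex.I * y)‖)
    (∫ y : ℝ, ‖φ ((σ - δ : ℝ) + Complex.I * y)‖), δ, by linarith, fun x => ?_⟩
  rcases le_total 0 x with hx | hx
  · have := h.norm_verticalIntegral_le x hp (σ := σ + δ) (by linarith)
    rw [abs_of_nonneg hx]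
    calc _ ≤ Real.exp (σ * x) * ((∫ y : ℝ, ‖φ ((σ + δ : ℝ) + Complex.I * y)‖) *
        Real.exp (-(σ + δ) * x)) := by gcongr
      _ = (∫ y : ℝ, ‖φ ((σ + δ : ℝ) + Complex.I * y)‖) * Real.exp (-δ * x) := by
        rw [mul_left_comm, ← Real.exp_add]; ring_nf
      _ ≤ _ := by gcongr; exact le_max_left _ _
  · have := h.norm_verticalIntegral_le x hp (σ := σ - δ) (by linarith)
    rw [abs_of_nonpos hx]
    calc _ ≤ Real.exp (σ * x) * ((∫ y : ℝ, ‖φ ((σ - δ : ℝ) + Complex.I * y)‖) *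
        Real.exp (-(σ - δ) * x)) := by gcongr
      _ = (∫ y : ℝ, ‖φ ((σ - δ : ℝ) + Complex.I * y)‖) * Real.exp (-δ * -x) := by
        rw [mul_left_comm, ← Real.exp_add]; ring_nf
      _ ≤ _ := by gcongr; exact le_max_right _ _

theorem integrable_exp_mul_verticalIntegral (h : HasVerticalDecay φ a) {p z : ℂ} (hp : a < p.re)
    (hz : a < z.re) : Integrable fun x : ℝ => Complex.exp (z * x) * verticalIntegral φ x p := by
  obtain ⟨C, δ, hδ, hC⟩ := h.norm_exp_mul_verticalIntegral_le hp hz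
  refine ((integrable_exp_neg_mul_abs hδ).const_mul C).mono'
    (Continuous.mul (by fun_prop) (h.continuous_verticalIntegral hp)).aestronglyMeasurable
    (.of_forall fun x => ?_)
  rw [norm_mul, Complex.norm_exp]
  simpa using hC x

open scoped FourierTransform in
/-- Fourier inversion: the two-sided Laplace transform of `verticalIntegral φ · p` is `2πφ`. -/
theorem integral_exp_mul_verticalIntegral (h : HasVerticalDecay φ a) {p z : ℂ} (hp : a < p.re)
    (hz : a < z.re) :
    ∫ x : ℝ, Complex.exp (z * x) * verticalIntegral φ x p = 2 * Real.pi * φ z := by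
  set ψ : ℝ → ℂ := fun y => φ (z.re + Complex.I * y) with hψ
  have hz' : a < (z.re : ℂ).re := by simpa using hz
  have hF (x : ℝ) : 𝓕 ψ (x / (2 * Real.pi)) =
      Complex.exp (z.re * x) * verticalIntegral φ x p := by
    rw [h.verticalIntegral_eq x hp hz', verticalIntegral, ← integral_const_mul,
      Real.fourier_real_eq_integral_exp_smul]
    congr 1 with y
    rw [smul_eq_mul, ← mul_assoc, ← Complex.exp_add, hψ]
    congr 2
    push_cast
    field_simp
    ring
  have hint : Integrable (𝓕 ψ) := by
    rw [← integrable_comp_div_iff _ Real.two_pi_pos.ne']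
    simp_rw [hF]
    exact h.integrable_exp_mul_verticalIntegral hp hz'
  have key := congrFun ((h.continuous_vertical hz').fourierInv_fourier_eq
    (h.integrable_vertical hz') hint) z.im
  rw [Real.fourierInv_eq', ← hψ] at key
  have h1 : φ z = ψ z.im := by
    rw [hψ]; congr 1; rw [mul_comm]; exact (Complex.re_add_im z).symm
  rw [h1, show ψ z.im = _ from key.symm, ← Complex.ofReal_ofNat, ← Complex.ofReal_mul, ← Complex.real_smul,
    ← abs_of_pos Real.two_pi_pos, ← Measure.integral_comp_div, abs_of_pos Real.two_pi_pos]
  congr 1 with x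
  rw [hF, smul_eq_mul, ← mul_assoc, ← Complex.exp_add]
  congr 2
  simp
  field_simp
  conv_lhs => rw [← Complex.re_add_im z]
  ring

theorem exists_norm_mul_verticalIntegral_neg_le (h : HasVerticalDecay φ a) (ha : a < 0) {R : ℝ}
    (hR : 0 ≤ R) : ∃ C : ℝ, ∀ x : ℝ,
      ‖verticalIntegral φ x 0 * verticalIntegral φ (-x) 0‖ ≤ C * Real.exp (-R * |x|) := by
  have h0 : a < (0 : ℂ).re := by simpa using ha
  have key {x : ℝ} (hx : 0 ≤ x) : ‖verticalIntegral φ x 0‖ * ‖verticalIntegral φ (-x) 0‖ ≤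
      (∫ y : ℝ, ‖φ (R + Complex.I * y)‖) * (∫ y : ℝ, ‖φ ((0 : ℝ) + Complex.I * y)‖) *
        Real.exp (-R * x) := by
    have h1 := h.norm_verticalIntegral_le x h0 (σ := R) (by linarith)
    have h2 := h.norm_verticalIntegral_le (-x) h0 ha
    rw [neg_zero, zero_mul, Real.exp_zero, mul_one] at h2
    exact (mul_le_mul h1 h2 (norm_nonneg _) ((norm_nonneg _).trans h1)).trans_eq (by ring)
  refine ⟨(∫ y : ℝ, ‖φ (R + Complex.I * y)‖) * (∫ y : ℝ, ‖φ ((0 : ℝ) + Complex.I * y)‖),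
    fun x => ?_⟩
  rw [norm_mul]
  rcases le_total 0 x with hx | hx
  · rw [abs_of_nonneg hx]
    exact key hx
  · rw [abs_of_nonpos hx, mul_comm]
    simpa using key (neg_nonneg.2 hx)

theorem continuous_mul_verticalIntegral_neg (h : HasVerticalDecay φ a) (ha : a < 0) :
    Continuous fun x => verticalIntegral φ x 0 * verticalIntegral φ (-x) 0 := by
  have := h.continuous_verticalIntegral (p := 0) (by simpa using ha)
  exact this.mul (this.comp continuous_neg)

theorem exists_norm_exp_mul_le (h : HasVerticalDecay φ a) (ha : a < 0) (R : ℝ) :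
    ∃ C : ℝ, ∀ t : ℂ, |t.re| ≤ R → ∀ x : ℝ, ‖Complex.exp (t * x) *
      (verticalIntegral φ x 0 * verticalIntegral φ (-x) 0)‖ ≤ C * Real.exp (-1 * |x|) := by
  obtain ⟨C, hC⟩ := h.exists_norm_mul_verticalIntegral_neg_le ha (R := |R| + 1) (by positivity)
  refine ⟨C, fun t ht x => ?_⟩
  have h1 : ‖Complex.exp (t * x)‖ ≤ Real.exp (|R| * |x|) := by
    rw [Complex.norm_exp, Complex.re_mul_ofReal]
    refine Real.exp_le_exp.2 ((le_abs_self _).trans ?_)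
    rw [abs_mul]
    exact mul_le_mul_of_nonneg_right (ht.trans (le_abs_self R)) (abs_nonneg x)
  rw [norm_mul]
  refine (mul_le_mul h1 (hC x) (norm_nonneg _) (Real.exp_pos _).le).trans_eq ?_
  rw [mul_left_comm, ← Real.exp_add]
  ring_nf

theorem integrable_exp_mul (h : HasVerticalDecay φ a) (ha : a < 0) (t : ℂ) :
    Integrable fun x : ℝ => Complex.exp (t * x) *
      (verticalIntegral φ x 0 * verticalIntegral φ (-x) 0) := by
  obtain ⟨C, hC⟩ := h.exists_norm_exp_mul_le ha |t.re|
  exact ((integrable_exp_neg_mul_abs one_pos).const_mul C).mono'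
    (Continuous.mul (by fun_prop) (h.continuous_mul_verticalIntegral_neg ha)).aestronglyMeasurable
    (.of_forall (hC t le_rfl))

theorem differentiable_integral_exp_mul (h : HasVerticalDecay φ a) (ha : a < 0) :
    Differentiable ℂ fun t : ℂ => ∫ x : ℝ, Complex.exp (t * x) *
      (verticalIntegral φ x 0 * verticalIntegral φ (-x) 0) := by
  intro t
  obtain ⟨C, hC⟩ := h.exists_norm_exp_mul_le ha (|t.re| + 1)
  have hd (x : ℝ) : Differentiable ℂ fun t : ℂ => Complex.exp (t * x) *
      (verticalIntegral φ x 0 * verticalIntegral φ (-x) 0) := by fun_prop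
  refine (hasDerivAt_integral_of_differentiableOn_of_norm_le one_pos
    (fun z _ => (h.integrable_exp_mul ha z).aestronglyMeasurable)
    (.of_forall fun x => (hd x).differentiableOn) (.of_forall fun x => (hd x t).hasDerivAt)
    (.of_forall fun x z hz => hC z ?_ x)
    ((integrable_exp_neg_mul_abs one_pos).const_mul C)).2.differentiableAt
  rw [mem_ball_iff_norm] at hz
  have h1 := (Complex.abs_re_le_norm (z - t)).trans hz.le
  have h2 := abs_add_le t.re (z.re - t.re)
  rw [add_sub_cancel] at h2
  rw [Complex.sub_re] at h1
  linarith

/-- The convolution formula for the two-sided Laplace transform of the product. -/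
theorem integral_exp_mul_eq (h : HasVerticalDecay φ a) (ha : a < 0) {t : ℂ} {σ : ℝ} (hσ : a < σ)
    (hσt : a < σ + t.re) :
    ∫ x : ℝ, Complex.exp (t * x) * (verticalIntegral φ x 0 * verticalIntegral φ (-x) 0) =
      2 * Real.pi * ∫ y : ℝ, φ (σ + Complex.I * y + t) * φ (σ + Complex.I * y) := by
  have h0 : a < (0 : ℂ).re := by simpa using ha
  have hσ' : a < (σ : ℂ).re := by simpa using hσ
  let K : ℝ → ℝ → ℂ := fun x y =>
    Complex.exp ((σ + Complex.I * y + t) * x) * verticalIntegral φ x 0 * φ (σ + Complex.I * y)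
  have hK : Integrable (Function.uncurry K) (volume.prod volume) := by
    have h1 := (h.integrable_exp_mul_verticalIntegral (z := σ + t) h0 (by simpa using hσt)).mul_prod
      (h.integrable_vertical hσ')
    refine h1.mono ?_ (.of_forall fun q => ?_)
    · refine Continuous.aestronglyMeasurable ?_
      have h2 := (h.continuous_verticalIntegral h0).comp (continuous_fst (X := ℝ) (Y := ℝ))
      have h3 := (h.continuous_vertical hσ').comp (continuous_snd (X := ℝ) (Y := ℝ))
      exact (Continuous.mul (by fun_prop) h2).mul h3
    · simp [K, Function.uncurry, Complex.norm_exp]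
  have hl (x : ℝ) : Complex.exp (t * x) * (verticalIntegral φ x 0 * verticalIntegral φ (-x) 0) =
      ∫ y, K x y := by
    rw [h.verticalIntegral_eq (-x) h0 hσ', ← mul_assoc]
    nth_rw 2 [verticalIntegral]
    rw [← integral_const_mul]
    congr 1 with y
    simp only [K]
    rw [show (σ + Complex.I * y + t) * x = t * x + -(σ + Complex.I * y) * ((-x : ℝ) : ℂ) by
      push_cast; ring, Complex.exp_add]
    ring
  have hr (y : ℝ) : ∫ x, K x y =
      2 * Real.pi * (φ (σ + Complex.I * y + t) * φ (σ + Complex.I * y)) := by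
    simp only [K]
    rw [integral_mul_const, h.integral_exp_mul_verticalIntegral h0 (by simpa using hσt)]
    ring
  simp_rw [hl]
  rw [integral_integral_swap hK, ← integral_const_mul]
  simp_rw [hr]

end HasVerticalDecay

theorem chernoff_mgf_entire_and_formula (Ai : ℂ → ℂ)
    (hAi_d1 : Differentiable ℂ Ai)
    (hAi_d2 : Differentiable ℂ (deriv Ai))
    (hAi_ode : ∀ z : ℂ, deriv (deriv Ai) z = z * Ai z)
    (hAi_0 : Ai 0 = (3 : ℂ) ^ (-(2 : ℂ) / 3) / Complex.Gamma (2 / 3))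
    (hAi_0' : deriv Ai 0 = -(3 : ℂ) ^ (-(1 : ℂ) / 3) / Complex.Gamma (1 / 3))
    (hAi_zeros : ∀ z : ℂ, Ai z = 0 → ∃ x : ℝ, x < 0 ∧ z = (x : ℂ))
    (a₁ : ℝ)
    (ha₁_zero : Ai (a₁ : ℂ) = 0)
    (ha₁_max : ∀ z : ℂ, Ai z = 0 → z.re ≤ a₁)
    (g : ℝ → ℝ)
    (hg : ∀ x : ℝ, (g x : ℂ) =
      (1 / (2 * (Real.pi : ℂ))) *
        ∫ t : ℝ, Complex.exp (-(Complex.I * t * x)) * ((Real.sqrt 2 : ℂ) / Ai (Complex.I * t)))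
    (f : ℝ → ℝ)
    (hf : ∀ x : ℝ, f x = (1 / 2) * g x * g (-x)) :
    (∀ t : ℂ, MeasureTheory.Integrable (fun x : ℝ => Complex.exp (t * x) * (f x : ℂ))) ∧
    Differentiable ℂ (fun t : ℂ => ∫ x : ℝ, Complex.exp (t * x) * (f x : ℂ)) ∧
    (∀ (t : ℂ) (σ : ℝ), a₁ < σ → a₁ < σ + t.re →
      ∫ x : ℝ, Complex.exp (t * x) * (f x : ℂ) =
        (1 / (2 * (Real.pi : ℂ))) *
          ∫ y : ℝ, 1 / (Ai ((σ : ℂ) + Complex.I * y + t) * Ai ((σ : ℂ) + Complex.I * y))) := by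
  have ha : a₁ < 0 := by
    obtain ⟨x, hx, hx'⟩ := hAi_zeros _ ha₁_zero
    rwa [Complex.ofReal_inj.1 hx']
  have h : HasVerticalDecay (fun z => (Ai z)⁻¹) a₁ :=
    ⟨fun z hz => (hAi_d1 z).inv fun h0 => (ha₁_max z h0).not_gt hz, fun s₁ s₂ hs =>
      exists_norm_inv_airy_le hAi_d1.continuous
        (airy_eq_contour hAi_d1 hAi_d2 hAi_ode hAi_0 hAi_0') ha₁_max hs⟩
  have hg' (x : ℝ) : (g x : ℂ) =
      Real.sqrt 2 / (2 * Real.pi) * verticalIntegral (fun z => (Ai z)⁻¹) x 0 := by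
    rw [hg, verticalIntegral, ← integral_const_mul, ← integral_const_mul]
    congr 1 with y
    rw [zero_add, neg_mul, div_eq_mul_inv _ (Ai _)]
    ring
  have hpi : (Real.pi : ℂ) ≠ 0 := Complex.ofReal_ne_zero.2 Real.pi_ne_zero
  have hf' (t : ℂ) (x : ℝ) : Complex.exp (t * x) * (f x : ℂ) = 1 / (2 * Real.pi) ^ 2 *
      (Complex.exp (t * x) * (verticalIntegral (fun z => (Ai z)⁻¹) x 0 *
        verticalIntegral (fun z => (Ai z)⁻¹) (-x) 0)) := by
    have h2 : (Real.sqrt 2 : ℂ) ^ 2 = 2 := by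
      rw [← Complex.ofReal_pow, Real.sq_sqrt zero_le_two, Complex.ofReal_ofNat]
    rw [hf]
    push_cast
    rw [hg', hg']
    generalize verticalIntegral _ x 0 = A, verticalIntegral _ (-x) 0 = B
    field_simp
    linear_combination A * B * h2
  simp_rw [hf']
  refine ⟨fun t => (h.integrable_exp_mul ha t).const_mul _, ?_, fun t σ hσ hσt => ?_⟩
  · simp_rw [integral_const_mul]
    exact (h.differentiable_integral_exp_mul ha).const_mul _
  · rw [integral_const_mul, h.integral_exp_mul_eq ha hσ hσt]
    simp_rw [one_div, mul_inv]
    field_simp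
end

section
/- For every integer n ≥ 0, the n-th moment of the Chernoff density satisfies ∫_ℝ x^n f(x) dx = (1/(2πi)) ∫_{−i∞}^{i∞} (d^n/dz^n)(1/Ai)(z) · (1/Ai(z)) dz, i.e. it equals (1/(2π)) ∫_ℝ (d^n/dz^n)(1/Ai)(iy) / Ai(iy) dy, where (d^n/dz^n)(1/Ai) denotes the n-th complex derivative of the function z ↦ 1/Ai(z). -/
open scoped FourierTransform SchwartzMap

theorem le_of_hasDerivAt_nonneg {φ φ' : ℝ → ℝ} (h : ∀ y, HasDerivAt φ (φ' y) y) {a b : ℝ}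
    (hab : a ≤ b) (h' : ∀ y, a ≤ y → 0 ≤ φ' y) : φ a ≤ φ b := by
  have hm : MonotoneOn φ (Set.Ici a) := by
    apply monotoneOn_of_deriv_nonneg (convex_Ici a)
    · exact fun y _ => (h y).continuousAt.continuousWithinAt
    · exact fun y _ => (h y).differentiableAt.differentiableWithinAt
    · intro y hy
      rw [interior_Ici] at hy
      rw [(h y).deriv]
      exact h' y (le_of_lt hy)
  exact hm Set.self_mem_Ici hab hab

theorem exists_nonneg_of_hasDerivAt_ge {φ φ' : ℝ → ℝ} (h : ∀ y, HasDerivAt φ (φ' y) y)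
    {a ε : ℝ} (hε : 0 < ε) (h' : ∀ y, a ≤ y → ε ≤ φ' y) : ∃ b, a ≤ b ∧ ∀ y, b ≤ y → 0 ≤ φ y := by
  refine ⟨a + |φ a| / ε, by have := div_nonneg (abs_nonneg (φ a)) hε.le; linarith, fun y hy => ?_⟩
  have h0 := div_nonneg (abs_nonneg (φ a)) hε.le
  have h1 : φ a - ε * a ≤ φ y - ε * y :=
    le_of_hasDerivAt_nonneg (φ := fun y => φ y - ε * y) (φ' := fun y => φ' y - ε)
      (fun y => ((h y).sub ((hasDerivAt_id y).const_mul ε)).congr_deriv (by ring)) (by linarith)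
      (fun y hy => by linarith [h' y hy])
  have h2 : |φ a| ≤ ε * (y - a) := by
    have : |φ a| / ε ≤ y - a := by linarith
    rwa [div_le_iff₀' hε] at this
  linarith [neg_abs_le (φ a)]

/-- The quadratic quantities `u = |w|²`, `P + i Q = w' * conj w`, `M = |w'|²` attached to a solution
of `w'' = -i y w` (with `V = -Q`): `u` grows exponentially and `M / u` at most polynomially. -/
theorem energy_growth {u P V M : ℝ → ℝ} (hu : ∀ y, HasDerivAt u (2 * P y) y)
    (hP : ∀ y, HasDerivAt P (M y) y) (hV : ∀ y, HasDerivAt V (y * u y) y)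
    (hM : ∀ y, M y * u y = P y ^ 2 + V y ^ 2) (hM0 : ∀ y, 0 ≤ M y)
    (u0 : 0 < u 0) (P0 : P 0 = 0) (V0 : 0 ≤ V 0) :
    (∃ C, 0 < C ∧ ∀ y, 0 ≤ y → C * Real.exp (2 * y) ≤ u y) ∧
      ∃ B, 0 ≤ B ∧ ∀ y, 0 ≤ y → M y ≤ (B * (1 + y) ^ 5) ^ 2 * u y := by
  have Pnn : ∀ y, 0 ≤ y → 0 ≤ P y := fun y hy =>
    P0.ge.trans (le_of_hasDerivAt_nonneg hP hy fun y _ => hM0 y)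
  have ule : ∀ y, 0 ≤ y → u 0 ≤ u y := fun y hy =>
    le_of_hasDerivAt_nonneg hu hy fun y hy => by linarith [Pnn y hy]
  have upos : ∀ y, 0 ≤ y → 0 < u y := fun y hy => u0.trans_le (ule y hy)
  have Vnn : ∀ y, 0 ≤ y → 0 ≤ V y := fun y hy =>
    V0.trans (le_of_hasDerivAt_nonneg hV hy fun y hy => mul_nonneg hy (upos y hy).le)
  constructor
  · obtain ⟨y₁, hy₁, h₁⟩ := exists_nonneg_of_hasDerivAt_ge
      (φ := fun y => P y + V y - 5 * u y) (φ' := fun y => M y + y * u y - 5 * (2 * P y))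
      (fun y => ((hP y).add (hV y)).sub ((hu y).const_mul 5)) (a := 26) u0 (by
        intro y hy
        have hy0 : (0 : ℝ) ≤ y := by linarith
        have h1 : 0 ≤ M y + 25 * u y - 10 * P y := by
          refine nonneg_of_mul_nonneg_left (b := u y) ?_ (upos y hy0)
          nlinarith [hM y, sq_nonneg (P y - 5 * u y), sq_nonneg (V y)]
        nlinarith [ule y hy0, upos y hy0])
    obtain ⟨y₂, hy₂, h₂⟩ := exists_nonneg_of_hasDerivAt_ge
      (φ := fun y => P y - u y) (φ' := fun y => M y - 2 * P y)
      (fun y => (hP y).sub (hu y)) (a := y₁) u0 (by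
        intro y hy
        have hy0 : (0 : ℝ) ≤ y := by linarith
        have h0 := upos y hy0
        have h1 := h₁ y hy
        have h2 : 0 ≤ M y - 2 * P y - u y := by
          refine nonneg_of_mul_nonneg_left (b := u y) ?_ h0
          have h3 : 2 * u y ^ 2 ≤ (P y - u y) ^ 2 + V y ^ 2 := by
            rcases le_total (2 * u y) (V y) with h | h
            · nlinarith [sq_nonneg (P y - u y)]
            · nlinarith [sq_nonneg (V y)]
          nlinarith [hM y]
        linarith [ule y hy0])
    have hy₂0 : (0 : ℝ) ≤ y₂ := by linarith
    refine ⟨u 0 * Real.exp (-(2 * y₂)), by positivity, fun y hy => ?_⟩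
    rw [mul_assoc, ← Real.exp_add]
    rcases le_total y y₂ with h | h
    · calc u 0 * Real.exp (-(2 * y₂) + 2 * y) ≤ u 0 * 1 := by
            gcongr
            rw [Real.exp_le_one_iff]
            linarith
        _ ≤ u y := by simpa using ule y hy
    · have h3 : u y₂ * Real.exp (-(2 * y₂)) ≤ u y * Real.exp (-(2 * y)) :=
        le_of_hasDerivAt_nonneg (φ := fun y => u y * Real.exp (-(2 * y)))
          (φ' := fun y => 2 * P y * Real.exp (-(2 * y)) + u y * (Real.exp (-(2 * y)) * (-(2 * 1))))
          (fun y => (hu y).mul (((hasDerivAt_id y).const_mul 2).neg.exp)) h (by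
            intro y hy
            have := h₂ y hy
            nlinarith [Real.exp_pos (-(2 * y))])
      calc u 0 * Real.exp (-(2 * y₂) + 2 * y)
          = u 0 * Real.exp (-(2 * y₂)) * Real.exp (2 * y) := by rw [Real.exp_add]; ring
        _ ≤ u y₂ * Real.exp (-(2 * y₂)) * Real.exp (2 * y) := by
            gcongr
            exact ule y₂ hy₂0
        _ ≤ u y * Real.exp (-(2 * y)) * Real.exp (2 * y) := by gcongr
        _ = u y := by rw [mul_assoc, ← Real.exp_add]; simp
  · set a := V 0 / u 0 with ha
    have a0 : 0 ≤ a := div_nonneg V0 u0.le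
    have hVu : ∀ y, 0 ≤ y → V y ≤ (a + y ^ 2 / 2) * u y := by
      intro y hy
      have h := le_of_hasDerivAt_nonneg (φ := fun y => (a + y ^ 2 / 2) * u y - V y)
        (φ' := fun y => (a + y ^ 2 / 2) * (2 * P y))
        (fun y => by
          have h := ((((hasDerivAt_pow 2 y).div_const 2).const_add a).mul (hu y)).sub (hV y)
          refine h.congr_deriv ?_
          simp) hy
        (fun y hy => by have := Pnn y hy; positivity)
      have h0 : a * u 0 = V 0 := by rw [ha]; field_simp
      linarith
    have hPu : ∀ y, 0 ≤ y → P y ≤ (y * (a + y ^ 2 / 2) ^ 2) * u y := by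
      intro y hy
      have hanti : MonotoneOn (fun y => y * (a + y ^ 2 / 2) ^ 2 - P y / u y)
          (Set.Ici 0) := by
        have hd : ∀ y, 0 ≤ y → HasDerivAt
            (fun y => y * (a + y ^ 2 / 2) ^ 2 - P y / u y)
            ((a + y ^ 2 / 2) ^ 2 + 2 * y ^ 2 * (a + y ^ 2 / 2)
              - (M y * u y - P y * (2 * P y)) / u y ^ 2) y := by
          intro y hy
          have h := (((hasDerivAt_id y).mul
            ((((hasDerivAt_pow 2 y).div_const 2).const_add a).pow 2))).sub
              ((hP y).div (hu y) (upos y hy).ne')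
          refine h.congr_deriv ?_
          simp
          ring
        apply monotoneOn_of_deriv_nonneg (convex_Ici 0)
        · exact fun y hy => (hd y hy).continuousAt.continuousWithinAt
        · rw [interior_Ici]
          exact fun y hy => (hd y (le_of_lt hy)).differentiableAt.differentiableWithinAt
        · rw [interior_Ici]
          intro y hy
          have hy : 0 ≤ y := le_of_lt hy
          rw [(hd y hy).deriv]
          have h1 : (M y * u y - P y * (2 * P y)) / u y ^ 2 ≤ (a + y ^ 2 / 2) ^ 2 := by
            rw [div_le_iff₀ (pow_pos (upos y hy) 2), hM, ← mul_pow]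
            have := pow_le_pow_left₀ (Vnn y hy) (hVu y hy) 2
            nlinarith [sq_nonneg (P y)]
          have h2 : 0 ≤ 2 * y ^ 2 * (a + y ^ 2 / 2) := by positivity
          linarith
      have h := hanti Set.self_mem_Ici (Set.mem_Ici.2 hy) hy
      simp only [zero_mul, P0, zero_div, sub_self] at h
      rw [← div_le_iff₀ (upos y hy)]
      linarith
    refine ⟨2 * (a + 1) ^ 2, by positivity, fun y hy => ?_⟩
    have hu' := upos y hy
    have hb : a + y ^ 2 / 2 ≤ (a + 1) * (1 + y) ^ 2 := by
      nlinarith [mul_nonneg a0 hy, mul_nonneg a0 (sq_nonneg y)]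
    have hb0 : 0 ≤ a + y ^ 2 / 2 := by positivity
    have ht : 1 ≤ 1 + y := by linarith
    have h1 : a + y ^ 2 / 2 ≤ (a + 1) ^ 2 * (1 + y) ^ 5 := by
      refine hb.trans ?_
      gcongr ?_ * ?_
      · nlinarith
      · exact pow_le_pow_right₀ ht (by norm_num)
    have h2 : y * (a + y ^ 2 / 2) ^ 2 ≤ (a + 1) ^ 2 * (1 + y) ^ 5 := by
      calc y * (a + y ^ 2 / 2) ^ 2 ≤ (1 + y) * ((a + 1) * (1 + y) ^ 2) ^ 2 := by
            gcongr
            linarith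
        _ = _ := by ring
    have hP2 := pow_le_pow_left₀ (Pnn y hy)
      ((hPu y hy).trans (mul_le_mul_of_nonneg_right h2 hu'.le)) 2
    have hV2 := pow_le_pow_left₀ (Vnn y hy)
      ((hVu y hy).trans (mul_le_mul_of_nonneg_right h1 hu'.le)) 2
    refine le_of_mul_le_mul_right ?_ hu'
    rw [hM]
    calc P y ^ 2 + V y ^ 2 ≤ 2 * ((a + 1) ^ 2 * (1 + y) ^ 5 * u y) ^ 2 := by linarith
      _ ≤ 4 * ((a + 1) ^ 2 * (1 + y) ^ 5 * u y) ^ 2 := by gcongr; norm_num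
      _ = _ := by ring

theorem iteratedDeriv_eq_of_hasDerivAt_succ {D : ℕ → ℝ → ℂ}
    (hD : ∀ n t, HasDerivAt (D n) (D (n + 1) t) t) (n : ℕ) : iteratedDeriv n (D 0) = D n := by
  induction n with
  | zero => exact iteratedDeriv_zero
  | succ n ih =>
    rw [iteratedDeriv_succ, ih]
    exact funext fun t => (hD n t).deriv

theorem exists_schwartzMap_of_hasDerivAt_succ {D : ℕ → ℝ → ℂ}
    (hD : ∀ n t, HasDerivAt (D n) (D (n + 1) t) t)
    (hdecay : ∀ k n : ℕ, ∃ C : ℝ, ∀ t, |t| ^ k * ‖D n t‖ ≤ C) :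
    ∃ S : 𝓢(ℝ, ℂ), ∀ t, S t = D 0 t := by
  refine ⟨⟨D 0, ?_, fun k n => ?_⟩, fun t => rfl⟩
  · refine contDiff_of_differentiable_iteratedDeriv fun m _ => ?_
    rw [iteratedDeriv_eq_of_hasDerivAt_succ hD]
    exact fun t => (hD m t).differentiableAt
  · obtain ⟨C, hC⟩ := hdecay k n
    refine ⟨C, fun t => ?_⟩
    rw [norm_iteratedFDeriv_eq_norm_iteratedDeriv, iteratedDeriv_eq_of_hasDerivAt_succ hD]
    exact hC t

/-- Parseval's identity for `∫ xⁿ b(x) b(-x) dx`, where `b` is the inverse Fourier transform (with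
kernel `exp (-itx) / 2π`) of a rapidly decreasing function. -/
theorem integral_pow_mul_fourier_mul_fourier_neg {D : ℕ → ℝ → ℂ}
    (hD : ∀ n t, HasDerivAt (D n) (D (n + 1) t) t)
    (hdecay : ∀ k n : ℕ, ∃ C : ℝ, ∀ t, |t| ^ k * ‖D n t‖ ≤ C) {b : ℝ → ℂ}
    (hb : ∀ x : ℝ, b x = (1 / (2 * (Real.pi : ℂ))) *
      ∫ t : ℝ, Complex.exp (-(Complex.I * t * x)) * D 0 t) (n : ℕ) :
    ∫ x : ℝ, (Complex.I * x) ^ n * (b x * b (-x)) =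
      (1 / (2 * (Real.pi : ℂ))) * ∫ t : ℝ, D n t * D 0 t := by
  obtain ⟨S, hS⟩ := exists_schwartzMap_of_hasDerivAt_succ hD hdecay
  obtain ⟨T, hT⟩ := exists_schwartzMap_of_hasDerivAt_succ (D := fun m => D (n + m))
    (fun m => hD (n + m)) (fun k m => hdecay k (n + m))
  have hS' : (S : ℝ → ℂ) = D 0 := funext hS
  have hT' : (T : ℝ → ℂ) = iteratedDeriv n (D 0) := by
    rw [iteratedDeriv_eq_of_hasDerivAt_succ hD]
    exact funext hT
  have hint : ∀ m : ℕ, MeasureTheory.Integrable (iteratedDeriv m (D 0)) := fun m => by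
    obtain ⟨U, hU⟩ := exists_schwartzMap_of_hasDerivAt_succ (D := fun k => D (m + k))
      (fun k => hD (m + k)) (fun k l => hdecay k (m + l))
    rw [iteratedDeriv_eq_of_hasDerivAt_succ hD]
    exact (funext hU : (U : ℝ → ℂ) = D m) ▸ U.integrable
  have hfour : ∀ ξ : ℝ, (𝓕 T) ξ = (2 * Real.pi * Complex.I * ξ) ^ n * (𝓕 S) ξ := fun ξ => by
    rw [SchwartzMap.fourier_coe, SchwartzMap.fourier_coe, hT', hS',
      Real.fourier_iteratedDeriv (N := ⊤) (hS' ▸ S.smooth') (fun m _ => hint m) le_top]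
    rfl
  have hbS : ∀ ξ : ℝ, b (2 * Real.pi * ξ) = 1 / (2 * (Real.pi : ℂ)) * (𝓕 S) ξ := fun ξ => by
    rw [SchwartzMap.fourier_coe, hS', Real.fourier_real_eq_integral_exp_smul, hb]
    congr 2
    ext t
    rw [smul_eq_mul]
    congr 2
    push_cast
    ring
  have hbS' : ∀ ξ : ℝ, b (-(2 * Real.pi * ξ)) = 1 / (2 * (Real.pi : ℂ)) * (𝓕⁻ S) ξ := fun ξ => by
    rw [SchwartzMap.fourierInv_coe, Real.fourierInv_eq_fourier_neg, ← SchwartzMap.fourier_coe,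
      ← hbS, mul_neg]
  have hpi : (2 * (Real.pi : ℂ)) ≠ 0 := by simp [Real.pi_ne_zero]
  have hscale := MeasureTheory.Measure.integral_comp_mul_left
    (fun x : ℝ => (Complex.I * x) ^ n * (b x * b (-x))) (2 * Real.pi)
  rw [abs_of_pos (by positivity)] at hscale
  have hself : ∫ ξ : ℝ, (𝓕 T) ξ * (𝓕⁻ S) ξ = ∫ t : ℝ, D n t * D 0 t := by
    rw [SchwartzMap.integral_fourier_mul_eq, FourierTransform.fourier_fourierInv_eq]
    simp only [hS, hT, add_zero]
  have hval : ∀ ξ : ℝ, (Complex.I * ((2 * Real.pi * ξ : ℝ) : ℂ)) ^ n *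
      (b (2 * Real.pi * ξ) * b (-(2 * Real.pi * ξ))) =
        (1 / (2 * (Real.pi : ℂ))) ^ 2 * ((𝓕 T) ξ * (𝓕⁻ S) ξ) := fun ξ => by
    rw [hbS, hbS', hfour]
    push_cast
    ring
  simp only [hval] at hscale
  rw [MeasureTheory.integral_const_mul, hself, Complex.real_smul] at hscale
  push_cast at hscale
  field_simp at hscale ⊢
  exact hscale.symm

/-- Growth of a solution of Airy's equation along the half-line `s i [0, ∞)`, `s = ±1`. -/
theorem airy_growth_half_line {Ai : ℂ → ℂ} (h₁ : Differentiable ℂ Ai)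
    (h₂ : Differentiable ℂ (deriv Ai)) (hode : ∀ z : ℂ, deriv (deriv Ai) z = z * Ai z)
    {a b : ℝ} (ha : 0 < a) (hb : 0 < b) (h0 : Ai 0 = a) (h0' : deriv Ai 0 = -(b : ℂ))
    {s : ℝ} (hs : s ^ 2 = 1) :
    ∃ C, 0 < C ∧ ∃ B, 0 ≤ B ∧ ∀ y : ℝ, 0 ≤ y →
      C * Real.exp y ≤ ‖Ai (Complex.I * (s * y : ℝ))‖ ∧
      ‖deriv Ai (Complex.I * (s * y : ℝ))‖ ≤ B * (1 + y) ^ 5 * ‖Ai (Complex.I * (s * y : ℝ))‖ := by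
  have hline : ∀ y : ℝ, HasDerivAt (fun y : ℝ => Complex.I * (s * y : ℝ)) (Complex.I * s) y :=
    fun y => by
      have h := (((hasDerivAt_id y).const_mul s).ofReal_comp).const_mul Complex.I
      simpa using h
  have hA : ∀ y : ℝ, HasDerivAt (fun y : ℝ => Ai (Complex.I * (s * y : ℝ)))
      (deriv Ai (Complex.I * (s * y : ℝ)) * (Complex.I * s)) y := fun y =>
    HasDerivAt.comp y (h₁ _).hasDerivAt (hline y)
  have hA' : ∀ y : ℝ, HasDerivAt (fun y : ℝ => deriv Ai (Complex.I * (s * y : ℝ)))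
      (Complex.I * (s * y : ℝ) * Ai (Complex.I * (s * y : ℝ)) * (Complex.I * s)) y := fun y => by
    have h := HasDerivAt.comp y (h₂ _).hasDerivAt (hline y)
    rwa [hode] at h
  have hre : ∀ {w : ℝ → ℂ} {w' : ℂ} {y : ℝ}, HasDerivAt w w' y →
      HasDerivAt (fun y => (w y).re) w'.re y := fun h =>
    Complex.reCLM.hasFDerivAt.comp_hasDerivAt _ h
  have him : ∀ {w : ℝ → ℂ} {w' : ℂ} {y : ℝ}, HasDerivAt w w' y →
      HasDerivAt (fun y => (w y).im) w'.im y := fun h =>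
    Complex.imCLM.hasFDerivAt.comp_hasDerivAt _ h
  set A : ℝ → ℂ := fun y => Ai (Complex.I * (s * y : ℝ))
  set A' : ℝ → ℂ := fun y => deriv Ai (Complex.I * (s * y : ℝ))
  replace hA' : ∀ y, HasDerivAt A' (Complex.I * (s * y : ℝ) * A y * (Complex.I * s)) y := hA'
  have dα : ∀ y, HasDerivAt (fun y => (A y).re) (-s * (A' y).im) y := fun y =>
    (hre (hA y)).congr_deriv (by simp [A']; ring)
  have dβ : ∀ y, HasDerivAt (fun y => (A y).im) (s * (A' y).re) y := fun y =>
    (him (hA y)).congr_deriv (by simp [A']; ring)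
  have dγ : ∀ y, HasDerivAt (fun y => (A' y).re) (-(y * (A y).re)) y := fun y =>
    (hre (hA' y)).congr_deriv (by simp; linear_combination (y * (A y).re) * hs)
  have dδ : ∀ y, HasDerivAt (fun y => (A' y).im) (-(y * (A y).im)) y := fun y =>
    (him (hA' y)).congr_deriv (by simp; linear_combination (y * (A y).im) * hs)
  have hA0 : A 0 = a := by simp [A, h0]
  have hA0' : A' 0 = -(b : ℂ) := by simp [A', h0']
  obtain ⟨⟨C, hC, hCu⟩, B, hB, hBu⟩ := energy_growth
    (u := fun y => (A y).re * (A y).re + (A y).im * (A y).im)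
    (P := fun y => s * ((A y).im * (A' y).re - (A y).re * (A' y).im))
    (V := fun y => -((A y).re * (A' y).re + (A y).im * (A' y).im))
    (M := fun y => (A' y).re * (A' y).re + (A' y).im * (A' y).im)
    (fun y => (((dα y).mul (dα y)).add ((dβ y).mul (dβ y))).congr_deriv (by ring))
    (fun y => ((((dβ y).mul (dγ y)).sub ((dα y).mul (dδ y))).const_mul s).congr_deriv
      (by linear_combination ((A' y).re ^ 2 + (A' y).im ^ 2) * hs))
    (fun y => (((dα y).mul (dγ y)).add ((dβ y).mul (dδ y))).neg.congr_deriv (by ring))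
    (fun y => by
      linear_combination (-((A y).im * (A' y).re - (A y).re * (A' y).im) ^ 2) * hs)
    (fun y => add_nonneg (mul_self_nonneg _) (mul_self_nonneg _))
    (by simp [hA0, ha]) (by simp [hA0, hA0']) (by simpa [hA0, hA0'] using (mul_pos ha hb).le)
  have hsq : ∀ z : ℂ, z.re * z.re + z.im * z.im = ‖z‖ ^ 2 := fun z => by
    rw [← Complex.normSq_apply, Complex.normSq_eq_norm_sq]
  simp only [hsq] at hCu hBu
  refine ⟨√C, Real.sqrt_pos.2 hC, B, hB, fun y hy => ⟨?_, ?_⟩⟩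
  · refine (pow_le_pow_iff_left₀ (by positivity) (norm_nonneg _) two_ne_zero).1 ?_
    rw [mul_pow, Real.sq_sqrt hC.le, ← Real.exp_nat_mul]
    exact_mod_cast hCu y hy
  · refine (pow_le_pow_iff_left₀ (norm_nonneg _) (by positivity) two_ne_zero).1 ?_
    rw [mul_pow]
    exact hBu y hy

theorem airy_growth_imaginary_axis {Ai : ℂ → ℂ} (h₁ : Differentiable ℂ Ai)
    (h₂ : Differentiable ℂ (deriv Ai)) (hode : ∀ z : ℂ, deriv (deriv Ai) z = z * Ai z)
    {a b : ℝ} (ha : 0 < a) (hb : 0 < b) (h0 : Ai 0 = a) (h0' : deriv Ai 0 = -(b : ℂ)) :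
    ∃ C, 0 < C ∧ ∃ B, 0 ≤ B ∧ ∀ t : ℝ, C * Real.exp |t| ≤ ‖Ai (Complex.I * t)‖ ∧
      ‖deriv Ai (Complex.I * t)‖ ≤ B * (1 + |t|) ^ 5 * ‖Ai (Complex.I * t)‖ := by
  obtain ⟨C₁, hC₁, B₁, hB₁, hp⟩ :=
    airy_growth_half_line h₁ h₂ hode ha hb h0 h0' (s := 1) (by norm_num)
  obtain ⟨C₂, hC₂, B₂, hB₂, hn⟩ :=
    airy_growth_half_line h₁ h₂ hode ha hb h0 h0' (s := -1) (by norm_num)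
  refine ⟨min C₁ C₂, lt_min hC₁ hC₂, max B₁ B₂, hB₁.trans (le_max_left _ _), fun t => ?_⟩
  rcases le_total 0 t with ht | ht
  · obtain ⟨i, j⟩ := hp |t| (abs_nonneg t)
    rw [one_mul, abs_of_nonneg ht] at i j
    rw [abs_of_nonneg ht]
    refine ⟨le_trans ?_ i, j.trans ?_⟩ <;> gcongr
    · exact min_le_left _ _
    · exact le_max_left _ _
  · obtain ⟨i, j⟩ := hn |t| (abs_nonneg t)
    rw [abs_of_nonpos ht, neg_one_mul, neg_neg] at i j
    rw [abs_of_nonpos ht]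
    have ht' : 0 ≤ 1 + -t := by linarith
    refine ⟨le_trans ?_ i, j.trans ?_⟩ <;> gcongr
    · exact min_le_right _ _
    · exact le_max_right _ _

/-- The `n`-th derivative of `1 / Ai` is a polynomial in `z` and `Ai' / Ai`, times `1 / Ai`. -/
theorem exists_mem_adjoin_iteratedDeriv_one_div {Ai : ℂ → ℂ} (h₁ : Differentiable ℂ Ai)
    (h₂ : Differentiable ℂ (deriv Ai)) (hode : ∀ z : ℂ, deriv (deriv Ai) z = z * Ai z) (n : ℕ) :
    ∃ G ∈ Algebra.adjoin ℂ ({id, fun z => deriv Ai z / Ai z} : Set (ℂ → ℂ)), ∀ z, Ai z ≠ 0 →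
      iteratedDeriv n (fun z => 1 / Ai z) z = G z * (1 / Ai z) ∧
      HasDerivAt (iteratedDeriv n (fun z => 1 / Ai z))
        (iteratedDeriv (n + 1) (fun z => 1 / Ai z) z) z := by
  set q : ℂ → ℂ := fun z => deriv Ai z / Ai z with hq
  set R := Algebra.adjoin ℂ ({id, q} : Set (ℂ → ℂ))
  have hidR : id ∈ R := Algebra.subset_adjoin (by simp)
  have hqR : q ∈ R := Algebra.subset_adjoin (by simp)
  have hdq : ∀ z, Ai z ≠ 0 → HasDerivAt q (z - q z * q z) z := fun z hz => by
    have h := (h₂ z).hasDerivAt.div (h₁ z).hasDerivAt hz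
    rw [hode] at h
    refine h.congr_deriv ?_
    simp only [hq]
    field_simp
  have hdF : ∀ z, Ai z ≠ 0 → HasDerivAt (fun z => 1 / Ai z) (-(q z) * (1 / Ai z)) z :=
    fun z hz => by
      have h := (hasDerivAt_const z (1 : ℂ)).div (h₁ z).hasDerivAt hz
      refine h.congr_deriv ?_
      simp only [hq]
      field_simp
      simp
  have hder : ∀ G ∈ R, ∃ G' ∈ R, ∀ z, Ai z ≠ 0 → HasDerivAt G (G' z) z := fun G hG => by
    induction hG using Algebra.adjoin_induction with
    | mem x hx =>
      rcases hx with rfl | rfl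
      · exact ⟨1, one_mem _, fun z _ => hasDerivAt_id z⟩
      · exact ⟨id - q * q, sub_mem hidR (mul_mem hqR hqR), hdq⟩
    | algebraMap r => exact ⟨0, zero_mem _, fun z _ => hasDerivAt_const z r⟩
    | add x y _ _ ihx ihy =>
      obtain ⟨x', hx', hx⟩ := ihx
      obtain ⟨y', hy', hy⟩ := ihy
      exact ⟨x' + y', add_mem hx' hy', fun z hz => (hx z hz).add (hy z hz)⟩
    | mul x y hxR hyR ihx ihy =>
      obtain ⟨x', hx', hx⟩ := ihx
      obtain ⟨y', hy', hy⟩ := ihy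
      exact ⟨x' * y + x * y', add_mem (mul_mem hx' hyR) (mul_mem hxR hy'),
        fun z hz => (hx z hz).mul (hy z hz)⟩
  have hopen : ∀ z, Ai z ≠ 0 → ∀ᶠ w in nhds z, Ai w ≠ 0 := fun z hz =>
    h₁.continuous.continuousAt.eventually_ne hz
  have step : ∀ {G : ℂ → ℂ} {n : ℕ}, G ∈ R →
      (∀ z, Ai z ≠ 0 → iteratedDeriv n (fun z => 1 / Ai z) z = G z * (1 / Ai z)) →
      ∃ G' ∈ R, ∀ z, Ai z ≠ 0 →
        HasDerivAt (iteratedDeriv n (fun z => 1 / Ai z)) (G' z * (1 / Ai z)) z := by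
    intro G n hG hn
    obtain ⟨G', hG', hd⟩ := hder G hG
    refine ⟨G' - G * q, sub_mem hG' (mul_mem hG hqR), fun z hz => ?_⟩
    have h := ((hd z hz).mul (hdF z hz)).congr_of_eventuallyEq ((hopen z hz).mono hn)
    refine h.congr_deriv ?_
    simp only [Pi.sub_apply, Pi.mul_apply]
    ring
  have main : ∃ G ∈ R, ∀ z, Ai z ≠ 0 →
      iteratedDeriv n (fun z => 1 / Ai z) z = G z * (1 / Ai z) := by
    induction n with
    | zero => exact ⟨1, one_mem _, fun z _ => by simp⟩
    | succ n ih =>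
      obtain ⟨G, hG, hn⟩ := ih
      obtain ⟨G', hG', hd⟩ := step hG hn
      exact ⟨G', hG', fun z hz => by rw [iteratedDeriv_succ, (hd z hz).deriv]⟩
  obtain ⟨G, hG, hn⟩ := main
  obtain ⟨G', -, hd⟩ := step hG hn
  refine ⟨G, hG, fun z hz => ⟨hn z hz, ?_⟩⟩
  rw [iteratedDeriv_succ]
  exact (hd z hz).differentiableAt.hasDerivAt

theorem exists_norm_le_of_mem_adjoin {q : ℂ → ℂ} {B : ℝ} (hB : 0 ≤ B)
    (hq : ∀ t : ℝ, ‖q (Complex.I * t)‖ ≤ B * (1 + |t|) ^ 5) {G : ℂ → ℂ}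
    (hG : G ∈ Algebra.adjoin ℂ ({id, q} : Set (ℂ → ℂ))) :
    ∃ K, 0 ≤ K ∧ ∃ k : ℕ, ∀ t : ℝ, ‖G (Complex.I * t)‖ ≤ K * (1 + |t|) ^ k := by
  induction hG using Algebra.adjoin_induction with
  | mem x hx =>
    rcases hx with rfl | rfl
    · exact ⟨1, zero_le_one, 1, fun t => by simp⟩
    · exact ⟨B, hB, 5, hq⟩
  | algebraMap r => exact ⟨‖r‖, norm_nonneg _, 0, fun t => by simp⟩
  | add x y _ _ ihx ihy =>
    obtain ⟨K, hK, k, hx⟩ := ihx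
    obtain ⟨L, hL, l, hy⟩ := ihy
    refine ⟨K + L, by positivity, k + l, fun t => ?_⟩
    have ht : 1 ≤ 1 + |t| := by simp
    calc ‖x (Complex.I * t) + y (Complex.I * t)‖ ≤ K * (1 + |t|) ^ k + L * (1 + |t|) ^ l :=
          norm_add_le_of_le (hx t) (hy t)
      _ ≤ K * (1 + |t|) ^ (k + l) + L * (1 + |t|) ^ (k + l) := by
          gcongr <;> first | exact ht | omega
      _ = _ := by ring
  | mul x y _ _ ihx ihy =>
    obtain ⟨K, hK, k, hx⟩ := ihx
    obtain ⟨L, hL, l, hy⟩ := ihy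
    refine ⟨K * L, by positivity, k + l, fun t => ?_⟩
    calc ‖x (Complex.I * t) * y (Complex.I * t)‖
        ≤ (K * (1 + |t|) ^ k) * (L * (1 + |t|) ^ l) := by
          rw [norm_mul]
          exact mul_le_mul (hx t) (hy t) (norm_nonneg _) (by positivity)
      _ = _ := by ring

theorem airy_initial_values_s4 {Ai : ℂ → ℂ}
    (hAi_0 : Ai 0 = (3 : ℂ) ^ (-(2 : ℂ) / 3) / Complex.Gamma (2 / 3))
    (hAi_0' : deriv Ai 0 = -(3 : ℂ) ^ (-(1 : ℂ) / 3) / Complex.Gamma (1 / 3)) :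
    ∃ a b : ℝ, 0 < a ∧ 0 < b ∧ Ai 0 = a ∧ deriv Ai 0 = -(b : ℂ) := by
  refine ⟨(3 : ℝ) ^ (-(2 : ℝ) / 3) / Real.Gamma (2 / 3), (3 : ℝ) ^ (-(1 : ℝ) / 3) /
    Real.Gamma (1 / 3), ?_, ?_, ?_, ?_⟩
  · exact div_pos (by positivity) (Real.Gamma_pos_of_pos (by norm_num))
  · exact div_pos (by positivity) (Real.Gamma_pos_of_pos (by norm_num))
  · rw [hAi_0, Complex.ofReal_div, Complex.ofReal_cpow (by norm_num), ← Complex.Gamma_ofReal]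
    push_cast
    rfl
  · rw [hAi_0', Complex.ofReal_div, Complex.ofReal_cpow (by norm_num), ← Complex.Gamma_ofReal]
    push_cast
    rw [neg_div]

theorem exists_pow_mul_exp_neg_le (m : ℕ) : ∃ K, ∀ s : ℝ, 0 ≤ s →
    (1 + s) ^ m * Real.exp (-s) ≤ K := by
  refine ⟨m.factorial * Real.exp 1, fun s hs => ?_⟩
  have h := Real.pow_div_factorial_le_exp (1 + s) (by linarith) m
  rw [div_le_iff₀ (by positivity)] at h
  calc (1 + s) ^ m * Real.exp (-s) ≤ Real.exp (1 + s) * m.factorial * Real.exp (-s) := by gcongr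
    _ = m.factorial * (Real.exp (1 + s) * Real.exp (-s)) := by ring
    _ = _ := by rw [← Real.exp_add]; congr 2; ring

theorem chernoff_moment_formula (Ai : ℂ → ℂ)
    (hAi_d1 : Differentiable ℂ Ai)
    (hAi_d2 : Differentiable ℂ (deriv Ai))
    (hAi_ode : ∀ z : ℂ, deriv (deriv Ai) z = z * Ai z)
    (hAi_0 : Ai 0 = (3 : ℂ) ^ (-(2 : ℂ) / 3) / Complex.Gamma (2 / 3))
    (hAi_0' : deriv Ai 0 = -(3 : ℂ) ^ (-(1 : ℂ) / 3) / Complex.Gamma (1 / 3))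
    (hAi_zeros : ∀ z : ℂ, Ai z = 0 → ∃ x : ℝ, x < 0 ∧ z = (x : ℂ))
    (g : ℝ → ℝ)
    (hg : ∀ x : ℝ, (g x : ℂ) =
      (1 / (2 * (Real.pi : ℂ))) *
        ∫ t : ℝ, Complex.exp (-(Complex.I * t * x)) * ((Real.sqrt 2 : ℂ) / Ai (Complex.I * t)))
    (f : ℝ → ℝ)
    (hf : ∀ x : ℝ, f x = (1 / 2) * g x * g (-x)) :
    ∀ n : ℕ,
      ((∫ x : ℝ, x ^ n * f x : ℝ) : ℂ) =
        (1 / (2 * (Real.pi : ℂ))) *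
          ∫ y : ℝ,
            iteratedDeriv n (fun z : ℂ => 1 / Ai z) (Complex.I * y) / Ai (Complex.I * y) := by
  intro n
  obtain ⟨a, b, ha, hb, h0, h0'⟩ := airy_initial_values_s4 hAi_0 hAi_0'
  obtain ⟨C, hC, B, hB, hgrow⟩ :=
    airy_growth_imaginary_axis hAi_d1 hAi_d2 hAi_ode ha hb h0 h0'
  have hpos : ∀ t : ℝ, 0 < ‖Ai (Complex.I * t)‖ := fun t =>
    lt_of_lt_of_le (by positivity) (hgrow t).1
  have hne : ∀ t : ℝ, Ai (Complex.I * t) ≠ 0 := fun t => norm_pos_iff.1 (hpos t)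
  have hq : ∀ t : ℝ, ‖deriv Ai (Complex.I * t) / Ai (Complex.I * t)‖ ≤ B * (1 + |t|) ^ 5 :=
    fun t => by
      rw [norm_div, div_le_iff₀ (hpos t)]
      exact (hgrow t).2
  set F : ℂ → ℂ := fun z => 1 / Ai z with hF
  set D : ℕ → ℝ → ℂ := fun m t =>
    (Real.sqrt 2 : ℂ) * (Complex.I ^ m * iteratedDeriv m F (Complex.I * t)) with hDdef
  have hD : ∀ m t, HasDerivAt (D m) (D (m + 1) t) t := fun m t => by
    obtain ⟨_, _, h⟩ := exists_mem_adjoin_iteratedDeriv_one_div hAi_d1 hAi_d2 hAi_ode m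
    have hline : HasDerivAt (fun t : ℝ => Complex.I * (t : ℂ)) Complex.I t := by
      simpa using (Complex.ofRealCLM.hasDerivAt (x := t)).const_mul Complex.I
    have h' := ((HasDerivAt.comp t (h _ (hne t)).2 hline).const_mul
      (Complex.I ^ m)).const_mul (Real.sqrt 2 : ℂ)
    refine h'.congr_deriv ?_
    simp only [hDdef]
    ring
  have hdecay : ∀ k m : ℕ, ∃ L : ℝ, ∀ t, |t| ^ k * ‖D m t‖ ≤ L := fun k m => by
    obtain ⟨G, hG, h⟩ := exists_mem_adjoin_iteratedDeriv_one_div hAi_d1 hAi_d2 hAi_ode m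
    obtain ⟨K, hK, l, hGl⟩ := exists_norm_le_of_mem_adjoin hB hq hG
    obtain ⟨E, hE⟩ := exists_pow_mul_exp_neg_le (k + l)
    refine ⟨√2 * K / C * E, fun t => ?_⟩
    have hinv : 1 / ‖Ai (Complex.I * t)‖ ≤ 1 / C * Real.exp (-|t|) := by
      rw [Real.exp_neg, ← one_div, one_div_mul_one_div]
      exact one_div_le_one_div_of_le (by positivity) (hgrow t).1
    have hDn : ‖D m t‖ = √2 * (‖G (Complex.I * t)‖ * (1 / ‖Ai (Complex.I * t)‖)) := by
      simp only [hDdef, hF]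
      rw [(h _ (hne t)).1]
      simp [abs_of_nonneg (Real.sqrt_nonneg 2)]
    rw [hDn]
    calc |t| ^ k * (√2 * (‖G (Complex.I * t)‖ * (1 / ‖Ai (Complex.I * t)‖)))
        ≤ (1 + |t|) ^ k * (√2 * ((K * (1 + |t|) ^ l) * (1 / C * Real.exp (-|t|)))) := by
          gcongr
          · linarith
          · exact hGl t
      _ = √2 * K / C * ((1 + |t|) ^ (k + l) * Real.exp (-|t|)) := by ring
      _ ≤ √2 * K / C * E := by
          gcongr
          exact hE _ (abs_nonneg t)
  have key := integral_pow_mul_fourier_mul_fourier_neg hD hdecay (b := fun x => (g x : ℂ))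
    (fun x => by
      rw [hg]
      simp only [hDdef, hF, iteratedDeriv_zero, pow_zero, mul_one_div]) n
  have hl : ∀ x : ℝ, (Complex.I * x) ^ n * ((g x : ℂ) * (g (-x) : ℂ)) =
      2 * Complex.I ^ n * ((x ^ n * f x : ℝ) : ℂ) := fun x => by
    rw [hf]
    push_cast
    ring
  have hr : ∀ t : ℝ, D n t * D 0 t = 2 * Complex.I ^ n *
      (iteratedDeriv n F (Complex.I * t) / Ai (Complex.I * t)) := fun t => by
    have h2 : (Real.sqrt 2 : ℂ) ^ 2 = 2 := by
      rw [← Complex.ofReal_pow, Real.sq_sqrt (by norm_num)]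
      simp
    simp only [hDdef, iteratedDeriv_zero, pow_zero, one_mul]
    rw [show F (Complex.I * t) = 1 / Ai (Complex.I * t) from rfl]
    linear_combination (Complex.I ^ n * iteratedDeriv n F (Complex.I * t) *
      (1 / Ai (Complex.I * t))) * h2
  simp only [hl, hr, MeasureTheory.integral_const_mul] at key
  rw [integral_complex_ofReal] at key
  have hne2 : 2 * Complex.I ^ n ≠ 0 := by simp
  refine mul_left_cancel₀ hne2 ?_
  rw [key]
  ring
end
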